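/- Let Ω be a pseudoconvex domain in ℂⁿ, let p be a strictly pseudoconvex boundary point of Ω of class C², and let V be a bounded neighborhood of p. Then there exist a neighborhood U ⊆ V of p and a constant C > 0 such that for every z ∈ Ω ∩ U, 1 ≥ J⁰_Ω(z)/J⁰_{Ω∩V}(z) ≥ 1 + C·δ_Ω(z)·log δ_Ω(z). -/

import Mathlib

open Metric MeasureTheory Set
open scoped NNReal ENNReal

noncomputable section

/-- Complex Euclidean `n`-space. -/
abbrev Cn (n : ℕ) := EuclideanSpace ℂ (Fin n)

variable {n : ℕ}

instance : MeasurableSpace (Cn n) := borel _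
instance : BorelSpace (Cn n) := ⟨rfl⟩
instance : InnerProductSpace ℝ (Cn n) := InnerProductSpace.rclikeToReal ℂ _

/-- `δ_Ω(z)`: the Euclidean distance from `z` to the boundary of `Ω`. -/
def bdist (Ω : Set (Cn n)) (z : Cn n) : ℝ := Metric.infDist z (frontier Ω)

/-- The squeezing function `σ_Ω(z)` of a (bounded) domain `Ω`. -/
def squeezing (Ω : Set (Cn n)) (z : Cn n) : ℝ :=
  sSup {r : ℝ | 0 < r ∧ ∃ f : Cn n → Cn n,
    DifferentiableOn ℂ f Ω ∧ Set.InjOn f Ω ∧ Set.MapsTo f Ω (Metric.ball 0 1) ∧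
    f z = 0 ∧ Metric.ball (0 : Cn n) r ⊆ f '' Ω}

/-- The Kobayashi metric `κ_Ω(z;X)`. -/
def kobayashi (Ω : Set (Cn n)) (z X : Cn n) : ℝ :=
  sInf {r : ℝ | ∃ (α : ℂ) (φ : ℂ → Cn n),
    DifferentiableOn ℂ φ (Metric.ball 0 1) ∧ Set.MapsTo φ (Metric.ball 0 1) Ω ∧
    φ 0 = z ∧ α • deriv φ 0 = X ∧ r = ‖α‖}

/-- The Carathéodory metric `γ_Ω(z;X)`. -/
def caratheodory (Ω : Set (Cn n)) (z X : Cn n) : ℝ :=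
  sSup {r : ℝ | ∃ f : Cn n → ℂ,
    DifferentiableOn ℂ f Ω ∧ Set.MapsTo f Ω (Metric.ball 0 1) ∧
    r = ‖fderiv ℂ f z X‖}

/-- `⟨∂ρ(q),X⟩ = Σ_j (∂ρ/∂z_j)(q) X_j`, expressed via the real differential:
`⟨∂ρ(q),X⟩ = (Dρ(q)X - i·Dρ(q)(iX))/2`. -/
def cderiv (ρ : Cn n → ℝ) (q X : Cn n) : ℂ :=
  (((fderiv ℝ ρ q X : ℝ) : ℂ) - Complex.I * ((fderiv ℝ ρ q (Complex.I • X) : ℝ) : ℂ)) / 2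

/-- The Levi form `L_ρ(q;X) = Σ_{j,k} (∂²ρ/∂z_j∂z̄_k)(q) X_j X̄_k`, expressed via the real
second differential: `L_ρ(q;X) = (D²ρ(q)[X,X] + D²ρ(q)[iX,iX])/4`. -/
def leviForm (ρ : Cn n → ℝ) (q X : Cn n) : ℝ :=
  (fderiv ℝ (fun w => fderiv ℝ ρ w X) q X
    + fderiv ℝ (fun w => fderiv ℝ ρ w (Complex.I • X)) q (Complex.I • X)) / 4

/-- `p` is a strictly pseudoconvex boundary point of `Ω` of class `C^{m,ε}`. -/
def IsStrictPscPtHolder (Ω : Set (Cn n)) (p : Cn n) (m : ℕ) (ε : ℝ) : Prop :=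
  p ∈ frontier Ω ∧ ∃ W : Set (Cn n), IsOpen W ∧ p ∈ W ∧ ∃ ρ : Cn n → ℝ,
    ContDiffOn ℝ m ρ W ∧
    (∃ C : ℝ≥0, HolderOnWith C ε.toNNReal (iteratedFDeriv ℝ m ρ) W) ∧
    Ω ∩ W = {z ∈ W | ρ z < 0} ∧
    (∀ q ∈ frontier Ω ∩ W, fderiv ℝ ρ q ≠ 0) ∧
    (∀ q ∈ frontier Ω ∩ W, ∀ X : Cn n, X ≠ 0 → cderiv ρ q X = 0 → 0 < leviForm ρ q X)

/-- `p` is a strictly pseudoconvex boundary point of `Ω` of class `C²`. -/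
def IsStrictPscPtC2 (Ω : Set (Cn n)) (p : Cn n) : Prop :=
  p ∈ frontier Ω ∧ ∃ W : Set (Cn n), IsOpen W ∧ p ∈ W ∧ ∃ ρ : Cn n → ℝ,
    ContDiffOn ℝ 2 ρ W ∧
    Ω ∩ W = {z ∈ W | ρ z < 0} ∧
    (∀ q ∈ frontier Ω ∩ W, fderiv ℝ ρ q ≠ 0) ∧
    (∀ q ∈ frontier Ω ∩ W, ∀ X : Cn n, X ≠ 0 → cderiv ρ q X = 0 → 0 < leviForm ρ q X)

/-- An open set `D ⊆ ℂⁿ` is pseudoconvex: `u = -log dist(·, Dᶜ)` is plurisubharmonic on `D`. -/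
def IsPseudoconvex (D : Set (Cn n)) : Prop :=
  IsOpen D ∧
  UpperSemicontinuousOn (fun z => -Real.log (Metric.infDist z Dᶜ)) D ∧
  ∀ a ∈ D, ∀ w : Cn n, ∀ r : ℝ, 0 < r →
    (∀ l : ℂ, ‖l‖ ≤ r → a + l • w ∈ D) →
    -Real.log (Metric.infDist a Dᶜ) ≤
      (1 / (2 * Real.pi)) * ∫ θ in (0:ℝ)..(2 * Real.pi),
        -Real.log (Metric.infDist (a + ((r : ℂ) * Complex.exp (θ * Complex.I)) • w) Dᶜ)

/-- `cl(Ω)` admits a Stein neighborhood basis. -/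
def HasSteinBasis (Ω : Set (Cn n)) : Prop :=
  ∀ W : Set (Cn n), IsOpen W → closure Ω ⊆ W →
    ∃ U : Set (Cn n), IsPseudoconvex U ∧ closure Ω ⊆ U ∧ U ⊆ W

/-- The squared `L²`-norm of `f` on `D` (as an extended nonnegative real). -/
def L2normSq (D : Set (Cn n)) (f : Cn n → ℂ) : ℝ≥0∞ := ∫⁻ w in D, (‖f w‖₊ : ℝ≥0∞) ^ 2

/-- `J⁰_D(z) = sup {|f(z)|² : f ∈ L²_h(D), ‖f‖_D ≤ 1}`; equals the Bergman kernel on the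
diagonal. -/
def J0 (D : Set (Cn n)) (z : Cn n) : ℝ :=
  sSup {v : ℝ | ∃ f : Cn n → ℂ, DifferentiableOn ℂ f D ∧ L2normSq D f ≤ 1 ∧ v = ‖f z‖ ^ 2}

/-- `J¹_D(z;X) = sup {|f'(z)X|² : f ∈ L²_h(D), ‖f‖_D ≤ 1, f(z) = 0}`. -/
def J1 (D : Set (Cn n)) (z X : Cn n) : ℝ :=
  sSup {v : ℝ | ∃ f : Cn n → ℂ, DifferentiableOn ℂ f D ∧ L2normSq D f ≤ 1 ∧ f z = 0 ∧
    v = ‖fderiv ℂ f z X‖ ^ 2}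

/-- `J²_D(z;X,Y) = sup {|Σ_{j,k} f_{ζ_jζ_k}(z) X_j Y_k|² : f ∈ L²_h(D), ‖f‖_D ≤ 1,
f(z) = 0, f'(z) = 0}`. -/
def J2 (D : Set (Cn n)) (z X Y : Cn n) : ℝ :=
  sSup {v : ℝ | ∃ f : Cn n → ℂ, DifferentiableOn ℂ f D ∧ L2normSq D f ≤ 1 ∧ f z = 0 ∧
    fderiv ℂ f z = 0 ∧ v = ‖fderiv ℂ (fun w => fderiv ℂ f w Y) z X‖ ^ 2}

/-- The Bergman metric `β_D(z;X) = (J¹_D(z;X)/J⁰_D(z))^{1/2}`. -/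
def bergman (D : Set (Cn n)) (z X : Cn n) : ℝ := Real.sqrt (J1 D z X / J0 D z)

/-- The bisectional curvature of the Bergman metric. -/
def bisect (D : Set (Cn n)) (z X Y : Cn n) : ℝ :=
  2 - J0 D z * J2 D z X Y / (J1 D z X * J1 D z Y)

/-- The holomorphic sectional curvature `s_D(z;X)` of the Bergman metric. -/
def sectCurv (D : Set (Cn n)) (z X : Cn n) : ℝ := bisect D z X X

/-- The Ricci curvature `r_D(z;X)` of the Bergman metric (w.r.t. the standard basis). -/
def ricciCurv (D : Set (Cn n)) (z X : Cn n) : ℝ :=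
  ∑ j : Fin n, bisect D z (EuclideanSpace.single j 1) X

/-- The scalar curvature `t_D(z)` of the Bergman metric. -/
def scalarCurv (D : Set (Cn n)) (z : Cn n) : ℝ :=
  ∑ j : Fin n, ricciCurv D z (EuclideanSpace.single j 1)

/-- `M(z;X) = ( |⟨∂δ_Ω(z),X⟩|²/δ_Ω(z)² + L(z;X)/δ_Ω(z) )^{1/2}`, where `L` is the Levi form
of `-δ_Ω`. -/
def Mfun (Ω : Set (Cn n)) (z X : Cn n) : ℝ :=
  Real.sqrt (‖cderiv (bdist Ω) z X‖ ^ 2 / (bdist Ω z) ^ 2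
    + leviForm (fun w => -(bdist Ω w)) z X / bdist Ω z)

/-- The sesquilinear form of the Bergman metric, recovered from `β²` by polarization. -/
def bergForm (D : Set (Cn n)) (z X Y : Cn n) : ℂ :=
  (((J1 D z (X + Y) / J0 D z : ℝ) : ℂ) - ((J1 D z (X - Y) / J0 D z : ℝ) : ℂ)
    + Complex.I * ((J1 D z (X + Complex.I • Y) / J0 D z : ℝ) : ℂ)
    - Complex.I * ((J1 D z (X - Complex.I • Y) / J0 D z : ℝ) : ℂ)) / 4

/-- The Hermitian matrix `(B_{jk}(z))` of the Bergman metric in the standard coordinates. -/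
def bergMat (D : Set (Cn n)) (z : Cn n) : Matrix (Fin n) (Fin n) ℂ :=
  fun j k => bergForm D z (EuclideanSpace.single j 1) (EuclideanSpace.single k 1)

/-- The canonical Bergman invariant `J_D(z) = Δ_D(z)/K_D(z)`. -/
def canonInvariant (D : Set (Cn n)) (z : Cn n) : ℂ :=
  (bergMat D z).det / ((J0 D z : ℝ) : ℂ)

section
namespace Loc
open Filter Topology ContDiff ComplexConjugate Complex

def ee (j : Fin n) : Cn n := EuclideanSpace.single j 1

def dbar (j : Fin n) (f : Cn n → ℂ) (z : Cn n) : ℂ :=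
  (fderiv ℝ f z (ee j) + I * fderiv ℝ f z (I • ee j)) / 2

def del (j : Fin n) (f : Cn n → ℂ) (z : Cn n) : ℂ :=
  (fderiv ℝ f z (ee j) - I * fderiv ℝ f z (I • ee j)) / 2

lemma dbar_mul {f g : Cn n → ℂ} {z : Cn n} (j : Fin n) (hf : DifferentiableAt ℝ f z)
    (hg : DifferentiableAt ℝ g z) :
    dbar j (fun w => f w * g w) z = f z * dbar j g z + dbar j f z * g z := by
  simp only [dbar]; rw [fderiv_fun_mul hf hg]; simp; ring

lemma del_mul {f g : Cn n → ℂ} {z : Cn n} (j : Fin n) (hf : DifferentiableAt ℝ f z)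
    (hg : DifferentiableAt ℝ g z) :
    del j (fun w => f w * g w) z = f z * del j g z + del j f z * g z := by
  simp only [del]; rw [fderiv_fun_mul hf hg]; simp; ring

lemma dbar_sub {f g : Cn n → ℂ} {z : Cn n} (j : Fin n) (hf : DifferentiableAt ℝ f z)
    (hg : DifferentiableAt ℝ g z) :
    dbar j (fun w => f w - g w) z = dbar j f z - dbar j g z := by
  simp only [dbar]; rw [fderiv_fun_sub hf hg]; simp; ring

lemma fderiv_conj' {f : Cn n → ℂ} {z : Cn n} (hf : DifferentiableAt ℝ f z) (X : Cn n) :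
    fderiv ℝ (fun w => conj (f w)) z X = conj (fderiv ℝ f z X) := by
  have h := (conjCLE.toContinuousLinearMap.hasFDerivAt.comp z hf.hasFDerivAt).fderiv
  have h2 : (⇑(conjCLE.toContinuousLinearMap) ∘ f) = fun w => conj (f w) := by ext w; simp
  rw [h2] at h; rw [h]; simp

lemma dbar_conj {f : Cn n → ℂ} {z : Cn n} (j : Fin n) (hf : DifferentiableAt ℝ f z) :
    dbar j (fun w => conj (f w)) z = conj (del j f z) := by
  have h2 : conj (2:ℂ) = 2 := conj_ofNat 2
  simp [dbar, del, fderiv_conj' hf, h2]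

lemma del_conj {f : Cn n → ℂ} {z : Cn n} (j : Fin n) (hf : DifferentiableAt ℝ f z) :
    del j (fun w => conj (f w)) z = conj (dbar j f z) := by
  have h2 : conj (2:ℂ) = 2 := conj_ofNat 2
  simp [dbar, del, fderiv_conj' hf, h2, sub_eq_add_neg]

lemma contDiff_dbar {f : Cn n → ℂ} {m k : ℕ∞} (j : Fin n) (hf : ContDiff ℝ m f) (h : k + 1 ≤ m) :
    ContDiff ℝ k (dbar j f) := by
  have h1 := fun X : Cn n => (hf.fderiv_right (m := k) (by exact_mod_cast h)).clm_apply (contDiff_const (c := X))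
  unfold dbar
  exact ((h1 _).add (contDiff_const.mul (h1 _))).div_const _

lemma contDiff_del {f : Cn n → ℂ} {m k : ℕ∞} (j : Fin n) (hf : ContDiff ℝ m f) (h : k + 1 ≤ m) :
    ContDiff ℝ k (del j f) := by
  have h1 := fun X : Cn n => (hf.fderiv_right (m := k) (by exact_mod_cast h)).clm_apply (contDiff_const (c := X))
  unfold del
  exact ((h1 _).sub (contDiff_const.mul (h1 _))).div_const _

lemma dbar_eq_zero_of {f : Cn n → ℂ} {z : Cn n} (j : Fin n) (h : z ∉ tsupport f) : dbar j f z = 0 := by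
  have : fderiv ℝ f z = 0 := by
    by_contra h'; exact h (support_fderiv_subset ℝ h')
  simp [dbar, this]

lemma del_eq_zero_of {f : Cn n → ℂ} {z : Cn n} (j : Fin n) (h : z ∉ tsupport f) : del j f z = 0 := by
  have : fderiv ℝ f z = 0 := by
    by_contra h'; exact h (support_fderiv_subset ℝ h')
  simp [del, this]

lemma tsupport_dbar (j : Fin n) (f : Cn n → ℂ) : tsupport (dbar j f) ⊆ tsupport f :=
  closure_minimal (fun z hz => by by_contra h; exact hz (dbar_eq_zero_of j h)) (isClosed_tsupport f)

lemma tsupport_del (j : Fin n) (f : Cn n → ℂ) : tsupport (del j f) ⊆ tsupport f :=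
  closure_minimal (fun z hz => by by_contra h; exact hz (del_eq_zero_of j h)) (isClosed_tsupport f)

lemma hcs_dbar {f : Cn n → ℂ} (j : Fin n) (hf : HasCompactSupport f) : HasCompactSupport (dbar j f) :=
  hf.of_isClosed_subset (isClosed_tsupport _) (tsupport_dbar j f)

lemma hcs_del {f : Cn n → ℂ} (j : Fin n) (hf : HasCompactSupport f) : HasCompactSupport (del j f) :=
  hf.of_isClosed_subset (isClosed_tsupport _) (tsupport_del j f)

lemma ibp_fderiv {f g : Cn n → ℂ} (hf : ContDiff ℝ 1 f) (hg : ContDiff ℝ 1 g)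
    (hc : HasCompactSupport g) (X : Cn n) :
    ∫ z, f z * fderiv ℝ g z X = - ∫ z, fderiv ℝ f z X * g z := by
  have c1 : Continuous (fun z => fderiv ℝ f z X) := (hf.continuous_fderiv (by simp)).clm_apply continuous_const
  have c2 : Continuous (fun z => fderiv ℝ g z X) := (hg.continuous_fderiv (by simp)).clm_apply continuous_const
  have s2 : HasCompactSupport (fun z => fderiv ℝ g z X) := hc.fderiv_apply (𝕜 := ℝ) X
  apply integral_mul_fderiv_eq_neg_fderiv_mul_of_integrable (𝕜 := ℂ)
  · exact (c1.mul hg.continuous).integrable_of_hasCompactSupport hc.mul_left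
  · exact (hf.continuous.mul c2).integrable_of_hasCompactSupport s2.mul_left
  · exact (hf.continuous.mul hg.continuous).integrable_of_hasCompactSupport hc.mul_left
  · exact fun x _ => hf.differentiable (by simp) x
  · exact fun x _ => hg.differentiable (by simp) x

lemma int_aux {f g : Cn n → ℂ} (hf : Continuous f) (hg : ContDiff ℝ 1 g)
    (hc : HasCompactSupport g) (X : Cn n) : Integrable (fun z => f z * fderiv ℝ g z X) := by
  have c2 : Continuous (fun z => fderiv ℝ g z X) := (hg.continuous_fderiv (by simp)).clm_apply continuous_const
  have s2 : HasCompactSupport (fun z => fderiv ℝ g z X) := hc.fderiv_apply (𝕜 := ℝ) X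
  exact (hf.mul c2).integrable_of_hasCompactSupport s2.mul_left

lemma int_aux' {f g : Cn n → ℂ} (hf : ContDiff ℝ 1 f) (hg : Continuous g)
    (hc : HasCompactSupport g) (X : Cn n) : Integrable (fun z => fderiv ℝ f z X * g z) := by
  have c1 : Continuous (fun z => fderiv ℝ f z X) := (hf.continuous_fderiv (by simp)).clm_apply continuous_const
  exact (c1.mul hg).integrable_of_hasCompactSupport hc.mul_left

lemma ibp_dbar {f g : Cn n → ℂ} (hf : ContDiff ℝ 1 f) (hg : ContDiff ℝ 1 g)
    (hc : HasCompactSupport g) (j : Fin n) :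
    ∫ z, f z * dbar j g z = - ∫ z, dbar j f z * g z := by
  have e1 : ∀ z, f z * dbar j g z = (1/2 : ℂ) * (f z * fderiv ℝ g z (ee j)) + (I/2) * (f z * fderiv ℝ g z (I • ee j)) := by
    intro z; simp only [dbar]; ring
  have e2 : ∀ z, dbar j f z * g z = (1/2 : ℂ) * (fderiv ℝ f z (ee j) * g z) + (I/2) * (fderiv ℝ f z (I • ee j) * g z) := by
    intro z; simp only [dbar]; ring
  simp_rw [e1, e2]
  rw [integral_add ((int_aux hf.continuous hg hc _).const_mul _) ((int_aux hf.continuous hg hc _).const_mul _),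
    integral_add ((int_aux' hf hg.continuous hc _).const_mul _) ((int_aux' hf hg.continuous hc _).const_mul _)]
  simp_rw [integral_const_mul]
  rw [ibp_fderiv hf hg hc, ibp_fderiv hf hg hc]; ring

lemma ibp_del {f g : Cn n → ℂ} (hf : ContDiff ℝ 1 f) (hg : ContDiff ℝ 1 g)
    (hc : HasCompactSupport g) (j : Fin n) :
    ∫ z, f z * del j g z = - ∫ z, del j f z * g z := by
  have e1 : ∀ z, f z * del j g z = (1/2 : ℂ) * (f z * fderiv ℝ g z (ee j)) + (-I/2) * (f z * fderiv ℝ g z (I • ee j)) := by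
    intro z; simp only [del]; ring
  have e2 : ∀ z, del j f z * g z = (1/2 : ℂ) * (fderiv ℝ f z (ee j) * g z) + (-I/2) * (fderiv ℝ f z (I • ee j) * g z) := by
    intro z; simp only [del]; ring
  simp_rw [e1, e2]
  rw [integral_add ((int_aux hf.continuous hg hc _).const_mul _) ((int_aux hf.continuous hg hc _).const_mul _),
    integral_add ((int_aux' hf hg.continuous hc _).const_mul _) ((int_aux' hf hg.continuous hc _).const_mul _)]
  simp_rw [integral_const_mul]
  rw [ibp_fderiv hf hg hc, ibp_fderiv hf hg hc]; ring

/-- second derivative as a bilinear expression -/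
def D2 (f : Cn n → ℂ) (z X Y : Cn n) : ℂ := fderiv ℝ (fun w => fderiv ℝ f w Y) z X

lemma D2_eq {f : Cn n → ℂ} (hf : ContDiff ℝ 2 f) (z X Y : Cn n) :
    D2 f z X Y = fderiv ℝ (fderiv ℝ f) z X Y := by
  have h : DifferentiableAt ℝ (fderiv ℝ f) z :=
    (hf.fderiv_right (m := 1) (by norm_num)).differentiable (by simp) z
  unfold D2
  rw [fderiv_clm_apply h (differentiableAt_const _)]; simp

lemma D2_symm {f : Cn n → ℂ} (hf : ContDiff ℝ 2 f) (z X Y : Cn n) : D2 f z X Y = D2 f z Y X := by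
  rw [D2_eq hf, D2_eq hf]
  exact (hf.contDiffAt.isSymmSndFDerivAt (by simp)).eq X Y

lemma diff_fderiv {f : Cn n → ℂ} (hf : ContDiff ℝ 2 f) (z Y : Cn n) :
    DifferentiableAt ℝ (fun w => fderiv ℝ f w Y) z :=
  ((hf.fderiv_right (m := 1) (by norm_num)).clm_apply contDiff_const).differentiable (by simp) z

lemma fderiv_dbar {f : Cn n → ℂ} (hf : ContDiff ℝ 2 f) (k : Fin n) (z X : Cn n) :
    fderiv ℝ (dbar k f) z X = (D2 f z X (ee k) + I * D2 f z X (I • ee k)) / 2 := by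
  have h1 := diff_fderiv hf z (ee k)
  have h2 := diff_fderiv hf z (I • ee k)
  have : dbar k f = fun w => (1/2 : ℂ) * (fderiv ℝ f w (ee k)) + (I/2) * fderiv ℝ f w (I • ee k) := by
    ext w; simp only [dbar]; ring
  rw [this, fderiv_fun_add (h1.const_mul _) (h2.const_mul _), fderiv_const_mul h1, fderiv_const_mul h2]
  simp [D2]; ring

lemma fderiv_del {f : Cn n → ℂ} (hf : ContDiff ℝ 2 f) (k : Fin n) (z X : Cn n) :
    fderiv ℝ (del k f) z X = (D2 f z X (ee k) - I * D2 f z X (I • ee k)) / 2 := by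
  have h1 := diff_fderiv hf z (ee k)
  have h2 := diff_fderiv hf z (I • ee k)
  have : del k f = fun w => (1/2 : ℂ) * (fderiv ℝ f w (ee k)) + (-I/2) * fderiv ℝ f w (I • ee k) := by
    ext w; simp only [del]; ring
  rw [this, fderiv_fun_add (h1.const_mul _) (h2.const_mul _), fderiv_const_mul h1, fderiv_const_mul h2]
  simp [D2]; ring

lemma dbar_comm {f : Cn n → ℂ} (hf : ContDiff ℝ 2 f) (j k : Fin n) (z : Cn n) :
    dbar j (dbar k f) z = dbar k (dbar j f) z := by
  rw [dbar, dbar, fderiv_dbar hf, fderiv_dbar hf, fderiv_dbar hf, fderiv_dbar hf,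
    D2_symm hf z (ee j) (ee k), D2_symm hf z (ee j) (I • ee k), D2_symm hf z (I • ee j) (ee k),
    D2_symm hf z (I • ee j) (I • ee k)]; ring

lemma del_dbar_comm {f : Cn n → ℂ} (hf : ContDiff ℝ 2 f) (j k : Fin n) (z : Cn n) :
    del j (dbar k f) z = dbar k (del j f) z := by
  rw [del, dbar, fderiv_dbar hf, fderiv_dbar hf, fderiv_del hf, fderiv_del hf,
    D2_symm hf z (ee j) (ee k), D2_symm hf z (ee j) (I • ee k), D2_symm hf z (I • ee j) (ee k),
    D2_symm hf z (I • ee j) (I • ee k)]; ring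

lemma exists_cutoff {K Ω : Set (Cn n)} (hK : IsCompact K) (hΩ : IsOpen Ω) (h : K ⊆ Ω) :
    ∃ Θ : Cn n → ℝ, ContDiff ℝ ∞ Θ ∧ HasCompactSupport Θ ∧ tsupport Θ ⊆ Ω ∧
      (∀ x, Θ x ∈ Icc (0:ℝ) 1) ∧ (∀ᶠ x in 𝓝ˢ K, Θ x = 1) := by
  obtain ⟨L, hL, hKL, hLΩ⟩ := exists_compact_between hK hΩ h
  obtain ⟨f, h1, h2, h3⟩ := exists_contMDiffMap_one_nhds_of_subset_interior (modelWithCornersSelf ℝ (Cn n))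
    (n := (⊤ : ℕ∞)) hK.isClosed hKL
  have hs : tsupport f ⊆ L := closure_minimal (fun x hx => by
    by_contra hx'
    exact hx (h2 x hx')) hL.isClosed
  exact ⟨f, f.contMDiff.contDiff, hL.of_isClosed_subset (isClosed_tsupport _) hs, hs.trans hLΩ, h3, h1⟩

end Loc
end

section
namespace Loc
open Filter Topology ContDiff ComplexConjugate Complex

def k0 (x : Cn n) : ℝ := expNegInvGlue (1 - ‖x‖ ^ 2)

lemma k0_smooth : ContDiff ℝ ∞ (k0 : Cn n → ℝ) :=
  (expNegInvGlue.contDiff (n := (⊤ : ℕ∞))).comp (contDiff_const.sub (contDiff_norm_sq ℝ))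

lemma k0_nonneg (x : Cn n) : 0 ≤ k0 x := expNegInvGlue.nonneg _

lemma k0_supp : Function.support (k0 : Cn n → ℝ) ⊆ ball 0 1 := by
  intro x hx
  by_contra h
  apply hx
  apply expNegInvGlue.zero_of_nonpos
  have : 1 ≤ ‖x‖ := by simpa using h
  nlinarith

lemma k0_hcs : HasCompactSupport (k0 : Cn n → ℝ) :=
  HasCompactSupport.of_support_subset_isCompact (isCompact_closedBall 0 1) (k0_supp.trans ball_subset_closedBall)

lemma k0_int : Integrable (k0 : Cn n → ℝ) := k0_smooth.continuous.integrable_of_hasCompactSupport k0_hcs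

lemma k0_int_pos : 0 < ∫ x : Cn n, k0 x := by
  refine k0_smooth.continuous.integral_pos_of_hasCompactSupport_nonneg_nonzero k0_hcs k0_nonneg (x := 0) ?_
  have := expNegInvGlue.pos_of_pos (x := 1) one_pos
  simp [k0, this.ne']

/-- radial mollifier -/
def ker (ε : ℝ) (x : Cn n) : ℝ :=
  (ε ^ Module.finrank ℝ (Cn n))⁻¹ * (∫ x : Cn n, k0 x)⁻¹ * k0 (ε⁻¹ • x)

lemma ker_smooth (ε : ℝ) : ContDiff ℝ ∞ (ker ε : Cn n → ℝ) :=
  contDiff_const.mul (k0_smooth.comp (contDiff_const_smul _))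

lemma ker_nonneg {ε : ℝ} (hε : 0 < ε) (x : Cn n) : 0 ≤ ker ε x := by
  unfold ker
  exact mul_nonneg (mul_nonneg (inv_nonneg.2 (pow_nonneg hε.le _)) (inv_nonneg.2 k0_int_pos.le)) (k0_nonneg _)

lemma ker_zero {ε : ℝ} (hε : 0 < ε) {x : Cn n} (hx : ε ≤ ‖x‖) : ker ε x = 0 := by
  have : k0 (ε⁻¹ • x) = 0 := by
    by_contra h
    have := k0_supp h
    rw [mem_ball_zero_iff, norm_smul, norm_inv, Real.norm_of_nonneg hε.le, inv_mul_lt_iff₀ hε] at this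
    linarith
  simp [ker, this]

lemma ker_hcs {ε : ℝ} (hε : 0 < ε) : HasCompactSupport (ker ε : Cn n → ℝ) :=
  HasCompactSupport.of_support_subset_isCompact (isCompact_closedBall 0 ε) (fun x hx => by
    by_contra h
    exact hx (ker_zero hε (by simpa using (le_of_not_ge (by simpa using h : ¬ ‖x‖ ≤ ε)))))

lemma ker_int {ε : ℝ} (hε : 0 < ε) : Integrable (ker ε : Cn n → ℝ) :=
  (ker_smooth ε).continuous.integrable_of_hasCompactSupport (ker_hcs hε)

lemma ker_integral {ε : ℝ} (hε : 0 < ε) : ∫ x : Cn n, ker ε x = 1 := by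
  unfold ker
  rw [integral_const_mul, Measure.integral_comp_inv_smul_of_nonneg _ _ hε.le]
  have := (k0_int_pos (n := n)).ne'
  have := (pow_pos hε (Module.finrank ℝ (Cn n))).ne'
  simp only [smul_eq_mul]
  field_simp

lemma ker_radial (ε : ℝ) {x y : Cn n} (h : ‖x‖ = ‖y‖) : ker ε x = ker ε y := by
  simp [ker, k0, norm_smul, h]

lemma ker_le {ε : ℝ} (hε : 0 < ε) (x : Cn n) :
    ker ε x ≤ (ε ^ Module.finrank ℝ (Cn n))⁻¹ * (∫ x : Cn n, k0 x)⁻¹ := by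
  have := k0_int_pos (n := n)
  have h1 : k0 (ε⁻¹ • x) ≤ 1 := by
    unfold k0 expNegInvGlue; split_ifs with h
    · simp
    · rw [not_le] at h; apply Real.exp_le_one_iff.2; simp [h.le]
  unfold ker
  exact mul_le_of_le_one_right (mul_nonneg (inv_nonneg.2 (pow_nonneg hε.le _)) (inv_nonneg.2 k0_int_pos.le)) h1

lemma ker_lintegral {ε : ℝ} (hε : 0 < ε) : ∫⁻ x : Cn n, ENNReal.ofReal (ker ε x) = 1 := by
  rw [← ofReal_integral_eq_lintegral_ofReal (ker_int hε) (ae_of_all _ (ker_nonneg hε)), ker_integral hε]; simp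

/-- Jensen for squares -/
lemma jensen_sq {α : Type*} [MeasurableSpace α] {μ : Measure α} {k h : α → ℝ≥0∞}
    (hk : AEMeasurable k μ) (hh : AEMeasurable h μ) (h1 : ∫⁻ x, k x ∂μ ≤ 1) :
    (∫⁻ x, k x * h x ∂μ) ^ 2 ≤ ∫⁻ x, k x * h x ^ 2 ∂μ := by
  have h2 := ENNReal.lintegral_mul_le_Lp_mul_Lq μ (Real.HolderConjugate.two_two)
    (f := fun x => k x ^ (1/2:ℝ)) (g := fun x => k x ^ (1/2:ℝ) * h x) (hk.pow_const _) ((hk.pow_const _).mul hh)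
  have e1 : ∀ x, k x ^ (1/2:ℝ) * (k x ^ (1/2:ℝ) * h x) = k x * h x := by
    intro x; rw [← mul_assoc, ← ENNReal.rpow_add_of_nonneg _ _ (by norm_num) (by norm_num)]; norm_num
  have e2 : ∀ x, (k x ^ (1/2:ℝ)) ^ (2:ℝ) = k x := by
    intro x; rw [← ENNReal.rpow_mul]; norm_num
  have e3 : ∀ x, (k x ^ (1/2:ℝ) * h x) ^ (2:ℝ) = k x * h x ^ 2 := by
    intro x; rw [ENNReal.mul_rpow_of_nonneg _ _ (by norm_num), e2]; norm_num
  simp only [Pi.mul_apply, e1, e2, e3] at h2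
  have h3 : (∫⁻ x, k x * h x ∂μ) ≤ (∫⁻ x, k x * h x ^ 2 ∂μ) ^ (1/2:ℝ) := by
    refine h2.trans ?_
    calc _ ≤ 1 ^ (1/2:ℝ) * (∫⁻ x, k x * h x ^ 2 ∂μ) ^ (1/2:ℝ) := by gcongr
      _ = _ := by simp
  calc _ ≤ ((∫⁻ x, k x * h x ^ 2 ∂μ) ^ (1/2:ℝ)) ^ 2 := by gcongr
    _ = _ := by rw [← ENNReal.rpow_natCast, ← ENNReal.rpow_mul]; norm_num

/-- mollification -/
def mol (ε : ℝ) (f : Cn n → ℂ) (z : Cn n) : ℂ := ∫ y, (ker ε y : ℂ) * f (z - y)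

lemma mol_eq (ε : ℝ) (f : Cn n → ℂ) (z : Cn n) : mol ε f z = ∫ y, f y * (ker ε (z - y) : ℂ) := by
  unfold mol
  rw [← integral_sub_left_eq_self (fun y => f y * (ker ε (z - y) : ℂ)) volume z]
  simp [mul_comm]

lemma sq_eLpNorm {α : Type*} [MeasurableSpace α] {μ : Measure α} (f : α → ℂ) :
    eLpNorm f 2 μ ^ 2 = ∫⁻ x, ‖f x‖ₑ ^ 2 ∂μ := by
  have := eLpNorm_nnreal_pow_eq_lintegral (f := f) (μ := μ) (p := 2) (by norm_num)
  simpa using this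

lemma translation {f : Cn n → ℂ} (hf : MemLp f 2) {η : ℝ≥0∞} (hη : 0 < η) :
    ∃ ε > 0, ∀ y : Cn n, ‖y‖ < ε → ∫⁻ x, ‖f (x - y) - f x‖ₑ ^ 2 ≤ η := by
  have : Fact ((2:ℝ≥0∞) ≠ ⊤) := ⟨by norm_num⟩
  let F := hf.toLp
  have hc : Continuous (fun y : Cn n => (DomAddAct.mk (-y)) +ᵥ F) :=
    (DomAddAct.continuous_mk.comp continuous_neg).vadd continuous_const
  have h0 := hc.tendsto 0
  have h00 : (DomAddAct.mk (-(0:Cn n))) +ᵥ F = F := by simp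
  simp only [h00] at h0
  rw [EMetric.tendsto_nhds] at h0
  obtain ⟨m, hm, hm2⟩ : ∃ m > 0, m ^ 2 ≤ η := by
    refine ⟨min η 1, by simp [hη], ?_⟩
    calc (min η 1) ^ 2 = min η 1 * min η 1 := sq _
      _ ≤ η * 1 := by gcongr <;> simp
      _ = η := by simp
  obtain ⟨ε, hε, h1⟩ := Metric.eventually_nhds_iff.1 (h0 m hm)
  refine ⟨ε, hε, fun y hy => ?_⟩
  have h2 := (h1 (by simpa using hy)).le
  rw [Lp.edist_def] at h2
  refine le_trans (le_of_eq ?_) (le_trans (pow_le_pow_left' h2 2) hm2)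
  rw [sq_eLpNorm]
  apply lintegral_congr_ae
  have a1 := DomAddAct.vadd_Lp_ae_eq (DomAddAct.mk (-y)) F
  have a2 := hf.coeFn_toLp
  have a3 : ∀ᵐ x, F ((-y) +ᵥ x) = f ((-y) +ᵥ x) :=
    (measurePreserving_vadd (-y) (volume : Measure (Cn n))).quasiMeasurePreserving.ae a2
  filter_upwards [a1, a2, a3] with x h1 h2 h3
  have h4 : ((DomAddAct.mk (-y)) +ᵥ F) x = F (-y +ᵥ x) := h1
  rw [Pi.sub_apply, h4, h3, h2]
  simp [vadd_eq_add, sub_eq_add_neg, add_comm]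

lemma lint_mol {f : Cn n → ℂ} (hf : AEStronglyMeasurable f) {ε : ℝ} (hε : 0 < ε) :
    ∀ x, ‖mol ε f x‖ₑ ^ 2 ≤ ∫⁻ y, ENNReal.ofReal (ker ε y) * ‖f (x - y)‖ₑ ^ 2 := by
  intro x
  have hm : AEStronglyMeasurable (fun y => f (x - y)) :=
    hf.comp_quasiMeasurePreserving (Measure.measurePreserving_sub_left volume x).quasiMeasurePreserving
  refine le_trans ?_ (jensen_sq ?_ hm.enorm (ker_lintegral hε).le)
  · gcongr
    refine (enorm_integral_le_lintegral_enorm _).trans (le_of_eq ?_)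
    congr 1; ext y
    rw [enorm_mul]
    congr 1
    rw [← ofReal_norm, Complex.norm_real, Real.norm_of_nonneg (ker_nonneg hε y)]
  · exact ((ker_smooth ε).continuous.measurable.ennreal_ofReal).aemeasurable

lemma mol_int' {f : Cn n → ℂ} (hli : LocallyIntegrable f) {ε : ℝ} (hε : 0 < ε) (x : Cn n) :
    Integrable (fun y => f y * (ker ε (x - y) : ℂ)) := by
  have := hli.integrable_smul_left_of_hasCompactSupport (g := fun y => ker ε (x - y))
    ((ker_smooth ε).continuous.comp (continuous_const.sub continuous_id)) ?_
  · simpa [mul_comm] using this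
  · exact (ker_hcs hε).comp_homeomorph (Homeomorph.subLeft x)

lemma mol_int {f : Cn n → ℂ} (hli : LocallyIntegrable f) {ε : ℝ} (hε : 0 < ε) (x : Cn n) :
    Integrable (fun y => (ker ε y : ℂ) * f (x - y)) := by
  have := (mol_int' hli hε x).comp_sub_left x
  simpa [mul_comm] using this

lemma mol_tendsto {f : Cn n → ℂ} (hf : MemLp f 2) :
    Tendsto (fun ε => eLpNorm (fun x => mol ε f x - f x) 2 volume) (𝓝[>] 0) (𝓝 0) := by
  have key : ∀ η : ℝ≥0∞, 0 < η → ∀ᶠ ε in 𝓝[>] (0:ℝ), eLpNorm (fun x => mol ε f x - f x) 2 volume ^ 2 ≤ η := by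
    intro η hη
    obtain ⟨r, hr, h⟩ := translation hf hη
    filter_upwards [Ioo_mem_nhdsGT hr] with ε hε
    rw [sq_eLpNorm]
    have hli : LocallyIntegrable f := hf.locallyIntegrable (by norm_num)
    have hcont : Continuous (ker ε : Cn n → ℝ) := (ker_smooth ε).continuous
    have h1 : ∀ x, mol ε f x - f x = ∫ y, (ker ε y : ℂ) * (f (x - y) - f x) := by
      intro x
      have i1 := mol_int hli hε.1 x
      have i2 : Integrable (fun y : Cn n => (ker ε y : ℂ) * f x) := ((ker_int hε.1).ofReal).mul_const _
      simp_rw [mul_sub]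
      rw [integral_sub i1 i2, integral_mul_const, integral_complex_ofReal, ker_integral hε.1]
      simp [mol]
    have hmeas : AEStronglyMeasurable (fun p : Cn n × Cn n => f (p.1 - p.2) - f p.1) (volume.prod volume) := by
      refine AEStronglyMeasurable.sub ?_ ?_
      · exact hf.1.comp_quasiMeasurePreserving (quasiMeasurePreserving_sub volume volume)
      · exact hf.1.comp_fst
    calc ∫⁻ x, ‖mol ε f x - f x‖ₑ ^ 2 ≤ ∫⁻ x, ∫⁻ y, ENNReal.ofReal (ker ε y) * ‖f (x - y) - f x‖ₑ ^ 2 := by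
          apply lintegral_mono
          intro x
          have hm : AEStronglyMeasurable (fun y => f (x - y) - f x) :=
            (hf.1.comp_quasiMeasurePreserving (Measure.measurePreserving_sub_left volume x).quasiMeasurePreserving).sub
              aestronglyMeasurable_const
          refine le_trans ?_ (jensen_sq ?_ hm.enorm (ker_lintegral hε.1).le)
          · refine pow_le_pow_left' ?_ 2
            rw [h1]
            refine (enorm_integral_le_lintegral_enorm _).trans (le_of_eq ?_)
            congr 1; ext y
            rw [enorm_mul]
            congr 1
            rw [← ofReal_norm, Complex.norm_real, Real.norm_of_nonneg (ker_nonneg hε.1 y)]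
          · exact (hcont.measurable.ennreal_ofReal).aemeasurable
      _ = ∫⁻ y, ∫⁻ x, ENNReal.ofReal (ker ε y) * ‖f (x - y) - f x‖ₑ ^ 2 := by
          apply lintegral_lintegral_swap
          exact ((hcont.measurable.ennreal_ofReal).comp measurable_snd).aemeasurable.mul (hmeas.enorm.pow_const 2)
      _ ≤ ∫⁻ y, ENNReal.ofReal (ker ε y) * η := by
          apply lintegral_mono
          intro y
          simp only
          rw [lintegral_const_mul' _ _ (by simp)]
          by_cases hy : ‖y‖ < r
          · gcongr; exact h y hy
          · rw [ker_zero hε.1 (hε.2.le.trans (not_lt.1 hy))]; simp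
      _ = η := by
          rw [lintegral_mul_const _ (hcont.measurable.ennreal_ofReal), ker_lintegral hε.1, one_mul]
  rw [ENNReal.tendsto_nhds_zero]
  intro η hη
  filter_upwards [key (η ^ 2) (by positivity)] with ε hε
  exact (ENNReal.pow_le_pow_left_iff (by norm_num)).1 hε

end Loc
end

section
namespace Loc
open Filter Topology ContDiff ComplexConjugate Complex

lemma kerC_smooth (ε : ℝ) : ContDiff ℝ ∞ (fun y : Cn n => (ker ε y : ℂ)) :=
  ofRealCLM.contDiff.comp (ker_smooth ε)

lemma kerC_hcs {ε : ℝ} (hε : 0 < ε) : HasCompactSupport (fun y : Cn n => (ker ε y : ℂ)) :=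
  (ker_hcs hε).comp_left (g := fun x : ℝ => (x : ℂ)) (by simp)

lemma mol_conv (ε : ℝ) (f : Cn n → ℂ) :
    mol ε f = MeasureTheory.convolution f (fun y => (ker ε y : ℂ)) (ContinuousLinearMap.mul ℝ ℂ) volume := by
  ext z; rw [mol_eq]; rfl

lemma mol_smooth {f : Cn n → ℂ} (hf : LocallyIntegrable f) {ε : ℝ} (hε : 0 < ε) : ContDiff ℝ ∞ (mol ε f) := by
  rw [mol_conv]
  exact (kerC_hcs hε).contDiff_convolution_right _ hf (kerC_smooth ε)

lemma fderiv_mol {f : Cn n → ℂ} (hf : LocallyIntegrable f) {ε : ℝ} (hε : 0 < ε) (z X : Cn n) :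
    fderiv ℝ (mol ε f) z X = ∫ y, f y * fderiv ℝ (fun y : Cn n => (ker ε y : ℂ)) (z - y) X := by
  rw [mol_conv]
  have h1 : ContDiff ℝ 1 (fun y : Cn n => (ker ε y : ℂ)) := (kerC_smooth ε).of_le (by exact_mod_cast le_top)
  rw [((kerC_hcs hε).hasFDerivAt_convolution_right (ContinuousLinearMap.mul ℝ ℂ) hf h1 z).fderiv]
  rw [convolution_precompR_apply _ hf ((kerC_hcs hε).fderiv (𝕜 := ℝ)) (h1.continuous_fderiv (by simp))]
  rfl

lemma fderiv_refl {g : Cn n → ℂ} (hg : ContDiff ℝ 1 g) (z y X : Cn n) :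
    fderiv ℝ (fun y => g (z - y)) y X = - fderiv ℝ g (z - y) X := by
  have h1 : HasFDerivAt (fun y : Cn n => z - y) (-(ContinuousLinearMap.id ℝ (Cn n))) y :=
    (hasFDerivAt_id y).const_sub z
  have h2 := ((hg.differentiable (by simp) (z - y)).hasFDerivAt.comp y h1).fderiv
  have h3 : (g ∘ fun y : Cn n => z - y) = fun y => g (z - y) := rfl
  rw [← h3, h2]; simp

lemma fderiv_mol' {f : Cn n → ℂ} (hf : LocallyIntegrable f) {ε : ℝ} (hε : 0 < ε) (z X : Cn n) :
    Integrable (fun y => f y * fderiv ℝ (fun y : Cn n => (ker ε (z - y) : ℂ)) y X) ∧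
    fderiv ℝ (mol ε f) z X = - ∫ y, f y * fderiv ℝ (fun y : Cn n => (ker ε (z - y) : ℂ)) y X := by
  have h1 : ContDiff ℝ 1 (fun y : Cn n => (ker ε y : ℂ)) := (kerC_smooth ε).of_le (by exact_mod_cast le_top)
  have h2 : ContDiff ℝ 1 (fun y : Cn n => (ker ε (z - y) : ℂ)) := h1.comp (contDiff_const.sub contDiff_id)
  constructor
  · have h3 : HasCompactSupport (fun y : Cn n => (ker ε (z - y) : ℂ)) :=
      (kerC_hcs hε).comp_homeomorph (Homeomorph.subLeft z)
    have := hf.integrable_smul_left_of_hasCompactSupport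
      (g := fun y => fderiv ℝ (fun y : Cn n => (ker ε (z - y) : ℂ)) y X)
      ((h2.continuous_fderiv (by simp)).clm_apply continuous_const) (h3.fderiv_apply (𝕜 := ℝ) X)
    simpa [mul_comm] using this
  · rw [fderiv_mol hf hε, ← integral_neg]
    congr 1; ext y
    rw [fderiv_refl h1]; ring

lemma dbar_mol {f : Cn n → ℂ} (hf : LocallyIntegrable f) {ε : ℝ} (hε : 0 < ε) (j : Fin n) (z : Cn n) :
    dbar j (mol ε f) z = - ∫ y, f y * dbar j (fun y : Cn n => (ker ε (z - y) : ℂ)) y := by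
  obtain ⟨i1, e1⟩ := fderiv_mol' hf hε z (ee j)
  obtain ⟨i2, e2⟩ := fderiv_mol' hf hε z (I • ee j)
  have e : ∀ y, f y * dbar j (fun y : Cn n => (ker ε (z - y) : ℂ)) y =
      (1/2:ℂ) * (f y * fderiv ℝ (fun y : Cn n => (ker ε (z - y) : ℂ)) y (ee j)) +
      (I/2) * (f y * fderiv ℝ (fun y : Cn n => (ker ε (z - y) : ℂ)) y (I • ee j)) := by
    intro y; simp only [dbar]; ring
  simp_rw [e]
  rw [integral_add (i1.const_mul _) (i2.const_mul _), integral_const_mul, integral_const_mul, dbar, e1, e2]; ring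

lemma del_mol {f : Cn n → ℂ} (hf : LocallyIntegrable f) {ε : ℝ} (hε : 0 < ε) (j : Fin n) (z : Cn n) :
    del j (mol ε f) z = - ∫ y, f y * del j (fun y : Cn n => (ker ε (z - y) : ℂ)) y := by
  obtain ⟨i1, e1⟩ := fderiv_mol' hf hε z (ee j)
  obtain ⟨i2, e2⟩ := fderiv_mol' hf hε z (I • ee j)
  have e : ∀ y, f y * del j (fun y : Cn n => (ker ε (z - y) : ℂ)) y =
      (1/2:ℂ) * (f y * fderiv ℝ (fun y : Cn n => (ker ε (z - y) : ℂ)) y (ee j)) +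
      (-I/2) * (f y * fderiv ℝ (fun y : Cn n => (ker ε (z - y) : ℂ)) y (I • ee j)) := by
    intro y; simp only [del]; ring
  simp_rw [e]
  rw [integral_add (i1.const_mul _) (i2.const_mul _), integral_const_mul, integral_const_mul, del, e1, e2]; ring

lemma kerz_tsupport {ε : ℝ} (hε : 0 < ε) (z : Cn n) :
    tsupport (fun y : Cn n => (ker ε (z - y) : ℂ)) ⊆ closedBall z ε := by
  refine closure_minimal (fun y hy => ?_) isClosed_closedBall
  by_contra h
  apply hy
  have : ε ≤ ‖z - y‖ := by rw [mem_closedBall, dist_comm, dist_eq_norm] at h; exact (not_le.1 h).le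
  simp [ker_zero hε this]

/-- rotations preserve Lebesgue measure -/
lemma integral_rot (G : Cn n → ℂ) (θ : ℝ) : ∫ y, G (exp (θ * I) • y) = ∫ y, G y := by
  let u : Circle := Circle.exp θ
  let T : Cn n ≃ₗᵢ[ℝ] Cn n :=
    { toLinearEquiv := LinearEquiv.ofBijective
        ((DistribSMul.toLinearMap ℝ (Cn n) (exp (θ * I)) : Cn n →ₗ[ℝ] Cn n))
        ⟨fun x y h => by
            have h' : exp (θ * I) • x = exp (θ * I) • y := h
            exact smul_right_injective _ (exp_ne_zero _) h',
          fun y => ⟨(exp (θ * I))⁻¹ • y, by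
            show exp (θ * I) • ((exp (θ * I))⁻¹ • y) = y
            rw [smul_smul, mul_inv_cancel₀ (exp_ne_zero _), one_smul]⟩⟩
      norm_map' := fun x => by
        show ‖exp (θ * I) • x‖ = ‖x‖
        rw [norm_smul, norm_exp_ofReal_mul_I, one_mul] }
  have := T.measurePreserving.integral_comp T.toHomeomorph.measurableEmbedding G
  exact this

lemma avg_holo {f : Cn n → ℂ} {z y : Cn n} {r : ℝ} (hf : DifferentiableOn ℂ f (ball z r)) (hy : ‖y‖ < r) :
    ∫ θ in (0:ℝ)..(2 * Real.pi), f (z - exp (θ * I) • y) = 2 * Real.pi * f z := by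
  have h1 : DifferentiableOn ℂ (fun l : ℂ => f (z - l • y)) (closedBall 0 1) := by
    refine hf.comp (Differentiable.differentiableOn (by fun_prop)) ?_
    intro l hl
    rw [mem_ball, dist_eq_norm]
    have : ‖l‖ ≤ 1 := by simpa using hl
    simp only [sub_sub_cancel_left, norm_neg, norm_smul]
    nlinarith [norm_nonneg y]
  have h2 : DiffContOnCl ℂ (fun l : ℂ => f (z - l • y)) (ball 0 |1|) := by
    rw [abs_one]
    exact ⟨h1.mono ball_subset_closedBall, by rw [closure_ball _ one_ne_zero]; exact h1.continuousOn⟩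
  have h3 := h2.circleAverage
  rw [Real.circleAverage_def] at h3
  simp only [circleMap, zero_add, ofReal_one, one_mul, zero_smul, sub_zero] at h3
  rw [← h3, real_smul]
  have : (Real.pi : ℂ) ≠ 0 := by exact_mod_cast Real.pi_ne_zero
  push_cast
  rw [← mul_assoc, mul_inv_cancel₀ (by simpa using this), one_mul]

lemma mol_holo {f : Cn n → ℂ} {z : Cn n} {r ε : ℝ} (hf : DifferentiableOn ℂ f (ball z r)) (hε : 0 < ε)
    (hr : ε < r) : mol ε f z = f z := by
  let G : Cn n → ℂ := fun y => (ker ε y : ℂ) * f (z - y)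
  have hGc : Continuous G := by
    rw [continuous_iff_continuousAt]
    intro y
    by_cases hy : ‖y‖ < r
    · refine (kerC_smooth ε).continuous.continuousAt.mul ?_
      have hm : z - y ∈ ball z r := by simpa [mem_ball, dist_eq_norm] using hy
      have hc : ContinuousAt f (z - y) := (hf.continuousOn).continuousAt (isOpen_ball.mem_nhds hm)
      exact hc.comp (f := fun y => z - y) (continuous_const.sub continuous_id).continuousAt
    · have : G =ᶠ[𝓝 y] fun _ => 0 := by
        have ho : ∀ᶠ x in 𝓝 y, ε < ‖x‖ := (isOpen_lt continuous_const continuous_norm).mem_nhds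
          (hr.trans_le (not_lt.1 hy))
        filter_upwards [ho] with x hx
        simp [G, ker_zero hε hx.le]
      exact this.continuousAt
  have hG0 : ∀ y, y ∉ closedBall (0 : Cn n) ε → G y = 0 := by
    intro y hy
    have : ε ≤ ‖y‖ := by simpa using (not_le.1 (by simpa using hy)).le
    simp [G, ker_zero hε this]
  obtain ⟨M, hM⟩ : ∃ M, ∀ y, ‖G y‖ ≤ M :=
    (HasCompactSupport.intro (isCompact_closedBall (0 : Cn n) ε) hG0).exists_bound_of_continuous hGc
  let μ : Measure ℝ := volume.restrict (Ioc 0 (2 * Real.pi))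
  have hH : Continuous (fun q : ℝ × Cn n => G (exp (q.1 * I) • q.2)) := hGc.comp (by fun_prop)
  have hint : Integrable (fun q : ℝ × Cn n => G (exp (q.1 * I) • q.2)) (μ.prod volume) := by
    have hb : Integrable (fun q : ℝ × Cn n => (1:ℝ) * (closedBall (0 : Cn n) ε).indicator (fun _ => M) q.2) (μ.prod volume) :=
      Integrable.mul_prod (f := fun _ : ℝ => (1:ℝ)) (integrable_const _)
        ((integrableOn_const (C := M) measure_closedBall_lt_top.ne).integrable_indicator measurableSet_closedBall)
    refine hb.mono' hH.aestronglyMeasurable (ae_of_all _ ?_)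
    rintro ⟨θ, y⟩
    simp only [one_mul, indicator]
    split_ifs with h
    · exact hM _
    · rw [hG0]; · simp
      intro h'; apply h
      simpa [norm_smul, norm_exp_ofReal_mul_I] using h'
  have hsw := integral_integral_swap (f := fun (θ : ℝ) (y : Cn n) => G (exp (θ * I) • y)) hint
  have e1 : ∫ θ, (∫ y, G (exp (θ * I) • y)) ∂μ = 2 * Real.pi * ∫ y, G y := by
    simp_rw [integral_rot G]
    rw [integral_const]
    simp [μ, Real.pi_pos.le]
  have e2 : ∀ y, ∫ θ, G (exp (θ * I) • y) ∂μ = (ker ε y : ℂ) * (2 * Real.pi * f z) := by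
    intro y
    have e3 : ∀ θ : ℝ, G (exp (θ * I) • y) = (ker ε y : ℂ) * f (z - exp (θ * I) • y) := by
      intro θ
      simp only [G]
      rw [ker_radial ε (x := exp (θ * I) • y) (y := y)]
      rw [norm_smul, norm_exp_ofReal_mul_I, one_mul]
    simp_rw [e3]
    by_cases hy : ‖y‖ < r
    · rw [integral_const_mul, ← avg_holo hf hy, intervalIntegral.integral_of_le (by positivity)]
    · simp [ker_zero hε (hr.le.trans (not_lt.1 hy))]
  rw [e1] at hsw
  simp_rw [e2] at hsw
  rw [integral_mul_const, integral_complex_ofReal, ker_integral hε, ofReal_one, one_mul] at hsw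
  have : (Real.pi : ℂ) ≠ 0 := by exact_mod_cast Real.pi_ne_zero
  exact mul_left_cancel₀ (by simpa using this) hsw

end Loc
end

section
namespace Loc
open Filter Topology ContDiff ComplexConjugate Complex

lemma vec_expand (X : Cn n) : X = ∑ j, ((X j).re • ee j + (X j).im • (I • ee j)) := by
  ext k
  simp only [WithLp.ofLp_sum, WithLp.ofLp_add, WithLp.ofLp_smul, Finset.sum_apply, Pi.add_apply, Pi.smul_apply, ee]
  rw [Finset.sum_eq_single k]
  · have := (re_add_im (X k)).symm
    simpa using this
  · intro b _ hb; simp [hb.symm]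
  · simp

lemma aux_expand (x u v : ℂ) :
    x.re * u + x.im * v = x * ((u - I * v) / 2) + conj x * ((u + I * v) / 2) := by
  have h1 : x = x.re + x.im * I := (re_add_im x).symm
  have h2 : conj x = x.re - x.im * I := by apply Complex.ext <;> simp
  rw [h2]
  generalize x.re = a at *
  generalize x.im = b at *
  rw [h1]
  linear_combination (b * v) * I_sq

lemma lin_expand (L : Cn n →L[ℝ] ℂ) (X : Cn n) :
    L X = ∑ j, (X j * ((L (ee j) - I * L (I • ee j)) / 2) + conj (X j) * ((L (ee j) + I * L (I • ee j)) / 2)) := by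
  conv_lhs => rw [vec_expand X]
  rw [map_sum]
  refine Finset.sum_congr rfl (fun j _ => ?_)
  rw [map_add, map_smul, map_smul, real_smul, real_smul]
  exact aux_expand _ _ _

lemma fderiv_expand (f : Cn n → ℂ) (z X : Cn n) :
    fderiv ℝ f z X = ∑ j, (X j * del j f z + conj (X j) * dbar j f z) := lin_expand _ _

lemma holo_of_dbar {f : Cn n → ℂ} {z : Cn n} (hf : DifferentiableAt ℝ f z) (h : ∀ j, dbar j f z = 0) :
    DifferentiableAt ℂ f z := by
  rw [differentiableAt_iff_restrictScalars ℝ hf]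
  have e : ∀ X, fderiv ℝ f z X = ∑ j, X j * del j f z := by
    intro X; rw [fderiv_expand]; simp [h]
  refine ⟨LinearMap.toContinuousLinearMap
    { toFun := fun X => ∑ j, X j * del j f z
      map_add' := fun X Y => by simp [add_mul, Finset.sum_add_distrib]
      map_smul' := fun c X => by simp [Finset.mul_sum, mul_assoc] }, ?_⟩
  ext X
  rw [e]; rfl

lemma dbar_of_holo {f : Cn n → ℂ} {z : Cn n} (hf : DifferentiableAt ℂ f z) (j : Fin n) : dbar j f z = 0 := by
  unfold dbar
  rw [hf.fderiv_restrictScalars ℝ]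
  simp [← mul_assoc]

lemma mol_congr {f g : Cn n → ℂ} {ε : ℝ} (hε : 0 < ε) {z : Cn n} (h : ∀ y ∈ ball z ε, f y = g y) :
    mol ε f z = mol ε g z := by
  rw [mol_eq, mol_eq]
  congr 1; ext y
  by_cases hy : y ∈ ball z ε
  · rw [h y hy]
  · rw [mem_ball, dist_comm, dist_eq_norm, not_lt] at hy
    simp [ker_zero hε hy]

lemma holo_smooth {f : Cn n → ℂ} {D : Set (Cn n)} (hD : IsOpen D) (hf : DifferentiableOn ℂ f D) {z : Cn n}
    (hz : z ∈ D) : ContDiffAt ℝ ∞ f z := by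
  obtain ⟨r, hr, hb⟩ := Metric.isOpen_iff.1 hD z hz
  let f' : Cn n → ℂ := (closedBall z (r/2)).indicator f
  have hi : Integrable f' := by
    refine IntegrableOn.integrable_indicator ?_ measurableSet_closedBall
    refine ContinuousOn.integrableOn_compact (isCompact_closedBall _ _) (hf.continuousOn.mono ?_)
    exact (closedBall_subset_ball (by linarith)).trans hb
  have h1 := (mol_smooth hi.locallyIntegrable (ε := r/8) (by positivity)).contDiffAt (x := z)
  refine h1.congr_of_eventuallyEq ?_
  filter_upwards [ball_mem_nhds z (show (0:ℝ) < r/4 by positivity)] with w hw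
  have hs : ball w (r/4) ⊆ closedBall z (r/2) := by
    intro y hy; rw [mem_ball] at hy hw; rw [mem_closedBall]; linarith [dist_triangle y w z]
  rw [mol_congr (g := f) (by positivity), mol_holo (r := r/4) (hf.mono _) (by positivity) (by linarith)]
  · exact hs.trans ((closedBall_subset_ball (by linarith)).trans hb)
  · intro y hy
    exact indicator_of_mem (hs (ball_subset_ball (by linarith) hy)) f

lemma finrank_Cn : Module.finrank ℝ (Cn n) = 2 * n := by
  rw [finrank_real_of_complex]; simp

/-- constant in the pointwise bound -/
def Ck (n : ℕ) : ℝ := (∫ x : Cn n, k0 x)⁻¹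

lemma Ck_pos : 0 < Ck n := inv_pos.2 k0_int_pos

lemma point_bound {f : Cn n → ℂ} {z : Cn n} {r : ℝ} (hr : 0 < r) (hf : DifferentiableOn ℂ f (ball z r)) :
    ‖f z‖ₑ ^ 2 ≤ ENNReal.ofReal (((r/2) ^ (2 * n))⁻¹ * Ck n) * ∫⁻ w in ball z r, ‖f w‖ₑ ^ 2 := by
  have hr2 : 0 < r / 2 := by positivity
  let f' : Cn n → ℂ := (ball z r).indicator f
  have hm : AEStronglyMeasurable f' :=
    (aestronglyMeasurable_indicator_iff measurableSet_ball).2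
      (hf.continuousOn.aestronglyMeasurable measurableSet_ball)
  have h1 := lint_mol hm hr2 z
  rw [mol_congr (g := f) hr2, mol_holo (r := r) hf hr2 (by linarith)] at h1
  · refine h1.trans ?_
    have h2 : ∫⁻ w in ball z r, ‖f w‖ₑ ^ 2 = ∫⁻ y, ‖f' (z - y)‖ₑ ^ 2 := by
      rw [lintegral_sub_left_eq_self (fun y => ‖f' y‖ₑ ^ 2) z, ← lintegral_indicator measurableSet_ball]
      congr 1; ext y
      simp only [f', indicator]; split_ifs <;> simp
    rw [h2, ← lintegral_const_mul' _ _ (by simp)]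
    apply lintegral_mono
    intro y
    simp only
    gcongr
    have := ker_le hr2 y
    rwa [finrank_Cn] at this
  · intro y hy
    exact indicator_of_mem (ball_subset_ball (by linarith) hy) f

lemma mol_comm {F : Cn n → ℂ} (hF : Integrable F) {ε δ : ℝ} (hε : 0 < ε) (hδ : 0 < δ) (z : Cn n) :
    mol ε (mol δ F) z = mol δ (mol ε F) z := by
  have key : ∀ {ε δ : ℝ}, 0 < ε → 0 < δ → mol ε (mol δ F) z = ∫ u, F u * ∫ y, (ker ε y : ℂ) * ker δ (z - u - y) := by
    intro ε δ hε hδ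
    have e1 : mol ε (mol δ F) z = ∫ y, ∫ u, (ker ε y : ℂ) * (F u * ker δ (z - y - u)) := by
      rw [mol]; congr 1; ext y; rw [mol_eq, integral_const_mul]
    rw [e1, integral_integral_swap]
    · congr 1; ext u
      rw [← integral_const_mul]; congr 1; ext y
      rw [sub_right_comm]; ring
    · have hb : Integrable (fun q : Cn n × Cn n => (ker ε q.1 : ℂ) * F q.2) (volume.prod volume) :=
        (ker_int hε).ofReal.mul_prod hF
      have hb2 := hb.bdd_mul (f := fun q : Cn n × Cn n => (ker δ (z - q.1 - q.2) : ℂ))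
        (c := (δ ^ Module.finrank ℝ (Cn n))⁻¹ * (∫ x : Cn n, k0 x)⁻¹) ?_ ?_
      · refine hb2.congr (ae_of_all _ ?_)
        rintro ⟨y, u⟩; simp only [Function.uncurry]; ring
      · exact ((kerC_smooth δ).continuous.comp (by fun_prop)).aestronglyMeasurable
      · refine ae_of_all _ (fun q => ?_)
        rw [norm_real, Real.norm_of_nonneg (ker_nonneg hδ _)]
        exact ker_le hδ _
  rw [key hε hδ, key hδ hε]
  congr 1; ext u
  congr 1
  rw [← integral_sub_left_eq_self (fun y => (ker ε y : ℂ) * ker δ (z - u - y)) volume (z - u)]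
  congr 1; ext y
  rw [sub_sub_cancel, mul_comm]

lemma weyl {Ω : Set (Cn n)} (hΩ : IsOpen Ω) (hne : Ωᶜ.Nonempty) {F : Cn n → ℂ} (hF : MemLp F 2)
    (hw : ∀ (j : Fin n) (w : Cn n → ℂ), ContDiff ℝ ∞ w → HasCompactSupport w → tsupport w ⊆ Ω →
      ∫ y, F y * dbar j w y = 0) :
    ∃ G : Cn n → ℂ, DifferentiableOn ℂ G Ω ∧ ∀ᵐ z, z ∈ Ω → G z = F z := by
  have hli : LocallyIntegrable F := hF.locallyIntegrable (by norm_num)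
  have hh : ∀ {ε : ℝ} {z : Cn n}, 0 < ε → closedBall z ε ⊆ Ω → DifferentiableAt ℂ (mol ε F) z := by
    intro ε z hε hz
    refine holo_of_dbar ((mol_smooth hli hε).differentiable (by simp) z) (fun j => ?_)
    rw [dbar_mol hli hε, hw, neg_zero]
    · exact (kerC_smooth ε).comp (contDiff_const.sub contDiff_id)
    · exact (kerC_hcs hε).comp_homeomorph (Homeomorph.subLeft z)
    · exact (kerz_tsupport hε z).trans hz
  have ind : ∀ {z0 : Cn n} {r : ℝ}, ball z0 (4 * r) ⊆ Ω → ∀ {ε δ : ℝ}, 0 < ε → 0 < δ → ε < r → δ < r →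
      ∀ z ∈ ball z0 r, mol ε F z = mol δ F z := by
    intro z0 r hz0 ε δ hε hδ hεr hδr z hz
    let F' : Cn n → ℂ := (ball z0 (4 * r)).indicator F
    have hF' : Integrable F' := by
      refine IntegrableOn.integrable_indicator ?_ measurableSet_ball
      have : IsFiniteMeasure (volume.restrict (ball z0 (4 * r))) := ⟨by simpa using measure_ball_lt_top⟩
      exact (hF.restrict _).integrable (by norm_num)
    have heq : ∀ {ε : ℝ}, 0 < ε → ε < r → ∀ w ∈ ball z0 (2 * r), mol ε F' w = mol ε F w := by
      intro ε hε hεr w hw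
      refine mol_congr hε (fun y hy => indicator_of_mem ?_ _)
      rw [mem_ball] at *; linarith [dist_triangle y w z0]
    have hol : ∀ {ε : ℝ}, 0 < ε → ε < r → DifferentiableOn ℂ (mol ε F') (ball z r) := by
      intro ε hε hεr
      have hsub : ball z r ⊆ ball z0 (2 * r) := by
        intro y hy; rw [mem_ball] at *; linarith [dist_triangle y z z0]
      refine DifferentiableOn.congr (f := mol ε F) ?_ (fun w hw => heq hε hεr w (hsub hw))
      intro w hw
      refine (hh hε (Subset.trans ?_ hz0)).differentiableWithinAt
      intro y hy
      have := hsub hw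
      rw [mem_ball] at *; rw [mem_closedBall] at hy
      linarith [dist_triangle y w z0]
    have hz2 : z ∈ ball z0 (2 * r) := by
      rw [mem_ball] at *; linarith
    rw [← heq hε hεr z hz2, ← heq hδ hδr z hz2, ← mol_holo (hol hε hεr) hδ hδr, ← mol_holo (hol hδ hδr) hε hεr,
      mol_comm hF' hδ hε]
  have hd0 : ∀ z ∈ Ω, 0 < infDist z Ωᶜ := fun z hz =>
    (hΩ.isClosed_compl.notMem_iff_infDist_pos hne).1 (by simpa using hz)
  have hsub : ∀ z, ball z (infDist z Ωᶜ) ⊆ Ω := fun z => by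
    have := (disjoint_ball_infDist (x := z) (s := Ωᶜ))
    exact disjoint_compl_right_iff_subset.1 this
  have hG : ∀ z0 ∈ Ω, ∀ z ∈ ball z0 (infDist z0 Ωᶜ / 4), mol (infDist z Ωᶜ / 8) F z = mol (infDist z0 Ωᶜ / 8) F z := by
    intro z0 hz0 z hz
    have h0 := hd0 z0 hz0
    have hzΩ : z ∈ Ω := hsub z0 (ball_subset_ball (by linarith) hz)
    have h1 := hd0 z hzΩ
    have h2 : infDist z Ωᶜ ≤ infDist z0 Ωᶜ + dist z z0 := infDist_le_infDist_add_dist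
    rw [mem_ball] at hz
    refine ind (z0 := z0) (r := infDist z0 Ωᶜ / 4) ?_ (by positivity) (by positivity) (by linarith) (by linarith) z hz
    convert hsub z0 using 2; ring
  refine ⟨fun z => mol (infDist z Ωᶜ / 8) F z, ?_, ?_⟩
  · intro z0 hz0
    have h0 := hd0 z0 hz0
    have h1 : DifferentiableAt ℂ (mol (infDist z0 Ωᶜ / 8) F) z0 := by
      refine hh (by positivity) (Subset.trans (closedBall_subset_ball ?_) (hsub z0)); linarith
    refine (h1.congr_of_eventuallyEq ?_).differentiableWithinAt
    filter_upwards [ball_mem_nhds z0 (show 0 < infDist z0 Ωᶜ / 4 by positivity)] with z hz using hG z0 hz0 z hz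
  · rw [ae_iff]
    refine measure_null_of_locally_null _ (fun z0 hz0' => ?_)
    simp only [mem_ofPred_eq, Classical.not_imp] at hz0'
    have hz0 := hz0'.1
    have h0 := hd0 z0 hz0
    set r := infDist z0 Ωᶜ / 4 with hr
    have hr0 : 0 < r := by positivity
    refine ⟨{z | z ∈ ball z0 r ∧ mol (r / 2) F z ≠ F z}, ?_, ?_⟩
    · filter_upwards [self_mem_nhdsWithin, mem_nhdsWithin_of_mem_nhds (ball_mem_nhds z0 hr0)] with z hz hz2
      refine ⟨hz2, ?_⟩
      simp only [mem_ofPred_eq, Classical.not_imp] at hz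
      rw [hG z0 hz0 z hz2] at hz
      have h8 : r / 2 = infDist z0 Ωᶜ / 8 := by rw [hr]; ring
      rw [h8]; exact hz.2
    · have hle : ∀ᶠ ε in 𝓝[>] (0:ℝ), eLpNorm (fun z => mol (r/2) F z - F z) 2 (volume.restrict (ball z0 r)) ≤
          eLpNorm (fun z => mol ε F z - F z) 2 volume := by
        filter_upwards [Ioo_mem_nhdsGT hr0] with ε hε
        refine le_trans (le_of_eq ?_) (eLpNorm_mono_measure _ (Measure.restrict_le_self (s := ball z0 r)))
        refine eLpNorm_congr_ae ?_
        filter_upwards [ae_restrict_mem measurableSet_ball] with z hz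
        rw [ind (z0 := z0) (r := r) ?_ (by positivity) hε.1 (by linarith) hε.2 z hz]
        convert hsub z0 using 2; rw [hr]; ring
      have h1 := ge_of_tendsto (mol_tendsto hF) hle
      have h2 : eLpNorm (fun z => mol (r/2) F z - F z) 2 (volume.restrict (ball z0 r)) = 0 := by simpa using h1
      rw [eLpNorm_eq_zero_iff] at h2
      · rw [EventuallyEq, ae_restrict_iff' measurableSet_ball, ae_iff] at h2
        refine measure_mono_null ?_ h2
        rintro z ⟨hz, hz2⟩ h
        exact hz2 (sub_eq_zero.1 (h hz))
      · exact ((mol_smooth hli (by positivity)).continuous.aestronglyMeasurable.sub hF.1).restrict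
      · norm_num

end Loc
end

section
namespace Loc
open Filter Topology ContDiff ComplexConjugate Complex

/-- complexification of a real function -/
def cx (φ : Cn n → ℝ) : Cn n → ℂ := fun z => (φ z : ℂ)

lemma cx_contDiff {φ : Cn n → ℝ} {m : WithTop ℕ∞} (h : ContDiff ℝ m φ) : ContDiff ℝ m (cx φ) :=
  ofRealCLM.contDiff.comp h

lemma conj_del_cx {φ : Cn n → ℝ} {z : Cn n} (h : DifferentiableAt ℝ (cx φ) z) (j : Fin n) :
    conj (del j (cx φ) z) = dbar j (cx φ) z := by
  rw [← dbar_conj j h]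
  congr 1; ext w; simp [cx]

lemma conj_dbar_cx {φ : Cn n → ℝ} {z : Cn n} (h : DifferentiableAt ℝ (cx φ) z) (j : Fin n) :
    conj (dbar j (cx φ) z) = del j (cx φ) z := by
  rw [← conj_del_cx h, conj_conj]

/-- the weight -/
def wt (φ : Cn n → ℝ) : Cn n → ℂ := fun z => exp (-(cx φ z))

lemma wt_eq (φ : Cn n → ℝ) (z : Cn n) : wt φ z = (Real.exp (-(φ z)) : ℂ) := by simp [wt, cx]

lemma conj_wt (φ : Cn n → ℝ) (z : Cn n) : conj (wt φ z) = wt φ z := by rw [wt_eq, conj_ofReal]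

lemma wt_contDiff {φ : Cn n → ℝ} {m : WithTop ℕ∞} (h : ContDiff ℝ m φ) : ContDiff ℝ m (wt φ) :=
  (cx_contDiff h).neg.cexp

lemma fderiv_wt {φ : Cn n → ℝ} {z : Cn n} (h : DifferentiableAt ℝ (cx φ) z) (X : Cn n) :
    fderiv ℝ (wt φ) z X = - (fderiv ℝ (cx φ) z X) * wt φ z := by
  have := (h.hasFDerivAt.fun_neg.cexp).fderiv
  have e : wt φ = fun z => exp (-(cx φ) z) := rfl
  rw [e, this]
  simp [mul_comm]

lemma del_wt {φ : Cn n → ℝ} {z : Cn n} (h : DifferentiableAt ℝ (cx φ) z) (j : Fin n) :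
    del j (wt φ) z = - del j (cx φ) z * wt φ z := by
  simp only [del, fderiv_wt h]; ring

lemma bochner_jk {φ : Cn n → ℝ} (hφ : ContDiff ℝ 2 φ) {u v : Cn n → ℂ} (hu : ContDiff ℝ 2 u) (hv : ContDiff ℝ 2 v)
    (hcu : HasCompactSupport u) (hcv : HasCompactSupport v) (j k : Fin n) :
    ∫ z, (del j u z - del j (cx φ) z * u z) * conj (del k v z - del k (cx φ) z * v z) * wt φ z =
    (∫ z, dbar k u z * conj (dbar j v z) * wt φ z) +
      ∫ z, del j (dbar k (cx φ)) z * u z * conj (v z) * wt φ z := by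
  have hΦ := cx_contDiff hφ
  have hw := wt_contDiff hφ
  have h12 : (1:WithTop ℕ∞) ≤ 2 := by norm_num
  have dΦ : ∀ z, DifferentiableAt ℝ (cx φ) z := fun z => hΦ.differentiable (by simp) z
  have dw : ∀ z, DifferentiableAt ℝ (wt φ) z := fun z => hw.differentiable (by simp) z
  have du : ∀ z, DifferentiableAt ℝ u z := fun z => hu.differentiable (by simp) z
  have dv : ∀ z, DifferentiableAt ℝ v z := fun z => hv.differentiable (by simp) z
  have cdel : ∀ {f : Cn n → ℂ} (l : Fin n), ContDiff ℝ 2 f → ContDiff ℝ 1 (del l f) :=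
    fun l hf => contDiff_del (m := 2) (k := 1) l hf (by norm_num)
  have cdbar : ∀ {f : Cn n → ℂ} (l : Fin n), ContDiff ℝ 2 f → ContDiff ℝ 1 (dbar l f) :=
    fun l hf => contDiff_dbar (m := 2) (k := 1) l hf (by norm_num)
  have cconj : ∀ {f : Cn n → ℂ}, ContDiff ℝ 1 f → ContDiff ℝ 1 (fun z => conj (f z)) :=
    fun hf => conjCLE.toContinuousLinearMap.contDiff.comp hf
  have d1 : ∀ {f : Cn n → ℂ}, ContDiff ℝ 1 f → ∀ z, DifferentiableAt ℝ f z := fun hf z => hf.differentiable (by simp) z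
  -- first integration by parts
  let g : Cn n → ℂ := fun z => del k v z - del k (cx φ) z * v z
  have hg : ContDiff ℝ 1 g := (cdel k hv).sub ((cdel k hΦ).mul (hv.of_le h12))
  have e1 : ∀ z, (del j u z - del j (cx φ) z * u z) * conj (g z) * wt φ z =
      conj (g z) * del j (fun z => u z * wt φ z) z := by
    intro z; rw [del_mul j (du z) (dw z), del_wt (dΦ z)]; ring
  have e2 : ∀ z, del j (fun z => conj (g z)) z = conj (del k (dbar j v) z - del k (cx φ) z * dbar j v z)
      - del j (dbar k (cx φ)) z * conj (v z) := by
    intro z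
    rw [del_conj j (d1 hg z)]
    have : dbar j g z = dbar j (del k v) z - (del k (cx φ) z * dbar j v z + dbar j (del k (cx φ)) z * v z) := by
      show dbar j (fun z => del k v z - del k (cx φ) z * v z) z = _
      rw [dbar_sub j (d1 (cdel k hv) z) ((d1 (cdel k hΦ) z).fun_mul (dv z)), dbar_mul j (d1 (cdel k hΦ) z) (dv z)]
    have e3 : conj (dbar j (del k (cx φ)) z) = del j (dbar k (cx φ)) z := by
      rw [← del_conj j (d1 (cdel k hΦ) z)]
      congr 1; ext w; exact conj_del_cx (dΦ w) k
    rw [this, ← e3, del_dbar_comm hv]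
    simp only [map_sub, map_add, map_mul]; ring
  have hcs1 : HasCompactSupport (fun z => u z * wt φ z) := hcu.mul_right
  have step1 := ibp_del (cconj hg) ((hu.of_le h12).mul (hw.of_le h12)) hcs1 j
  -- second
  let q : Cn n → ℂ := fun z => dbar j v z * wt φ z
  have hq : ContDiff ℝ 1 q := (cdbar j hv).mul (hw.of_le h12)
  have hcq : HasCompactSupport q := (hcs_dbar j hcv).mul_right
  have e4 : ∀ z, dbar k (fun z => conj (q z)) z = conj (del k (dbar j v) z - del k (cx φ) z * dbar j v z) * wt φ z := by
    intro z
    rw [dbar_conj k (d1 hq z)]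
    have : del k q z = dbar j v z * (- del k (cx φ) z * wt φ z) + del k (dbar j v) z * wt φ z := by
      show del k (fun z => dbar j v z * wt φ z) z = _
      rw [del_mul k (d1 (cdbar j hv) z) (dw z), del_wt (dΦ z)]
    rw [this]
    simp only [map_sub, map_add, map_mul, map_neg, conj_wt]; ring
  have hcq' : HasCompactSupport (fun z => conj (q z)) := hcq.comp_left (g := fun x : ℂ => conj x) (by simp)
  have step2 := ibp_dbar (hu.of_le h12) (cconj hq) hcq' k
  simp_rw [e4] at step2
  calc _ = ∫ z, conj (g z) * del j (fun z => u z * wt φ z) z := by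
        congr 1; ext z; exact e1 z
    _ = - ∫ z, (conj (del k (dbar j v) z - del k (cx φ) z * dbar j v z)
      - del j (dbar k (cx φ)) z * conj (v z)) * (u z * wt φ z) := by rw [step1]; simp_rw [e2]
    _ = - ∫ z, (u z * (conj (del k (dbar j v) z - del k (cx φ) z * dbar j v z) * wt φ z)
          - del j (dbar k (cx φ)) z * u z * conj (v z) * wt φ z) := by
        congr 2; ext z; ring
    _ = _ := by
        rw [integral_sub, step2]
        · have : ∀ z, dbar k u z * conj (q z) = dbar k u z * conj (dbar j v z) * wt φ z := by
            intro z; simp only [q, map_mul, conj_wt]; ring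
          simp_rw [this]; ring
        · have hc : Continuous (fun z => u z * (conj (del k (dbar j v) z - del k (cx φ) z * dbar j v z) * wt φ z)) := by
            simp_rw [← e4]
            exact hu.continuous.mul (contDiff_dbar (m := 1) (k := 0) k (cconj hq) (by norm_num)).continuous
          exact hc.integrable_of_hasCompactSupport hcu.mul_right
        · have hc : Continuous (fun z => del j (dbar k (cx φ)) z * u z * conj (v z) * wt φ z) :=
            (((contDiff_del (m := 1) (k := 0) j (cdbar k hΦ) (by norm_num)).continuous.mul hu.continuous).mul
              (cconj (hv.of_le h12)).continuous).mul hw.continuous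
          exact hc.integrable_of_hasCompactSupport (hcu.mul_left.mul_right.mul_right)

lemma sum_re_mul_conj (x : Fin n → ℂ) : ∑ j, ∑ k, (x j * conj (x k)).re = ‖∑ j, x j‖ ^ 2 := by
  have : (‖∑ j, x j‖ ^ 2 : ℝ) = ((∑ j, x j) * conj (∑ k, x k)).re := by
    rw [mul_conj, ofReal_re, normSq_eq_norm_sq]
  rw [this, map_sum, Finset.sum_mul_sum, re_sum]
  exact Finset.sum_congr rfl (fun j _ => (re_sum _ _).symm)

lemma sum_re_swap (c : Fin n → Fin n → ℂ) :
    - ∑ j, ∑ k, (c j k * conj (c k j)).re ≤ ∑ j, ∑ k, (1/2:ℝ) * ‖c j k - c k j‖ ^ 2 := by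
  rw [← Finset.sum_neg_distrib]
  refine Finset.sum_le_sum (fun j _ => ?_)
  rw [← Finset.sum_neg_distrib]
  refine Finset.sum_le_sum (fun k _ => ?_)
  rw [← normSq_eq_norm_sq, normSq_sub]
  nlinarith [normSq_nonneg (c j k), normSq_nonneg (c k j)]

set_option maxHeartbeats 1000000 in
/-- smooth Bochner inequality -/
lemma bochner {φ : Cn n → ℝ} (hφ : ContDiff ℝ 2 φ) {b : Fin n → Cn n → ℂ} (hb : ∀ j, ContDiff ℝ 2 (b j))
    (hc : ∀ j, HasCompactSupport (b j)) :
    ∫ z, ∑ j, ∑ k, (del j (dbar k (cx φ)) z * b j z * conj (b k z)).re * Real.exp (-(φ z)) ≤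
    ∫ z, (‖∑ j, (del j (b j) z - del j (cx φ) z * b j z)‖ ^ 2 * Real.exp (-(φ z)) +
      ∑ j, ∑ k, (1/2:ℝ) * ‖dbar k (b j) z - dbar j (b k) z‖ ^ 2 * Real.exp (-(φ z))) := by
  have hΦ := cx_contDiff hφ
  have cdel : ∀ {f : Cn n → ℂ} (l : Fin n), ContDiff ℝ 2 f → ContDiff ℝ 1 (del l f) :=
    fun l hf => contDiff_del (m := 2) (k := 1) l hf (by norm_num)
  have cdbar : ∀ {f : Cn n → ℂ} (l : Fin n), ContDiff ℝ 2 f → ContDiff ℝ 1 (dbar l f) :=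
    fun l hf => contDiff_dbar (m := 2) (k := 1) l hf (by norm_num)
  have hwc : Continuous (fun z => Real.exp (-(φ z))) := Real.continuous_exp.comp hφ.continuous.neg
  let x : Fin n → Cn n → ℂ := fun j z => del j (b j) z - del j (cx φ) z * b j z
  have hxc : ∀ j, Continuous (x j) := fun j =>
    (cdel j (hb j)).continuous.sub ((cdel j hΦ).continuous.mul (hb j).continuous)
  have hxs : ∀ j, HasCompactSupport (x j) := fun j => (hcs_del j (hc j)).sub (hc j).mul_left
  have hdc : ∀ j k, Continuous (dbar k (b j)) := fun j k => (cdbar k (hb j)).continuous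
  have hds : ∀ j k, HasCompactSupport (dbar k (b j)) := fun j k => hcs_dbar k (hc j)
  have hfc : ∀ j k, Continuous (del j (dbar k (cx φ))) := fun j k =>
    (contDiff_del (m := 1) (k := 0) j (cdbar k hΦ) (by norm_num)).continuous
  have int_gen : ∀ {f g : Cn n → ℂ}, Continuous f → HasCompactSupport f → Continuous g →
      Integrable (fun z => (f z * conj (g z)).re * Real.exp (-(φ z))) := by
    intro f g hf hs hg
    have h1 : Continuous (fun z => (f z * conj (g z)).re * Real.exp (-(φ z))) :=
      (continuous_re.comp (hf.mul (continuous_conj.comp hg))).mul hwc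
    refine h1.integrable_of_hasCompactSupport (HasCompactSupport.mul_right ?_)
    exact (hs.mul_right (f' := fun z => conj (g z))).comp_left (g := re) (by simp)
  have toC : ∀ {f g : Cn n → ℂ}, Continuous f → HasCompactSupport f → Continuous g →
      ∫ z, (f z * conj (g z)).re * Real.exp (-(φ z)) = (∫ z, f z * conj (g z) * wt φ z).re := by
    intro f g hf hs hg
    have hi : Integrable (fun z => f z * conj (g z) * wt φ z) := by
      refine Continuous.integrable_of_hasCompactSupport ?_ (hs.mul_right.mul_right)
      exact (hf.mul (continuous_conj.comp hg)).mul (wt_contDiff hφ).continuous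
    have := integral_re hi
    simp only [RCLike.re_eq_complex_re] at this
    rw [← this]
    congr 1; ext z; rw [wt_eq, re_mul_ofReal]
  have hbs : ∀ j k, HasCompactSupport (fun z => del j (dbar k (cx φ)) z * b j z) := fun j k => (hc j).mul_left
  have key : ∀ j k, ∫ z, (x j z * conj (x k z)).re * Real.exp (-(φ z)) =
      (∫ z, (dbar k (b j) z * conj (dbar j (b k) z)).re * Real.exp (-(φ z))) +
      ∫ z, (del j (dbar k (cx φ)) z * b j z * conj (b k z)).re * Real.exp (-(φ z)) := by
    intro j k
    rw [toC (hxc j) (hxs j) (hxc k), toC (hdc j k) (hds j k) (hdc k j),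
      toC (f := fun z => del j (dbar k (cx φ)) z * b j z) ((hfc j k).mul (hb j).continuous) (hbs j k) (hb k).continuous, ← add_re]
    congr 1
    exact bochner_jk hφ (hb j) (hb k) (hc j) (hc k) j k
  have i1 := fun j k => int_gen (hxc j) (hxs j) (hxc k)
  have i2 := fun j k => int_gen (hdc j k) (hds j k) (hdc k j)
  have i3 := fun j k => int_gen (f := fun z => del j (dbar k (cx φ)) z * b j z) ((hfc j k).mul (hb j).continuous) (hbs j k) (hb k).continuous
  have i12 : ∀ j k, Integrable (fun z => (x j z * conj (x k z)).re * Real.exp (-(φ z)) -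
        (dbar k (b j) z * conj (dbar j (b k) z)).re * Real.exp (-(φ z))) := fun j k => (i1 j k).sub (i2 j k)
  have eL : ∫ z, ∑ j, ∑ k, (del j (dbar k (cx φ)) z * b j z * conj (b k z)).re * Real.exp (-(φ z)) =
      ∫ z, ∑ j, ∑ k, ((x j z * conj (x k z)).re * Real.exp (-(φ z)) -
        (dbar k (b j) z * conj (dbar j (b k) z)).re * Real.exp (-(φ z))) := by
    rw [integral_finsetSum _ (fun j _ => integrable_finsetSum _ (fun k _ => i3 j k)),
      integral_finsetSum _ (fun j _ => integrable_finsetSum _ (fun k _ => i12 j k))]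
    refine Finset.sum_congr rfl (fun j _ => ?_)
    rw [integral_finsetSum _ (fun k _ => i3 j k), integral_finsetSum _ (fun k _ => i12 j k)]
    refine Finset.sum_congr rfl (fun k _ => ?_)
    rw [integral_sub (i1 j k) (i2 j k), key]; ring
  rw [eL]
  apply integral_mono
  · exact integrable_finsetSum _ (fun j _ => integrable_finsetSum _ (fun k _ => i12 j k))
  · have hcX : Continuous (fun z => ∑ j, x j z) := continuous_finsetSum _ (fun j _ => hxc j)
    have hsX : HasCompactSupport (fun z => ∑ j, x j z) := by
      refine HasCompactSupport.intro (isCompact_iUnion (fun j => (hxs j).isCompact)) (K := ⋃ j, tsupport (x j)) ?_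
      intro z hz
      refine Finset.sum_eq_zero (fun j _ => image_eq_zero_of_notMem_tsupport (fun h => hz (mem_iUnion.2 ⟨j, h⟩)))
    have ii : ∀ {f : Cn n → ℂ}, Continuous f → HasCompactSupport f → Integrable (fun z => ‖f z‖ ^ 2 * Real.exp (-(φ z))) := by
      intro f hf hs
      refine ((hf.norm.pow 2).mul hwc).integrable_of_hasCompactSupport
        (HasCompactSupport.intro hs.isCompact (fun z hz => ?_))
      simp [image_eq_zero_of_notMem_tsupport hz]
    refine (ii hcX hsX).add (integrable_finsetSum _ (fun j _ => integrable_finsetSum _ (fun k _ => ?_)))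
    simp_rw [mul_assoc]
    exact (ii ((hdc j k).sub (hdc k j)) ((hds j k).sub (hds k j))).const_mul _
  · intro z
    have h1 := sum_re_mul_conj (fun j => x j z)
    have h2 := sum_re_swap (fun j k => dbar k (b j) z)
    have he := (Real.exp_pos (-(φ z))).le
    have h3 := mul_le_mul_of_nonneg_right h2 he
    have h4 : ∑ j, ∑ k, ((x j z * conj (x k z)).re * Real.exp (-(φ z)) -
        (dbar k (b j) z * conj (dbar j (b k) z)).re * Real.exp (-(φ z))) =
        (∑ j, ∑ k, (x j z * conj (x k z)).re) * Real.exp (-(φ z)) +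
        (- ∑ j, ∑ k, (dbar k (b j) z * conj (dbar j (b k) z)).re) * Real.exp (-(φ z)) := by
      simp only [Finset.sum_sub_distrib, ← Finset.sum_mul]; ring
    have h5 : ∑ j, ∑ k, (1/2:ℝ) * ‖dbar k (b j) z - dbar j (b k) z‖ ^ 2 * Real.exp (-(φ z)) =
        (∑ j, ∑ k, (1/2:ℝ) * ‖dbar k (b j) z - dbar j (b k) z‖ ^ 2) * Real.exp (-(φ z)) := by
      simp only [← Finset.sum_mul]
    show _ ≤ _ + _
    refine h4.le.trans ?_
    rw [h1, h5]
    exact add_le_add le_rfl h3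

end Loc
end

section
namespace Loc
open Filter Topology ContDiff ComplexConjugate Complex

lemma mol_memLp {f : Cn n → ℂ} (hf : MemLp f 2) {ε : ℝ} (hε : 0 < ε) : MemLp (mol ε f) 2 := by
  have hcont : Continuous (ker ε : Cn n → ℝ) := (ker_smooth ε).continuous
  refine ⟨(mol_smooth (hf.locallyIntegrable (by norm_num)) hε).continuous.aestronglyMeasurable, ?_⟩
  have h : eLpNorm (mol ε f) 2 volume ^ 2 ≤ eLpNorm f 2 volume ^ 2 := by
    rw [sq_eLpNorm, sq_eLpNorm]
    calc ∫⁻ x, ‖mol ε f x‖ₑ ^ 2 ≤ ∫⁻ x, ∫⁻ y, ENNReal.ofReal (ker ε y) * ‖f (x - y)‖ₑ ^ 2 :=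
          lintegral_mono (lint_mol hf.1 hε)
      _ = ∫⁻ y, ∫⁻ x, ENNReal.ofReal (ker ε y) * ‖f (x - y)‖ₑ ^ 2 := by
          apply lintegral_lintegral_swap
          exact ((hcont.measurable.ennreal_ofReal).comp measurable_snd).aemeasurable.mul
            ((hf.1.comp_quasiMeasurePreserving (quasiMeasurePreserving_sub volume volume)).enorm.pow_const 2)
      _ = ∫⁻ y, ENNReal.ofReal (ker ε y) * ∫⁻ x, ‖f x‖ₑ ^ 2 := by
          congr 1; ext y
          rw [lintegral_const_mul' _ _ (by simp), lintegral_sub_right_eq_self (fun x => ‖f x‖ₑ ^ 2)]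
      _ = _ := by rw [lintegral_mul_const _ (hcont.measurable.ennreal_ofReal), ker_lintegral hε, one_mul]
  exact lt_of_le_of_lt ((ENNReal.pow_le_pow_left_iff (by norm_num)).1 h) hf.2

/-- L2 convergence -/
def T2 (u : ℕ → Cn n → ℂ) (v : Cn n → ℂ) : Prop :=
  (∀ m, MemLp (u m) 2) ∧ MemLp v 2 ∧ Tendsto (fun m => eLpNorm (u m - v) 2 volume) atTop (𝓝 0)

/-- convergence of integrals -/
def TI (f : ℕ → Cn n → ℝ) (g : Cn n → ℝ) : Prop :=
  (∀ m, Integrable (f m)) ∧ Integrable g ∧ Tendsto (fun m => ∫ z, f m z) atTop (𝓝 (∫ z, g z))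

lemma TI.sum {ι : Type*} (s : Finset ι) {f : ι → ℕ → Cn n → ℝ} {g : ι → Cn n → ℝ} (h : ∀ i, TI (f i) (g i)) :
    TI (fun m z => ∑ i ∈ s, f i m z) (fun z => ∑ i ∈ s, g i z) := by
  refine ⟨fun m => integrable_finsetSum _ (fun i _ => (h i).1 m), integrable_finsetSum _ (fun i _ => (h i).2.1), ?_⟩
  simp_rw [integral_finsetSum s (fun i _ => (h i).2.1), fun m => integral_finsetSum s (fun i _ => (h i).1 m)]
  exact tendsto_finsetSum _ (fun i _ => (h i).2.2)

lemma TI.add {f f' : ℕ → Cn n → ℝ} {g g' : Cn n → ℝ} (h : TI f g) (h' : TI f' g') :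
    TI (fun m z => f m z + f' m z) (fun z => g z + g' z) := by
  refine ⟨fun m => (h.1 m).add (h'.1 m), h.2.1.add h'.2.1, ?_⟩
  simp_rw [integral_add h.2.1 h'.2.1, fun m => integral_add (h.1 m) (h'.1 m)]
  exact h.2.2.add h'.2.2

lemma T2.add {u u' : ℕ → Cn n → ℂ} {v v' : Cn n → ℂ} (h : T2 u v) (h' : T2 u' v') :
    T2 (fun m z => u m z + u' m z) (fun z => v z + v' z) := by
  refine ⟨fun m => (h.1 m).add (h'.1 m), h.2.1.add h'.2.1, ?_⟩
  have := h.2.2.add h'.2.2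
  rw [add_zero] at this
  refine tendsto_of_tendsto_of_tendsto_of_le_of_le tendsto_const_nhds this (fun m => zero_le) (fun m => ?_)
  refine le_trans (le_of_eq ?_) (eLpNorm_add_le ((h.1 m).sub h.2.1).1 ((h'.1 m).sub h'.2.1).1 (by norm_num))
  congr 1; ext z; simp; ring

lemma memLp_bdd_mul {c f : Cn n → ℂ} {M : ℝ} (hc : Continuous c) (hM : ∀ z, ‖c z‖ ≤ M) (hf : MemLp f 2) :
    MemLp (fun z => c z * f z) 2 :=
  hf.of_le_mul (c := M) (hc.aestronglyMeasurable.mul hf.1) (ae_of_all _ (fun z => by rw [norm_mul]; gcongr; exact hM z))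

lemma T2.mul {c : Cn n → ℂ} {M : ℝ} (hc : Continuous c) (hM : ∀ z, ‖c z‖ ≤ M)
    {u : ℕ → Cn n → ℂ} {v : Cn n → ℂ} (h : T2 u v) :
    T2 (fun m z => c z * u m z) (fun z => c z * v z) := by
  refine ⟨fun m => memLp_bdd_mul hc hM (h.1 m), memLp_bdd_mul hc hM h.2.1, ?_⟩
  have := ENNReal.Tendsto.const_mul (a := ENNReal.ofReal M) h.2.2 (Or.inr (by simp))
  rw [mul_zero] at this
  refine tendsto_of_tendsto_of_tendsto_of_le_of_le tendsto_const_nhds this (fun m => zero_le) (fun m => ?_)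
  refine eLpNorm_le_mul_eLpNorm_of_ae_le_mul (ae_of_all _ (fun z => ?_)) 2
  simp only [Pi.sub_apply, ← mul_sub, norm_mul]
  gcongr; exact hM z

lemma T2.sum {ι : Type*} [DecidableEq ι] (s : Finset ι) {f : ι → ℕ → Cn n → ℂ} {g : ι → Cn n → ℂ} (h : ∀ i, T2 (f i) (g i)) :
    T2 (fun m z => ∑ i ∈ s, f i m z) (fun z => ∑ i ∈ s, g i z) := by
  induction s using Finset.induction_on with
  | empty => simp [T2]
  | insert a s ha ih => simp_rw [Finset.sum_insert ha]; exact (h a).add ih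

lemma T2.inn {u u' : ℕ → Cn n → ℂ} {v v' : Cn n → ℂ} (h : T2 u v) (h' : T2 u' v') :
    TI (fun m z => (u m z * conj (u' m z)).re) (fun z => (v z * conj (v' z)).re) := by
  have ii : ∀ {f g : Cn n → ℂ}, MemLp f 2 → MemLp g 2 → Integrable (fun z => f z * conj (g z)) := by
    intro f g hf hg
    exact hf.integrable_mul (q := 2) hg.star
  have e : ∀ {f g : Cn n → ℂ} (hf : MemLp f 2) (hg : MemLp g 2),
      ∫ z, (f z * conj (g z)).re = (Inner.inner ℂ (hg.toLp) (hf.toLp)).re := by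
    intro f g hf hg
    rw [L2.inner_def]
    have := integral_re (ii hf hg)
    simp only [RCLike.re_eq_complex_re] at this
    rw [this]
    congr 1
    apply integral_congr_ae
    filter_upwards [hf.coeFn_toLp, hg.coeFn_toLp] with z h1 h2
    rw [h1, h2]; simp [RCLike.inner_apply]
  refine ⟨fun m => (ii (h.1 m) (h'.1 m)).re, (ii h.2.1 h'.2.1).re, ?_⟩
  simp_rw [e h.2.1 h'.2.1, fun m => e (h.1 m) (h'.1 m)]
  have t1 := (Lp.tendsto_Lp_iff_tendsto_eLpNorm'' u h.1 v h.2.1).2 h.2.2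
  have t2 := (Lp.tendsto_Lp_iff_tendsto_eLpNorm'' u' h'.1 v' h'.2.1).2 h'.2.2
  exact (continuous_re.tendsto _).comp (t2.inner t1)

lemma T2.sq {c : Cn n → ℝ} {M : ℝ} (hc : Continuous c) (hM : ∀ z, ‖c z‖ ≤ M)
    {u : ℕ → Cn n → ℂ} {v : Cn n → ℂ} (h : T2 u v) :
    TI (fun m z => ‖u m z‖ ^ 2 * c z) (fun z => ‖v z‖ ^ 2 * c z) := by
  have h1 := (h.mul (c := fun z => (c z : ℂ)) (M := M) (continuous_ofReal.comp hc) (fun z => by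
    rw [norm_real]; exact hM z)).inn h
  have e : ∀ (x : ℂ) (y : ℝ), ((y:ℂ) * x * conj x).re = ‖x‖ ^ 2 * y := by
    intro x y; rw [mul_assoc, mul_conj, ← ofReal_mul, ofReal_re, normSq_eq_norm_sq]; ring
  simp_rw [e] at h1
  exact h1

lemma mol_T2 {f : Cn n → ℂ} (hf : MemLp f 2) : T2 (fun m : ℕ => mol (1/((m:ℝ)+1)) f) f := by
  refine ⟨fun m => mol_memLp hf (by positivity), hf, ?_⟩
  refine (mol_tendsto hf).comp (tendsto_nhdsWithin_iff.2 ⟨tendsto_one_div_add_atTop_nhds_zero_nat, ?_⟩)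
  exact Eventually.of_forall (fun m => by simp only [mem_Ioi]; positivity)

lemma mol_hcs {f : Cn n → ℂ} (hf : HasCompactSupport f) {ε : ℝ} (hε : 0 < ε) : HasCompactSupport (mol ε f) := by
  refine HasCompactSupport.intro (hf.isCompact.add (isCompact_closedBall (0 : Cn n) ε)) (fun z hz => ?_)
  rw [mol_eq]
  refine integral_eq_zero_of_ae (ae_of_all _ (fun y => ?_))
  by_cases hy : y ∈ tsupport f
  · have : ε ≤ ‖z - y‖ := by
      by_contra h
      exact hz ⟨y, hy, z - y, by simpa using (not_le.1 h).le, by simp⟩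
    simp [ker_zero hε this]
  · simp [image_eq_zero_of_notMem_tsupport hy]

lemma li_mul {f g : Cn n → ℂ} (hf : LocallyIntegrable f) (hg : Continuous g) (hs : HasCompactSupport g) :
    Integrable (fun z => f z * g z) := by
  have := hf.integrable_smul_left_of_hasCompactSupport hg hs
  simpa [mul_comm] using this

/-- Bochner inequality for rough data -/
lemma bochner_weak {φ : Cn n → ℝ} (hφ : ContDiff ℝ 2 φ) (hφc : HasCompactSupport φ) {b : Fin n → Cn n → ℂ}
    (hb : ∀ j, MemLp (b j) 2) (hc : ∀ j, HasCompactSupport (b j)) {R : Fin n → Fin n → Cn n → ℂ} {H : Cn n → ℂ}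
    (hR : ∀ j k, MemLp (R j k) 2) (hH : MemLp H 2)
    (wR : ∀ j k w, ContDiff ℝ ∞ w → HasCompactSupport w →
      ∫ z, (b j z * dbar k w z - b k z * dbar j w z) = - ∫ z, R j k z * w z)
    (wH : ∀ w, ContDiff ℝ ∞ w → HasCompactSupport w →
      ∫ z, ∑ j, b j z * del j w z = - ∫ z, H z * w z) :
    Integrable (fun z => ∑ j, ∑ k, (del j (dbar k (cx φ)) z * b j z * conj (b k z)).re * Real.exp (-(φ z))) ∧ Integrable (fun z => ‖H z + ∑ j, - del j (cx φ) z * b j z‖ ^ 2 * Real.exp (-(φ z)) +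
      ∑ j, ∑ k, (1/2:ℝ) * ‖R j k z‖ ^ 2 * Real.exp (-(φ z))) ∧
    ∫ z, ∑ j, ∑ k, (del j (dbar k (cx φ)) z * b j z * conj (b k z)).re * Real.exp (-(φ z)) ≤
    ∫ z, (‖H z + ∑ j, - del j (cx φ) z * b j z‖ ^ 2 * Real.exp (-(φ z)) +
      ∑ j, ∑ k, (1/2:ℝ) * ‖R j k z‖ ^ 2 * Real.exp (-(φ z))) := by
  have hΦ := cx_contDiff hφ
  have hΦc : HasCompactSupport (cx φ) := hφc.comp_left (g := fun x : ℝ => (x : ℂ)) (by simp)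
  have cdel : ∀ {f : Cn n → ℂ} (l : Fin n), ContDiff ℝ 2 f → ContDiff ℝ 1 (del l f) :=
    fun l hf => contDiff_del (m := 2) (k := 1) l hf (by norm_num)
  have cdbar : ∀ {f : Cn n → ℂ} (l : Fin n), ContDiff ℝ 2 f → ContDiff ℝ 1 (dbar l f) :=
    fun l hf => contDiff_dbar (m := 2) (k := 1) l hf (by norm_num)
  have hli : ∀ j, LocallyIntegrable (b j) := fun j => (hb j).locallyIntegrable (by norm_num)
  have hwc : Continuous (fun z => Real.exp (-(φ z))) := Real.continuous_exp.comp hφ.continuous.neg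
  obtain ⟨M0, hM0⟩ := hφc.exists_bound_of_continuous hφ.continuous
  have hM : ∀ z, ‖Real.exp (-(φ z))‖ ≤ Real.exp M0 := by
    intro z
    rw [Real.norm_of_nonneg (Real.exp_pos _).le]
    exact Real.exp_le_exp.2 ((neg_le_abs _).trans (hM0 z))
  have e0 : ∀ m : ℕ, 0 < 1/((m:ℝ)+1) := fun m => by positivity
  have kz : ∀ (ε : ℝ) (z : Cn n), 0 < ε → ContDiff ℝ ∞ (fun y => (ker ε (z - y) : ℂ)) ∧ HasCompactSupport (fun y => (ker ε (z - y) : ℂ)) :=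
    fun ε z hε => ⟨(kerC_smooth ε).comp (contDiff_const.sub contDiff_id), (kerC_hcs hε).comp_homeomorph (Homeomorph.subLeft z)⟩
  have idb : ∀ j k (ε : ℝ) z, 0 < ε → Integrable (fun y => b j y * dbar k (fun y => (ker ε (z - y) : ℂ)) y) := by
    intro j k ε z hε
    exact li_mul (hli j) (contDiff_dbar (m := ⊤) (k := 0) k (kz ε z hε).1 (by simp)).continuous (hcs_dbar k (kz ε z hε).2)
  have idl : ∀ j k (ε : ℝ) z, 0 < ε → Integrable (fun y => b j y * del k (fun y => (ker ε (z - y) : ℂ)) y) := by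
    intro j k ε z hε
    exact li_mul (hli j) (contDiff_del (m := ⊤) (k := 0) k (kz ε z hε).1 (by simp)).continuous (hcs_del k (kz ε z hε).2)
  have eR : ∀ j k (ε : ℝ) z, 0 < ε → dbar k (mol ε (b j)) z - dbar j (mol ε (b k)) z = mol ε (R j k) z := by
    intro j k ε z hε
    have := wR j k _ (kz ε z hε).1 (kz ε z hε).2
    rw [integral_sub (idb j k ε z hε) (idb k j ε z hε)] at this
    rw [dbar_mol (hli j) hε, dbar_mol (hli k) hε, mol_eq]
    linear_combination -this
  have eH : ∀ (ε : ℝ) z, 0 < ε → ∑ j, del j (mol ε (b j)) z = mol ε H z := by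
    intro ε z hε
    have := wH _ (kz ε z hε).1 (kz ε z hε).2
    rw [integral_finsetSum _ (fun j _ => idl j j ε z hε)] at this
    rw [mol_eq, ← neg_eq_iff_eq_neg.2 this, ← Finset.sum_neg_distrib]
    exact Finset.sum_congr rfl (fun j _ => del_mol (hli j) hε j z)
  have hdb : ∀ j, ∃ M : ℝ, ∀ z, ‖-del j (cx φ) z‖ ≤ M := fun j => by
    obtain ⟨M, hM⟩ := (hcs_del j hΦc).exists_bound_of_continuous (cdel j hΦ).continuous
    exact ⟨M, fun z => by rw [norm_neg]; exact hM z⟩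
  have hL : TI (fun (m : ℕ) z => ∑ j, ∑ k, (del j (dbar k (cx φ)) z * mol (1/((m:ℝ)+1)) (b j) z *
      conj (mol (1/((m:ℝ)+1)) (b k) z)).re * Real.exp (-(φ z)))
      (fun z => ∑ j, ∑ k, (del j (dbar k (cx φ)) z * b j z * conj (b k z)).re * Real.exp (-(φ z))) := by
    refine TI.sum _ (fun j => TI.sum _ (fun k => ?_))
    have hcj : Continuous (fun z => del j (dbar k (cx φ)) z * wt φ z) :=
      (contDiff_del (m := 1) (k := 0) j (cdbar k hΦ) (by norm_num)).continuous.mul (wt_contDiff hφ).continuous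
    obtain ⟨M, hM⟩ := ((hcs_del j (hcs_dbar k hΦc)).mul_right (f' := wt φ)).exists_bound_of_continuous hcj
    have := ((mol_T2 (hb j)).mul hcj hM).inn (mol_T2 (hb k))
    have e : ∀ (x y z : ℂ) (w : Cn n), (x * wt φ w * y * z).re = (x * y * z).re * Real.exp (-(φ w)) := by
      intro x y z w; rw [wt_eq, ← re_mul_ofReal]; congr 1; ring
    simp_rw [e] at this
    exact this
  have hT : T2 (fun (m : ℕ) z => mol (1/((m:ℝ)+1)) H z + ∑ j, - del j (cx φ) z * mol (1/((m:ℝ)+1)) (b j) z)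
      (fun z => H z + ∑ j, - del j (cx φ) z * b j z) := by
    refine (mol_T2 hH).add (T2.sum _ (fun j => ?_))
    obtain ⟨M, hM⟩ := hdb j
    exact (mol_T2 (hb j)).mul (cdel j hΦ).continuous.neg hM
  have hX := (hT.sq hwc hM).add (TI.sum Finset.univ (fun j : Fin n => TI.sum Finset.univ (fun k : Fin n =>
    (mol_T2 (hR j k)).sq (c := fun z => (1/2:ℝ) * Real.exp (-(φ z))) (M := 1/2 * Real.exp M0) (continuous_const.mul hwc)
      (fun z => by rw [norm_mul]; gcongr; norm_num; exact hM z))))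
  have e5 : ∀ x y : ℝ, x * ((1/2:ℝ) * y) = (1/2:ℝ) * x * y := fun x y => by ring
  simp_rw [e5] at hX
  refine ⟨hL.2.1, hX.2.1, le_of_tendsto_of_tendsto' hL.2.2 hX.2.2 (fun m => ?_)⟩
  have := bochner hφ (b := fun j => mol (1/((m:ℝ)+1)) (b j)) (fun j => (mol_smooth (hli j) (e0 m)).of_le (by exact WithTop.coe_le_coe.2 le_top))
    (fun j => mol_hcs (hc j) (e0 m))
  refine this.trans (le_of_eq ?_)
  congr 1; ext z
  simp_rw [eR _ _ _ z (e0 m), Finset.sum_sub_distrib, eH _ z (e0 m), neg_mul, Finset.sum_neg_distrib, sub_eq_add_neg]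

end Loc
end

section
namespace Loc
open Filter Topology ContDiff ComplexConjugate Complex

lemma dbar_congr {f g : Cn n → ℂ} {z : Cn n} (h : f =ᶠ[𝓝 z] g) (j : Fin n) : dbar j f z = dbar j g z := by
  simp only [dbar, h.fderiv_eq]

lemma del_congr {f g : Cn n → ℂ} {z : Cn n} (h : f =ᶠ[𝓝 z] g) (j : Fin n) : del j f z = del j g z := by
  simp only [del, h.fderiv_eq]

lemma bochner_cut {φ : Cn n → ℝ} (hφ : ContDiff ℝ 2 φ) {K : Set (Cn n)} (hK : IsCompact K) {b : Fin n → Cn n → ℂ}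
    (hb : ∀ j, MemLp (b j) 2) {R : Fin n → Fin n → Cn n → ℂ} {H : Cn n → ℂ}
    (hR : ∀ j k, MemLp (R j k) 2) (hH : MemLp H 2)
    (bz : ∀ z ∉ K, ∀ j, b j z = 0) (Rz : ∀ z ∉ K, ∀ j k, R j k z = 0) (Hz : ∀ z ∉ K, H z = 0)
    (wR : ∀ j k w, ContDiff ℝ ∞ w → HasCompactSupport w →
      ∫ z, (b j z * dbar k w z - b k z * dbar j w z) = - ∫ z, R j k z * w z)
    (wH : ∀ w, ContDiff ℝ ∞ w → HasCompactSupport w →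
      ∫ z, ∑ j, b j z * del j w z = - ∫ z, H z * w z) :
    Integrable (fun z => ∑ j, ∑ k, (del j (dbar k (cx φ)) z * b j z * conj (b k z)).re * Real.exp (-(φ z))) ∧
    Integrable (fun z => ‖H z + ∑ j, - del j (cx φ) z * b j z‖ ^ 2 * Real.exp (-(φ z)) +
      ∑ j, ∑ k, (1/2:ℝ) * ‖R j k z‖ ^ 2 * Real.exp (-(φ z))) ∧
    ∫ z, ∑ j, ∑ k, (del j (dbar k (cx φ)) z * b j z * conj (b k z)).re * Real.exp (-(φ z)) ≤
    ∫ z, (‖H z + ∑ j, - del j (cx φ) z * b j z‖ ^ 2 * Real.exp (-(φ z)) +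
      ∑ j, ∑ k, (1/2:ℝ) * ‖R j k z‖ ^ 2 * Real.exp (-(φ z))) := by
  obtain ⟨Θ, h1, h2, -, -, h5⟩ := exists_cutoff hK isOpen_univ (subset_univ _)
  have h12 : ContDiff ℝ 2 Θ := h1.of_le (WithTop.coe_le_coe.2 le_top)
  let ψ : Cn n → ℝ := fun z => Θ z * φ z
  have eψ : ∀ z ∈ K, ψ =ᶠ[𝓝 z] φ := fun z hz => by
    filter_upwards [nhds_le_nhdsSet hz h5] with x hx
    simp [ψ, hx]
  have ecx : ∀ z ∈ K, cx ψ =ᶠ[𝓝 z] cx φ := fun z hz => (eψ z hz).mono (fun x hx => by simp [cx, hx])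
  have key := bochner_weak (φ := ψ) (h12.mul hφ) h2.mul_right hb
    (fun j => HasCompactSupport.intro hK (fun z hz => bz z hz j)) hR hH wR wH
  have e1 : ∀ z, ∑ j, ∑ k, (del j (dbar k (cx ψ)) z * b j z * conj (b k z)).re * Real.exp (-(ψ z)) =
      ∑ j, ∑ k, (del j (dbar k (cx φ)) z * b j z * conj (b k z)).re * Real.exp (-(φ z)) := by
    intro z
    by_cases hz : z ∈ K
    · rw [(eψ z hz).eq_of_nhds]
      have : ∀ j k, del j (dbar k (cx ψ)) z = del j (dbar k (cx φ)) z := fun j k =>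
        del_congr ((ecx z hz).eventuallyEq_nhds.mono (fun x hx => dbar_congr hx k)) j
      simp_rw [this]
    · simp [bz z hz]
  have e2 : ∀ z, ‖H z + ∑ j, - del j (cx ψ) z * b j z‖ ^ 2 * Real.exp (-(ψ z)) +
      ∑ j, ∑ k, (1/2:ℝ) * ‖R j k z‖ ^ 2 * Real.exp (-(ψ z)) = ‖H z + ∑ j, - del j (cx φ) z * b j z‖ ^ 2 * Real.exp (-(φ z)) +
      ∑ j, ∑ k, (1/2:ℝ) * ‖R j k z‖ ^ 2 * Real.exp (-(φ z)) := by
    intro z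
    by_cases hz : z ∈ K
    · rw [(eψ z hz).eq_of_nhds]
      have : ∀ j, del j (cx ψ) z = del j (cx φ) z := fun j => del_congr (ecx z hz) j
      simp_rw [this]
    · simp [bz z hz, Rz z hz, Hz z hz]
  simp_rw [e1, e2] at key
  exact key

/-- the Hilbert space of (n)-tuples -/
abbrev E2 (n : ℕ) := PiLp 2 (fun _ : Fin n => Lp ℂ 2 (volume : Measure (Cn n)))

/-- vector in E2 from functions -/
def mkE (f : Fin n → Cn n → ℂ) (hf : ∀ j, MemLp (f j) 2) : E2 n := WithLp.toLp 2 (fun j => (hf j).toLp)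

lemma ii2 {f g : Cn n → ℂ} (hf : MemLp f 2) (hg : MemLp g 2) : Integrable (fun z => conj (f z) * g z) :=
  hf.star.integrable_mul (q := 2) hg

lemma inner_mkE (f : Fin n → Cn n → ℂ) (hf : ∀ j, MemLp (f j) 2) (A : E2 n) :
    inner ℂ (mkE f hf) A = ∫ z, ∑ j, conj (f j z) * A j z := by
  rw [PiLp.inner_apply, integral_finsetSum _ (fun j _ => ii2 (hf j) (Lp.memLp (A j)))]
  refine Finset.sum_congr rfl (fun j _ => ?_)
  rw [L2.inner_def]
  apply integral_congr_ae
  filter_upwards [(hf j).coeFn_toLp] with z h1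
  simp only [mkE, RCLike.inner_apply]
  rw [h1, mul_comm]

lemma norm_sq_E (A : E2 n) : ‖A‖ ^ 2 = ∫ z, ∑ j, ‖A j z‖ ^ 2 := by
  rw [PiLp.norm_sq_eq_of_L2, integral_finsetSum _ (fun j _ => (Lp.memLp (A j)).integrable_norm_pow (by norm_num))]
  refine Finset.sum_congr rfl (fun j _ => ?_)
  have h := L2.inner_def (𝕜 := ℂ) (A j) (A j)
  rw [inner_self_eq_norm_sq_to_K] at h
  have : ∀ z, inner ℂ ((A j) z) ((A j) z) = ((‖A j z‖ ^ 2 : ℝ) : ℂ) := by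
    intro z; rw [inner_self_eq_norm_sq_to_K]; norm_cast
  simp_rw [this] at h
  rw [integral_complex_ofReal] at h
  have h' : ((‖A j‖ ^ 2 : ℝ) : ℂ) = ((∫ z, ‖A j z‖ ^ 2 : ℝ) : ℂ) := by rw [← h]; norm_cast
  exact ofReal_injective h'

lemma mkE_coe (f : Fin n → Cn n → ℂ) (hf : ∀ j, MemLp (f j) 2) (j : Fin n) : (mkE f hf) j =ᵐ[volume] f j :=
  (hf j).coeFn_toLp

lemma hilb {E : Type*} [NormedAddCommGroup E] [InnerProductSpace ℂ E] [CompleteSpace E] (S : Set E) (α : E) :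
    ∃ A : E, (∀ s ∈ S, inner ℂ s A = 0) ∧ (∀ G, (∀ s ∈ S, inner ℂ s G = 0) → inner ℂ G A = inner ℂ G α) ∧ ‖A‖ ≤ ‖α‖ := by
  let T := (Submodule.span ℂ S)ᗮ
  have hT : ∀ G, (∀ s ∈ S, inner ℂ s G = 0) → G ∈ T := by
    intro G hG
    rw [Submodule.mem_orthogonal]
    intro u hu
    induction hu using Submodule.span_induction with
    | mem x h => exact hG x h
    | zero => simp
    | add x y _ _ hx hy => rw [inner_add_left, hx, hy, add_zero]
    | smul a x _ hx => rw [inner_smul_left, hx, mul_zero]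
  refine ⟨T.starProjection α, fun s hs => ?_, fun G hG => ?_, T.norm_starProjection_apply_le α⟩
  · exact (Submodule.mem_orthogonal _ _).1 (T.starProjection_apply_mem α) s (Submodule.subset_span hs)
  · have := (Submodule.mem_orthogonal _ _).1 (T.sub_starProjection_mem_orthogonal α) G (hT G hG)
    rw [inner_sub_right, sub_eq_zero] at this
    exact this.symm

/-- smooth test functions -/
def Tst (Ω : Set (Cn n)) (w : Cn n → ℂ) : Prop := ContDiff ℝ ∞ w ∧ HasCompactSupport w ∧ tsupport w ⊆ Ω

/-- the weighted minimal form -/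
def Good (Ω : Set (Cn n)) (φ : Cn n → ℝ) (a B : Fin n → Cn n → ℂ) : Prop :=
  (∀ j, MemLp (B j) 2) ∧
  (∀ j k w, Tst Ω w → ∫ z, ((Real.exp (φ z / 2) : ℂ) * B j z * dbar k w z - (Real.exp (φ z / 2) : ℂ) * B k z * dbar j w z) = 0) ∧
  (∀ g : Fin n → Cn n → ℂ, (∀ j, MemLp (g j) 2) →
    (∀ j k w, Tst Ω w → ∫ z, (g j z * dbar k w z - g k z * dbar j w z) = 0) →
    ∫ z, ∑ j, conj (g j z) * ((Real.exp (-(φ z / 2)) : ℂ) * B j z) = ∫ z, ∑ j, conj (a j z * g j z)) ∧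
  ∫ z, ∑ j, ‖B j z‖ ^ 2 ≤ ∫ z, ∑ j, ‖a j z‖ ^ 2 * Real.exp (φ z)

lemma exists_good {Ω : Set (Cn n)} {φ : Cn n → ℝ} (hφ : Continuous φ) (h0 : ∀ z, 0 ≤ φ z) {a : Fin n → Cn n → ℂ}
    (ha : ∀ j, Continuous (a j)) (hac : ∀ j, HasCompactSupport (a j)) : ∃ B, Good Ω φ a B := by
  have ec : Continuous (fun z => (Real.exp (φ z / 2) : ℂ)) := continuous_ofReal.comp (Real.continuous_exp.comp (hφ.div_const 2))
  have eic : Continuous (fun z => (Real.exp (-(φ z / 2)) : ℂ)) :=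
    continuous_ofReal.comp (Real.continuous_exp.comp (hφ.div_const 2).neg)
  have eib : ∀ z, ‖(Real.exp (-(φ z / 2)) : ℂ)‖ ≤ 1 := fun z => by
    rw [norm_real, Real.norm_of_nonneg (Real.exp_pos _).le]
    exact Real.exp_le_one_iff.2 (by linarith [h0 z])
  have ee1 : ∀ z, (Real.exp (φ z / 2) : ℂ) * (Real.exp (-(φ z / 2)) : ℂ) = 1 := fun z => by
    rw [← ofReal_mul, ← Real.exp_add]; simp
  have mc : ∀ {f : Cn n → ℂ}, Continuous f → HasCompactSupport f → MemLp f 2 := fun h1 h2 => h1.memLp_of_hasCompactSupport h2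
  let sf : Fin n → Fin n → (Cn n → ℂ) → Fin n → Cn n → ℂ := fun j k w l z =>
    (Real.exp (φ z / 2) : ℂ) * ((if l = j then conj (dbar k w z) else 0) - (if l = k then conj (dbar j w z) else 0))
  have dc : ∀ {w} k, Tst Ω w → Continuous (dbar k w) := fun k hw => (contDiff_dbar (m := ⊤) (k := 0) k hw.1 (by simp)).continuous
  have hsf : ∀ j k w l, Tst Ω w → MemLp (sf j k w l) 2 := by
    intro j k w l hw
    have := fun k => continuous_conj.comp (dc k hw)
    refine mc ?_ (HasCompactSupport.intro hw.2.1.isCompact (fun z hz => ?_))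
    · refine ec.mul (Continuous.sub ?_ ?_) <;> split_ifs <;> first | exact continuous_const | exact this _
    · simp [sf, dbar_eq_zero_of _ hz]
  let S : Set (E2 n) := {x | ∃ j k w, ∃ hw : Tst Ω w, x = mkE (sf j k w) (fun l => hsf j k w l hw)}
  have hα : ∀ j, MemLp (fun z => (Real.exp (φ z / 2) : ℂ) * conj (a j z)) 2 := fun j =>
    mc (ec.mul (continuous_conj.comp (ha j))) (HasCompactSupport.mul_left ((hac j).comp_left (g := fun x : ℂ => conj x) (by simp)))
  obtain ⟨A, h1, h2, h3⟩ := hilb S (mkE _ hα)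
  have innS : ∀ j k w (hw : Tst Ω w) (G : E2 n), inner ℂ (mkE (sf j k w) (fun l => hsf j k w l hw)) G =
      ∫ z, ((Real.exp (φ z / 2) : ℂ) * G j z * dbar k w z - (Real.exp (φ z / 2) : ℂ) * G k z * dbar j w z) := by
    intro j k w hw G
    rw [inner_mkE]
    congr 1; ext z
    have : ∀ l, conj (sf j k w l z) * G l z = (if l = j then (Real.exp (φ z / 2) : ℂ) * G l z * dbar k w z else 0) -
        (if l = k then (Real.exp (φ z / 2) : ℂ) * G l z * dbar j w z else 0) := by
      intro l
      simp only [sf]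
      split_ifs <;> simp only [map_mul, map_sub, conj_ofReal, conj_conj, map_zero] <;> ring
    simp_rw [this, Finset.sum_sub_distrib, Finset.sum_ite_eq', Finset.mem_univ, if_true]
  refine ⟨fun j => A j, fun j => Lp.memLp (A j), fun j k w hw => ?_, fun g hg hgw => ?_, ?_⟩
  · rw [← innS j k w hw]; exact h1 _ ⟨j, k, w, hw, rfl⟩
  · have hG : ∀ j, MemLp (fun z => (Real.exp (-(φ z / 2)) : ℂ) * g j z) 2 := fun j => memLp_bdd_mul eic eib (hg j)
    have hGc := mkE_coe _ hG
    have := h2 (mkE _ hG) (by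
      rintro s ⟨j, k, w, hw, rfl⟩
      rw [innS j k w hw, ← hgw j k w hw]
      apply integral_congr_ae
      filter_upwards [hGc j, hGc k] with z e1 e2
      rw [e1, e2]
      linear_combination (g j z * dbar k w z - g k z * dbar j w z) * ee1 z)
    rw [inner_mkE, inner_mkE] at this
    have e3 : ∀ z, ∑ j, conj (g j z) * ((Real.exp (-(φ z / 2)) : ℂ) * A j z) = ∑ j, conj ((Real.exp (-(φ z / 2)) : ℂ) * g j z) * A j z := by
      intro z; refine Finset.sum_congr rfl (fun j _ => ?_); rw [map_mul, conj_ofReal]; ring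
    simp_rw [e3]
    rw [this]
    apply integral_congr_ae
    filter_upwards [ae_all_iff.2 (mkE_coe _ hα)] with z hz
    refine Finset.sum_congr rfl (fun j _ => ?_)
    rw [hz j]; simp only [map_mul, conj_ofReal]
    linear_combination (conj (g j z) * conj (a j z)) * ee1 z
  · have h4 : ‖A‖ ^ 2 ≤ ‖mkE _ hα‖ ^ 2 := by gcongr
    rw [norm_sq_E, norm_sq_E] at h4
    refine h4.trans (le_of_eq ?_)
    apply integral_congr_ae
    filter_upwards [ae_all_iff.2 (mkE_coe _ hα)] with z hz
    refine Finset.sum_congr rfl (fun j _ => ?_)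
    rw [hz j, norm_mul, norm_real, Real.norm_of_nonneg (Real.exp_pos _).le, mul_pow, ← Real.exp_nat_mul, RCLike.norm_conj, mul_comm]
    congr 2; push_cast; ring

end Loc
end

section
namespace Loc
open Filter Topology ContDiff ComplexConjugate Complex

lemma cs_sum (x y : Fin n → ℂ) : ‖∑ j, x j * y j‖ ^ 2 ≤ (∑ j, ‖x j‖ ^ 2) * ∑ j, ‖y j‖ ^ 2 := by
  refine le_trans ?_ (Finset.sum_mul_sq_le_sq_mul_sq Finset.univ (fun j => ‖x j‖) (fun j => ‖y j‖))
  gcongr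
  exact (norm_sum_le _ _).trans (le_of_eq (by simp_rw [norm_mul]))

lemma wedge_le (x y : Fin n → ℂ) :
    ∑ j, ∑ k, (1/2:ℝ) * ‖x j * y k - x k * y j‖ ^ 2 ≤ 2 * ((∑ j, ‖x j‖ ^ 2) * ∑ j, ‖y j‖ ^ 2) := by
  have h : ∀ j k, (1/2:ℝ) * ‖x j * y k - x k * y j‖ ^ 2 ≤ ‖x j‖ ^ 2 * ‖y k‖ ^ 2 + ‖x k‖ ^ 2 * ‖y j‖ ^ 2 := by
    intro j k
    have := norm_sub_le (x j * y k) (x k * y j)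
    rw [norm_mul, norm_mul] at this
    have h2 := pow_le_pow_left₀ (norm_nonneg _) this 2
    nlinarith [sq_nonneg (‖x j‖ * ‖y k‖ - ‖x k‖ * ‖y j‖)]
  calc _ ≤ ∑ j, ∑ k, (‖x j‖ ^ 2 * ‖y k‖ ^ 2 + ‖x k‖ ^ 2 * ‖y j‖ ^ 2) :=
        Finset.sum_le_sum (fun j _ => Finset.sum_le_sum (fun k _ => h j k))
    _ = _ := by
        simp_rw [Finset.sum_add_distrib]
        rw [Finset.sum_comm (f := fun j k => ‖x k‖ ^ 2 * ‖y j‖ ^ 2), ← Finset.sum_mul_sum]; ring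

lemma memLp_cs_mul {c f : Cn n → ℂ} (hc : Continuous c) (hs : HasCompactSupport c) (hf : MemLp f 2) :
    MemLp (fun z => c z * f z) 2 := by
  obtain ⟨M, hM⟩ := hs.exists_bound_of_continuous hc
  exact memLp_bdd_mul hc hM hf

set_option maxHeartbeats 1000000 in
lemma star {Ω : Set (Cn n)} {φ : Cn n → ℝ} (hφ : ContDiff ℝ 2 φ) {a B : Fin n → Cn n → ℂ}
    (ha : ∀ j, ContDiff ℝ 1 (a j)) (hG : Good Ω φ a B) {η : Cn n → ℝ} (hη : ContDiff ℝ ∞ η)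
    (hηc : HasCompactSupport η) (hηΩ : tsupport η ⊆ Ω) {lam : Cn n → ℝ} (hlm : Measurable lam) (hl0 : ∀ z, 0 ≤ lam z)
    {Λ : ℝ} (hlΛ : ∀ z, lam z ≤ Λ)
    (hlev : ∀ z ∈ tsupport η, ∀ X : Fin n → ℂ, lam z * ∑ j, ‖X j‖ ^ 2 ≤
      ∑ j, ∑ k, (del j (dbar k (cx φ)) z * X j * conj (X k)).re) :
    ∫ z, η z ^ 2 * lam z * ∑ j, ‖B j z‖ ^ 2 ≤ ∫ z, (2 * η z ^ 2 * ‖∑ j, dbar j (a j) z‖ ^ 2 * Real.exp (φ z) +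
      4 * (∑ j, ‖del j (cx η) z‖ ^ 2) * ∑ j, ‖B j z‖ ^ 2) := by
  obtain ⟨hB, hi, hiii, -⟩ := hG
  have h2 : (2:WithTop ℕ∞) ≤ ((⊤:ℕ∞) : WithTop ℕ∞) := WithTop.coe_le_coe.2 le_top
  have h12 : (1:WithTop ℕ∞) ≤ 2 := by norm_num
  have hN : ContDiff ℝ ∞ (cx η) := cx_contDiff hη
  have hN2 : ContDiff ℝ 2 (cx η) := hN.of_le h2
  have hNc : HasCompactSupport (cx η) := hηc.comp_left (g := fun x : ℝ => (x : ℂ)) (by simp)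
  have hNt : tsupport (cx η) = tsupport η := by
    unfold tsupport; congr 1; ext z; simp [cx]
  have hΦ := cx_contDiff hφ
  have cdel : ∀ {f : Cn n → ℂ} (l : Fin n), ContDiff ℝ 2 f → ContDiff ℝ 1 (del l f) :=
    fun l hf => contDiff_del (m := 2) (k := 1) l hf (by norm_num)
  have cdbar : ∀ {f : Cn n → ℂ} (l : Fin n), ContDiff ℝ 2 f → ContDiff ℝ 1 (dbar l f) :=
    fun l hf => contDiff_dbar (m := 2) (k := 1) l hf (by norm_num)
  have d2 : ∀ {f : Cn n → ℂ}, ContDiff ℝ 2 f → ∀ z, DifferentiableAt ℝ f z := fun hf z => hf.differentiable (by simp) z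
  have cconj : ∀ {m : WithTop ℕ∞} {f : Cn n → ℂ}, ContDiff ℝ m f → ContDiff ℝ m (fun z => conj (f z)) :=
    fun hf => conjCLE.toContinuousLinearMap.contDiff.comp hf
  let q : Cn n → ℂ := fun z => ∑ j, dbar j (a j) z
  have hqc : Continuous q := continuous_finsetSum _ (fun j _ => (contDiff_dbar (m := 1) (k := 0) j (ha j) (by norm_num)).continuous)
  let e : Cn n → ℂ := fun z => (Real.exp (φ z / 2) : ℂ)
  let ei : Cn n → ℂ := fun z => (Real.exp (-(φ z / 2)) : ℂ)
  have hec : Continuous e := continuous_ofReal.comp (Real.continuous_exp.comp (hφ.continuous.div_const 2))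
  have heic : Continuous ei := continuous_ofReal.comp (Real.continuous_exp.comp (hφ.continuous.div_const 2).neg)
  let F : Cn n → ℂ := wt (fun z => - φ z)
  have hF : ContDiff ℝ 2 F := wt_contDiff hφ.neg
  have hFe : ∀ z, F z = e z * e z := fun z => by
    simp only [F, e, wt_eq, ← ofReal_mul, ← Real.exp_add]; congr 2; ring
  have hee : ∀ z, ei z * e z = 1 := fun z => by simp only [ei, e, ← ofReal_mul, ← Real.exp_add]; simp
  have hdF : ∀ j z, del j F z = del j (cx φ) z * F z := by
    intro j z
    have e1 : cx (fun z => - φ z) = fun z => - cx φ z := by ext z; simp [cx]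
    rw [del_wt (by rw [e1]; exact (d2 hΦ z).neg), e1]
    simp only [del, fderiv_fun_neg, F]; simp only [_root_.neg_apply]; ring
  let b : Fin n → Cn n → ℂ := fun j z => cx η z * e z * B j z
  let R : Fin n → Fin n → Cn n → ℂ := fun j k z => dbar k (cx η) z * e z * B j z - dbar j (cx η) z * e z * B k z
  let H : Cn n → ℂ := fun z => (∑ j, del j (cx η) z * e z * B j z) + (∑ j, cx η z * (del j (cx φ) z * e z) * B j z) +
    cx η z * F z * conj (q z)
  have hbL : ∀ j, MemLp (b j) 2 := fun j => memLp_cs_mul (hN.continuous.mul hec) hNc.mul_right (hB j)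
  have cN : ∀ j, Continuous (dbar j (cx η)) := fun j => (cdbar j hN2).continuous
  have cN' : ∀ j, Continuous (del j (cx η)) := fun j => (cdel j hN2).continuous
  have hRL : ∀ j k, MemLp (R j k) 2 := fun j k =>
    (memLp_cs_mul ((cN k).mul hec) (hcs_dbar k hNc).mul_right (hB j)).sub (memLp_cs_mul ((cN j).mul hec) (hcs_dbar j hNc).mul_right (hB k))
  have hH1 : ∀ j, MemLp (fun z => del j (cx η) z * e z * B j z) 2 := fun j =>
    memLp_cs_mul ((cN' j).mul hec) (hcs_del j hNc).mul_right (hB j)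
  have hH2 : ∀ j, MemLp (fun z => cx η z * (del j (cx φ) z * e z) * B j z) 2 := fun j =>
    memLp_cs_mul (hN.continuous.mul ((cdel j hΦ).continuous.mul hec)) hNc.mul_right (hB j)
  have hH3c : Continuous (fun z => cx η z * F z * conj (q z)) := (hN.continuous.mul hF.continuous).mul (continuous_conj.comp hqc)
  have hHL : MemLp H 2 := ((memLp_finsetSum _ (fun j _ => hH1 j)).add (memLp_finsetSum _ (fun j _ => hH2 j))).add
    (hH3c.memLp_of_hasCompactSupport hNc.mul_right.mul_right)
  have z0 : ∀ z ∉ tsupport η, cx η z = 0 := fun z hz => image_eq_zero_of_notMem_tsupport (hNt ▸ hz)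
  have z1 : ∀ z ∉ tsupport η, ∀ j, dbar j (cx η) z = 0 := fun z hz j => dbar_eq_zero_of j (hNt ▸ hz)
  have z2 : ∀ z ∉ tsupport η, ∀ j, del j (cx η) z = 0 := fun z hz j => del_eq_zero_of j (hNt ▸ hz)
  have li : ∀ {f : Cn n → ℂ}, MemLp f 2 → LocallyIntegrable f := fun h => h.locallyIntegrable (by norm_num)
  have key := bochner_cut hφ hηc.isCompact hbL hRL hHL (fun z hz j => by simp [b, z0 z hz]) (fun z hz j k => by simp [R, z1 z hz])
    (fun z hz => by simp [H, z0 z hz, z2 z hz]) (by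
      intro j k w hw hwc
      have hT : Tst Ω (fun z => cx η z * w z) := ⟨hN.mul hw, hNc.mul_right,
        (closure_mono (Function.support_mul_subset_left _ _)).trans (hNt.le.trans hηΩ)⟩
      have := hi j k _ hT
      have hw2 : ContDiff ℝ 2 w := hw.of_le h2
      simp_rw [fun l z => dbar_mul l (d2 hN2 z) (d2 hw2 z)] at this
      rw [← integral_neg, ← sub_eq_zero, ← integral_sub, ← this]
      · congr 1; ext z; simp only [b, R, e]; ring
      · exact (li_mul (li (hbL j)) (cdbar k hw2).continuous (hcs_dbar k hwc)).sub
          (li_mul (li (hbL k)) (cdbar j hw2).continuous (hcs_dbar j hwc))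
      · exact (li_mul (li (hRL j k)) hw.continuous hwc).neg) (by
      intro w hw hwc
      have hw2 : ContDiff ℝ 2 w := hw.of_le h2
      let u : Cn n → ℂ := fun z => cx η z * (w z * F z)
      have hu : ContDiff ℝ 2 u := hN2.mul (hw2.mul hF)
      have huc : HasCompactSupport u := hNc.mul_right
      have hdu : ∀ j z, del j u z = (del j (cx η) z * w z + cx η z * (del j (cx φ) z) * w z + cx η z * del j w z) * F z := by
        intro j z
        show del j (fun z => cx η z * (w z * F z)) z = _
        rw [del_mul j (d2 hN2 z) ((d2 hw2 z).fun_mul (d2 hF z)), del_mul j (d2 hw2 z) (d2 hF z), hdF]; ring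
      let v : Cn n → ℂ := fun z => conj (u z)
      have hv : ContDiff ℝ 2 v := cconj hu
      have hdv : ∀ j z, dbar j v z = conj (del j u z) := fun j z => dbar_conj j (d2 hu z)
      have hvc : HasCompactSupport v := huc.comp_left (g := fun x : ℂ => conj x) (by simp)
      have h3 := hiii (fun j => dbar j v) (fun j => (cdbar j hv).continuous.memLp_of_hasCompactSupport (hcs_dbar j hvc)) (by
        intro j k w' hw'
        have hw'1 : ContDiff ℝ 1 w' := hw'.1.of_le (WithTop.coe_le_coe.2 le_top)
        have hw'2 : ContDiff ℝ 2 w' := hw'.1.of_le h2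
        rw [integral_sub, ibp_dbar (cdbar j hv) hw'1 hw'.2.1, ibp_dbar (cdbar k hv) hw'1 hw'.2.1]
        · simp_rw [dbar_comm hv k j]; ring
        · exact ((cdbar j hv).continuous.mul (cdbar k hw'2).continuous).integrable_of_hasCompactSupport (hcs_dbar k hw'.2.1).mul_left
        · exact ((cdbar k hv).continuous.mul (cdbar j hw'2).continuous).integrable_of_hasCompactSupport (hcs_dbar j hw'.2.1).mul_left)
      simp_rw [hdv, map_mul, conj_conj] at h3
      have h4 : ∫ z, ∑ j, conj (a j z) * del j u z = - ∫ z, conj (q z) * u z := by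
        have i1 : ∀ j, Integrable (fun z => conj (a j z) * del j u z) := fun j =>
          ((cconj (ha j)).continuous.mul (cdel j hu).continuous).integrable_of_hasCompactSupport (hcs_del j huc).mul_left
        have i2 : ∀ j, Integrable (fun z => conj (dbar j (a j) z) * u z) := fun j =>
          ((continuous_conj.comp (contDiff_dbar (m := 1) (k := 0) j (ha j) (by norm_num)).continuous).mul
            hu.continuous).integrable_of_hasCompactSupport huc.mul_left
        rw [integral_finsetSum _ (fun j _ => i1 j)]
        simp_rw [q, map_sum, Finset.sum_mul]
        rw [integral_finsetSum _ (fun j _ => i2 j), ← Finset.sum_neg_distrib]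
        refine Finset.sum_congr rfl (fun j _ => ?_)
        rw [ibp_del (cconj (ha j)) (hu.of_le h12) huc]
        congr 2; ext z; rw [del_conj j ((ha j).differentiable (by simp) z)]
      rw [h4] at h3
      have i5 : Integrable (fun z => ∑ j, b j z * del j w z) := integrable_finsetSum _ (fun j _ =>
        li_mul (li (hbL j)) (cdel j hw2).continuous (hcs_del j hwc))
      have i6 : Integrable (fun z => H z * w z) := li_mul (li hHL) hw.continuous hwc
      have i7 : Integrable (fun z => conj (q z) * u z) :=
        ((continuous_conj.comp hqc).mul hu.continuous).integrable_of_hasCompactSupport huc.mul_left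
      have i8 : Integrable (fun z => ∑ j, del j u z * (ei z * B j z)) := integrable_finsetSum _ (fun j _ => by
        have := (li_mul (li (hB j)) ((cdel j hu).continuous.mul heic) (hcs_del j huc).mul_right)
        refine this.congr (ae_of_all _ (fun z => ?_)); simp; ring)
      have h9 : ∀ z, (∑ j, b j z * del j w z) + H z * w z = (∑ j, del j u z * (ei z * B j z)) + conj (q z) * u z := by
        intro z
        have : ∀ j, del j u z * (ei z * B j z) = b j z * del j w z + (del j (cx η) z * e z * B j z) * w z +
            (cx η z * (del j (cx φ) z * e z) * B j z) * w z := by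
          intro j
          rw [hdu, hFe]; simp only [b]
          linear_combination ((del j (cx η) z * w z + cx η z * (del j (cx φ) z) * w z + cx η z * del j w z) * e z * B j z) * hee z
        simp_rw [this, Finset.sum_add_distrib, ← Finset.sum_mul]
        simp only [H, u]; ring
      have h10 := integral_congr_ae (ae_of_all volume h9)
      rw [integral_add i5 i6, integral_add i8 i7] at h10
      linear_combination h10 + h3)
  obtain ⟨k1, k2, k3⟩ := key
  have iB : ∀ j, Integrable (fun z => ‖B j z‖ ^ 2) := fun j => (hB j).integrable_norm_pow (by norm_num)
  have iBB : Integrable (fun z => ∑ j, ‖B j z‖ ^ 2) := integrable_finsetSum _ (fun j _ => iB j)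
  have heR : ∀ z, ‖e z‖ ^ 2 * Real.exp (-(φ z)) = 1 := fun z => by
    simp only [e, norm_real, Real.norm_of_nonneg (Real.exp_pos _).le]
    rw [← Real.exp_nat_mul, ← Real.exp_add]; simp; ring
  have hFR : ∀ z, ‖F z‖ ^ 2 * Real.exp (-(φ z)) = Real.exp (φ z) := fun z => by
    simp only [F, wt_eq, norm_real, Real.norm_of_nonneg (Real.exp_pos _).le]
    rw [← Real.exp_nat_mul, ← Real.exp_add]; congr 1; push_cast; ring
  have bdd_mul : ∀ {c : Cn n → ℝ} {M : ℝ}, Measurable c → (∀ z, ‖c z‖ ≤ M) → Integrable (fun z => c z * ∑ j, ‖B j z‖ ^ 2) := by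
    intro c M h1 h2
    exact iBB.bdd_mul h1.aestronglyMeasurable (ae_of_all _ h2)
  obtain ⟨Mη, hMη⟩ := hηc.exists_bound_of_continuous hη.continuous
  have iL : Integrable (fun z => η z ^ 2 * lam z * ∑ j, ‖B j z‖ ^ 2) := by
    refine bdd_mul (M := Mη ^ 2 * Λ) ((hη.continuous.measurable.pow_const 2).mul hlm) (fun z => ?_)
    rw [norm_mul, norm_pow, Real.norm_of_nonneg (hl0 z)]
    gcongr
    · exact hl0 z
    · exact hMη z
    · exact hlΛ z
  have cG : Continuous (fun z => ∑ j, ‖del j (cx η) z‖ ^ 2) := continuous_finsetSum _ (fun j _ => (cN' j).norm.pow 2)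
  obtain ⟨MG, hMG⟩ := (HasCompactSupport.intro hηc.isCompact (f := fun z => ∑ j, ‖del j (cx η) z‖ ^ 2)
    (fun z hz => by simp [z2 z hz])).exists_bound_of_continuous cG
  have iR : Integrable (fun z => 2 * η z ^ 2 * ‖q z‖ ^ 2 * Real.exp (φ z) +
      4 * (∑ j, ‖del j (cx η) z‖ ^ 2) * ∑ j, ‖B j z‖ ^ 2) := by
    refine Integrable.add ?_ (bdd_mul (M := 4 * MG) (continuous_const.mul cG).measurable (fun z => ?_))
    · refine Continuous.integrable_of_hasCompactSupport ?_ (HasCompactSupport.intro hηc.isCompact (fun z hz => ?_))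
      · exact ((continuous_const.mul (hη.continuous.pow 2)).mul (hqc.norm.pow 2)).mul (Real.continuous_exp.comp hφ.continuous)
      · simp [image_eq_zero_of_notMem_tsupport hz]
    · rw [norm_mul]; gcongr; norm_num; exact hMG z
  refine (integral_mono iL k1 (fun z => ?_)).trans (k3.trans (integral_mono k2 iR (fun z => ?_)))
  · by_cases hz : z ∈ tsupport η
    · have := mul_le_mul_of_nonneg_right (hlev z hz (fun j => b j z)) (Real.exp_pos (-(φ z))).le
      simp only
      simp_rw [← Finset.sum_mul]
      refine le_trans (le_of_eq ?_) this
      have : ∀ j, ‖b j z‖ ^ 2 = η z ^ 2 * ‖e z‖ ^ 2 * ‖B j z‖ ^ 2 := by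
        intro j; simp only [b, norm_mul, cx, norm_real, mul_pow, Real.norm_eq_abs, sq_abs]
      simp_rw [this, ← Finset.mul_sum]
      linear_combination -(η z ^ 2 * lam z * ∑ j, ‖B j z‖ ^ 2) * heR z
    · simp [image_eq_zero_of_notMem_tsupport hz, b, z0 z hz]
  · have hdb : ∀ j, ‖dbar j (cx η) z‖ = ‖del j (cx η) z‖ := fun j => by
      rw [← conj_del_cx (d2 hN2 z), RCLike.norm_conj]
    have e1 : H z + ∑ j, - del j (cx φ) z * b j z = e z * (∑ j, B j z * del j (cx η) z) + cx η z * F z * conj (q z) := by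
      have : ∑ j, - del j (cx φ) z * b j z = - ∑ j, cx η z * (del j (cx φ) z * e z) * B j z := by
        rw [← Finset.sum_neg_distrib]; refine Finset.sum_congr rfl (fun j _ => ?_); simp only [b]; ring
      rw [this, Finset.mul_sum]
      have : ∀ j, e z * (B j z * del j (cx η) z) = del j (cx η) z * e z * B j z := fun j => by ring
      simp_rw [this]; simp only [H]; ring
    have e2 : ‖H z + ∑ j, - del j (cx φ) z * b j z‖ ^ 2 * Real.exp (-(φ z)) ≤
        2 * ((∑ j, ‖B j z‖ ^ 2) * ∑ j, ‖del j (cx η) z‖ ^ 2) + 2 * η z ^ 2 * ‖q z‖ ^ 2 * Real.exp (φ z) := by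
      rw [e1]
      have h1 := norm_add_le (e z * (∑ j, B j z * del j (cx η) z)) (cx η z * F z * conj (q z))
      have h2 := pow_le_pow_left₀ (norm_nonneg _) h1 2
      have h3 := h2.trans (add_sq_le (a := ‖e z * (∑ j, B j z * del j (cx η) z)‖))
      have h4 := mul_le_mul_of_nonneg_right h3 (Real.exp_pos (-(φ z))).le
      refine h4.trans ?_
      simp only [norm_mul, RCLike.norm_conj, mul_pow]
      have h5 := cs_sum (fun j => B j z) (fun j => del j (cx η) z)
      have h6 : ‖cx η z‖ ^ 2 = η z ^ 2 := by simp [cx]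
      rw [h6]
      have h7 : 2 * (‖e z‖ ^ 2 * ‖∑ j, B j z * del j (cx η) z‖ ^ 2 + η z ^ 2 * ‖F z‖ ^ 2 * ‖q z‖ ^ 2) * Real.exp (-(φ z)) =
        2 * ‖∑ j, B j z * del j (cx η) z‖ ^ 2 + 2 * η z ^ 2 * ‖q z‖ ^ 2 * Real.exp (φ z) := by
        linear_combination (2 * ‖∑ j, B j z * del j (cx η) z‖ ^ 2) * heR z + (2 * η z ^ 2 * ‖q z‖ ^ 2) * hFR z
      rw [h7]; gcongr
    have e3 : ∑ j, ∑ k, (1/2:ℝ) * ‖R j k z‖ ^ 2 * Real.exp (-(φ z)) ≤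
        2 * ((∑ j, ‖B j z‖ ^ 2) * ∑ j, ‖del j (cx η) z‖ ^ 2) := by
      have h1 := wedge_le (fun j => B j z) (fun j => dbar j (cx η) z)
      simp_rw [hdb] at h1
      refine le_trans (le_of_eq ?_) h1
      refine Finset.sum_congr rfl (fun j _ => Finset.sum_congr rfl (fun k _ => ?_))
      have : R j k z = e z * (B j z * dbar k (cx η) z - B k z * dbar j (cx η) z) := by simp only [R]; ring
      rw [this, norm_mul, mul_pow]
      linear_combination ((1/2:ℝ) * ‖B j z * dbar k (cx η) z - B k z * dbar j (cx η) z‖ ^ 2) * heR z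
    refine (add_le_add e2 e3).trans (le_of_eq ?_)
    simp only [q]; ring

end Loc
end

section
namespace Loc
open Filter Topology ContDiff ComplexConjugate Complex

lemma sum_del (g : Cn n → ℂ) (z X : Cn n) :
    ∑ j, X j * del j g z = (fderiv ℝ g z X - I * fderiv ℝ g z (I • X)) / 2 := by
  rw [fderiv_expand, fderiv_expand, Finset.mul_sum, ← Finset.sum_sub_distrib, Finset.sum_div]
  refine Finset.sum_congr rfl fun j _ => ?_
  have : I * I = -1 := I_mul_I
  simp only [PiLp.smul_apply, smul_eq_mul, map_mul, conj_I]
  linear_combination (X j * del j g z - conj (X j) * dbar j g z) / 2 * this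

lemma sum_dbar (g : Cn n → ℂ) (z X : Cn n) :
    ∑ j, conj (X j) * dbar j g z = (fderiv ℝ g z X + I * fderiv ℝ g z (I • X)) / 2 := by
  rw [fderiv_expand, fderiv_expand, Finset.mul_sum, ← Finset.sum_add_distrib, Finset.sum_div]
  refine Finset.sum_congr rfl fun j _ => ?_
  have : I * I = -1 := I_mul_I
  simp only [PiLp.smul_apply, smul_eq_mul, map_mul, conj_I]
  linear_combination (- X j * del j g z + conj (X j) * dbar j g z) / 2 * this

lemma fderiv_cx {f : Cn n → ℝ} {z : Cn n} (hf : DifferentiableAt ℝ f z) (X : Cn n) :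
    fderiv ℝ (cx f) z X = (fderiv ℝ f z X : ℂ) := by
  have := (ofRealCLM.hasFDerivAt.comp z hf.hasFDerivAt).fderiv
  have e : cx f = ofRealCLM ∘ f := rfl
  rw [e, this]; rfl

lemma fderiv_apply_diff {f : Cn n → ℝ} (hf : ContDiff ℝ 2 f) (z X : Cn n) :
    DifferentiableAt ℝ (fun w => fderiv ℝ f w X) z :=
  ((hf.fderiv_right (m := 1) (by norm_num)).clm_apply contDiff_const).differentiable (by simp) z

lemma D2_cx {f : Cn n → ℝ} (hf : ContDiff ℝ 2 f) (z X Y : Cn n) :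
    D2 (cx f) z X Y = (fderiv ℝ (fun w => fderiv ℝ f w Y) z X : ℂ) := by
  unfold D2
  have : (fun w => fderiv ℝ (cx f) w Y) = cx (fun w => fderiv ℝ f w Y) := by
    ext w; exact fderiv_cx (hf.differentiable (by simp) w) Y
  rw [this, fderiv_cx (fderiv_apply_diff hf z Y)]

lemma lev_eq {f : Cn n → ℝ} (hf : ContDiff ℝ 2 f) (z X : Cn n) :
    ∑ j, ∑ k, (del j (dbar k (cx f)) z * X j * conj (X k)).re = leviForm f z X := by
  have hF := cx_contDiff hf
  have cdb : ∀ k, DifferentiableAt ℝ (dbar k (cx f)) z := fun k =>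
    (contDiff_dbar (m := 2) (k := 1) k hF (by norm_num)).differentiable (by simp) z
  have h1 : ∀ Y, fderiv ℝ (fun w => ∑ k, conj (X k) * dbar k (cx f) w) z Y
      = ∑ k, conj (X k) * fderiv ℝ (dbar k (cx f)) z Y := by
    intro Y
    rw [fderiv_fun_sum (fun k _ => (cdb k).const_mul _), ContinuousLinearMap.sum_apply]
    refine Finset.sum_congr rfl fun k _ => ?_
    rw [fderiv_const_mul (cdb k)]; simp
  have h2 : ∑ j, ∑ k, (del j (dbar k (cx f)) z * X j * conj (X k))
      = ∑ j, X j * del j (fun w => ∑ k, conj (X k) * dbar k (cx f) w) z := by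
    refine Finset.sum_congr rfl fun j _ => ?_
    simp only [del, h1]
    rw [Finset.mul_sum, ← Finset.sum_sub_distrib, Finset.sum_div, Finset.mul_sum]
    refine Finset.sum_congr rfl fun k _ => ?_
    ring
  have h3 : (fun w => ∑ k, conj (X k) * dbar k (cx f) w) =
      fun w => (1/2:ℂ) * fderiv ℝ (cx f) w X + (I/2) * fderiv ℝ (cx f) w (I • X) := by
    ext w; rw [sum_dbar]; ring
  have d1 := diff_fderiv hF z X
  have d2 := diff_fderiv hF z (I • X)
  have h4 : ∀ Y, fderiv ℝ (fun w => (1/2:ℂ) * fderiv ℝ (cx f) w X + (I/2) * fderiv ℝ (cx f) w (I • X)) z Y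
      = (1/2) * D2 (cx f) z Y X + (I/2) * D2 (cx f) z Y (I • X) := by
    intro Y
    rw [fderiv_fun_add (d1.const_mul _) (d2.const_mul _), fderiv_const_mul d1, fderiv_const_mul d2]
    simp [D2]
  have h5 : ∑ j, ∑ k, (del j (dbar k (cx f)) z * X j * conj (X k)) = (leviForm f z X : ℂ) := by
    rw [h2, sum_del, h3, h4, h4, D2_symm hF z X (I • X)]
    have : I * I = -1 := I_mul_I
    rw [leviForm]; push_cast
    rw [← D2_cx hf, ← D2_cx hf]
    linear_combination (-1/4) * D2 (cx f) z (I • X) (I • X) * this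
  have := congrArg Complex.re h5
  simpa using this

/-- third power of the positive part -/
def pp (x : ℝ) : ℝ := (max x 0) ^ 3

lemma pp_deriv_aux (k : ℕ) (x : ℝ) : HasDerivAt (fun x : ℝ => (max x 0) ^ (k + 2)) ((k+2) * (max x 0) ^ (k+1)) x := by
  rcases lt_trichotomy x 0 with h | h | h
  · have : (fun x : ℝ => (max x 0) ^ (k + 2)) =ᶠ[𝓝 x] fun _ => 0 := by
      filter_upwards [gt_mem_nhds h] with y hy
      rw [max_eq_right hy.le]; simp
    rw [max_eq_right h.le]
    simpa using (hasDerivAt_const x (0:ℝ)).congr_of_eventuallyEq this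
  · subst h
    simp only [max_self, ne_eq, Nat.add_eq_zero_iff, one_ne_zero, and_false, not_false_eq_true, zero_pow, mul_zero]
    rw [hasDerivAt_iff_isLittleO_nhds_zero]
    simp only [zero_add, max_self, ne_eq, Nat.add_eq_zero_iff, OfNat.ofNat_ne_zero, and_false, not_false_eq_true,
      zero_pow, sub_zero, smul_zero]
    have h1 : (fun h : ℝ => (max h 0) ^ (k+2)) =O[𝓝 0] fun h : ℝ => h ^ (k+2) := by
      refine Asymptotics.IsBigO.of_bound 1 (Eventually.of_forall fun h => ?_)
      rw [one_mul, norm_pow, norm_pow]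
      gcongr
      rw [Real.norm_eq_abs, Real.norm_eq_abs, abs_of_nonneg (le_max_right _ _)]
      exact max_le (le_abs_self _) (abs_nonneg _)
    refine h1.trans_isLittleO ?_
    have := Asymptotics.isLittleO_pow_pow (𝕜 := ℝ) (m := 1) (n := k+2) (by omega)
    simpa using this
  · have : (fun x : ℝ => (max x 0) ^ (k + 2)) =ᶠ[𝓝 x] fun x => x ^ (k+2) := by
      filter_upwards [lt_mem_nhds h] with y hy
      rw [max_eq_left hy.le]
    rw [max_eq_left h.le]
    have := (hasDerivAt_pow (k+2) x).congr_of_eventuallyEq this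
    simpa using this

lemma pp_hd (x : ℝ) : HasDerivAt pp (3 * (max x 0) ^ 2) x := by
  have := pp_deriv_aux 1 x; norm_num at this; exact this

lemma pp_hd2 (x : ℝ) : HasDerivAt (fun x => 3 * (max x 0) ^ 2) (6 * max x 0) x := by
  have := (pp_deriv_aux 0 x).const_mul 3; norm_num at this
  rw [show 6 * max x 0 = 3 * (2 * max x 0) by ring]; exact this

lemma pp_contDiff : ContDiff ℝ 2 pp := by
  rw [show (2 : WithTop ℕ∞) = 1 + 1 by norm_num, contDiff_succ_iff_deriv]
  have e : deriv pp = fun x => 3 * (max x 0) ^ 2 := by ext x; exact (pp_hd x).deriv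
  refine ⟨fun x => (pp_hd x).differentiableAt, by simp, ?_⟩
  rw [e, contDiff_one_iff_deriv]
  have e2 : deriv (fun x : ℝ => 3 * (max x 0) ^ 2) = fun x => 6 * max x 0 := by ext x; exact (pp_hd2 x).deriv
  refine ⟨fun x => (pp_hd2 x).differentiableAt, ?_⟩
  rw [e2]; fun_prop

lemma D2_pp {s : Cn n → ℝ} (hs : ContDiff ℝ 2 s) (z X : Cn n) :
    fderiv ℝ (fun w => fderiv ℝ (fun w => pp (s w)) w X) z X =
      3 * (max (s z) 0) ^ 2 * fderiv ℝ (fun w => fderiv ℝ s w X) z X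
      + 6 * max (s z) 0 * (fderiv ℝ s z X) ^ 2 := by
  have hd : ∀ w, DifferentiableAt ℝ s w := fun w => hs.differentiable (by simp) w
  have e : (fun w => fderiv ℝ (fun w => pp (s w)) w X) = fun w => 3 * (max (s w) 0) ^ 2 * fderiv ℝ s w X := by
    ext w
    have := ((pp_hd (s w)).comp_hasFDerivAt w (hd w).hasFDerivAt).fderiv
    have e' : (fun w => pp (s w)) = pp ∘ s := rfl
    rw [e', this]; simp
  rw [e]
  have h1 := (pp_hd2 (s z)).comp_hasFDerivAt z (hd z).hasFDerivAt
  have h2 := (h1.fun_mul (fderiv_apply_diff hs z X).hasFDerivAt).fderiv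
  have e2 : (fun w => 3 * (max (s w) 0) ^ 2 * fderiv ℝ s w X) =
    fun w => ((fun x : ℝ => 3 * (max x 0) ^ 2) ∘ s) w * fderiv ℝ s w X := rfl
  rw [e2, h2]
  simp
  ring

lemma levi_pp_ge {s : Cn n → ℝ} (hs : ContDiff ℝ 2 s) (z X : Cn n) :
    3 * (max (s z) 0) ^ 2 * leviForm s z X ≤ leviForm (fun w => pp (s w)) z X := by
  unfold leviForm
  rw [D2_pp hs, D2_pp hs]
  have : 0 ≤ max (s z) 0 := le_max_right _ _
  nlinarith [mul_nonneg this (sq_nonneg (fderiv ℝ s z X)), mul_nonneg this (sq_nonneg (fderiv ℝ s z (I • X)))]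

lemma D2_add {f g : Cn n → ℝ} (hf : ContDiff ℝ 2 f) (hg : ContDiff ℝ 2 g) (z X : Cn n) :
    fderiv ℝ (fun w => fderiv ℝ (fun w => f w + g w) w X) z X =
      fderiv ℝ (fun w => fderiv ℝ f w X) z X + fderiv ℝ (fun w => fderiv ℝ g w X) z X := by
  have e : (fun w => fderiv ℝ (fun w => f w + g w) w X) = fun w => fderiv ℝ f w X + fderiv ℝ g w X := by
    ext w; rw [fderiv_fun_add (hf.differentiable (by simp) w) (hg.differentiable (by simp) w)]; rfl
  rw [e, fderiv_fun_add (fderiv_apply_diff hf z X) (fderiv_apply_diff hg z X)]; rfl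

lemma levi_add {f g : Cn n → ℝ} (hf : ContDiff ℝ 2 f) (hg : ContDiff ℝ 2 g) (z X : Cn n) :
    leviForm (fun w => f w + g w) z X = leviForm f z X + leviForm g z X := by
  simp only [leviForm, D2_add hf hg]; ring

lemma D2_smul {f : Cn n → ℝ} (hf : ContDiff ℝ 2 f) (c : ℝ) (z X : Cn n) :
    fderiv ℝ (fun w => fderiv ℝ (fun w => c * f w) w X) z X =
      c * fderiv ℝ (fun w => fderiv ℝ f w X) z X := by
  have e : (fun w => fderiv ℝ (fun w => c * f w) w X) = fun w => c * fderiv ℝ f w X := by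
    ext w; rw [fderiv_const_mul (hf.differentiable (by simp) w)]; rfl
  rw [e, fderiv_const_mul (fderiv_apply_diff hf z X)]; rfl

lemma levi_smul {f : Cn n → ℝ} (hf : ContDiff ℝ 2 f) (c : ℝ) (z X : Cn n) :
    leviForm (fun w => c * f w) z X = c * leviForm f z X := by
  simp only [leviForm, D2_smul hf]; ring

lemma levi_sub_const (f : Cn n → ℝ) (c : ℝ) (z X : Cn n) :
    leviForm (fun w => f w - c) z X = leviForm f z X := by
  simp only [leviForm, fderiv_sub_const]

lemma levi_congr {f g : Cn n → ℝ} {z : Cn n} (h : f =ᶠ[𝓝 z] g) (X : Cn n) :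
    leviForm f z X = leviForm g z X := by
  have : ∀ Y, (fun w => fderiv ℝ f w Y) =ᶠ[𝓝 z] fun w => fderiv ℝ g w Y := fun Y => by
    filter_upwards [h.eventuallyEq_nhds] with w hw
    rw [hw.fderiv_eq]
  simp only [leviForm, (this _).fderiv_eq]

end Loc
end

section
namespace Loc
open Filter Topology ContDiff ComplexConjugate Complex

/-- good exhaustion functions -/
def Exh (Ω : Set (Cn n)) : Prop := ∀ K : Set (Cn n), IsCompact K → K ⊆ Ω → ∃ s : Cn n → ℝ,
  ContDiff ℝ ∞ s ∧ (∀ z ∈ K, s z < 0) ∧ IsCompact {z | s z ≤ 3} ∧ {z | s z ≤ 3} ⊆ Ω ∧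
  ∀ z, s z ≤ 3 → ∀ X, ‖X‖ ^ 2 ≤ leviForm s z X

lemma quad_aux {I P G : ℝ} (hI : 0 ≤ I) (hP : 0 ≤ P) (hG : 0 ≤ G)
    (h : ∀ μ : ℝ, 0 < μ → I ≤ 1 / 2 * μ * P + 1 / 2 * G / μ) : I ^ 2 ≤ P * G := by
  have := discrim_le_zero (a := P) (b := - 2 * I) (c := G) (fun x => by
    rcases le_or_gt x 0 with hx | hx
    · nlinarith [mul_nonneg hP (mul_self_nonneg x)]
    · have := mul_le_mul_of_nonneg_left (h x hx) hx.le
      have e : x * (1 / 2 * x * P + 1 / 2 * G / x) = 1/2 * (x * x * P) + 1/2 * G := by field_simp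
      rw [e] at this; linarith)
  unfold discrim at this; nlinarith

lemma trans_facts {s : Cn n → ℝ} (hs : ContDiff ℝ ∞ s) {A : ℝ} (hc : IsCompact {z | s z ≤ A}) :
    ContDiff ℝ ∞ (fun z => Real.smoothTransition (A - s z)) ∧
    HasCompactSupport (fun z => Real.smoothTransition (A - s z)) ∧
    tsupport (fun z => Real.smoothTransition (A - s z)) ⊆ {z | s z ≤ A} := by
  have h : tsupport (fun z => Real.smoothTransition (A - s z)) ⊆ {z | s z ≤ A} :=
    closure_minimal (fun z hz => by
      by_contra h
      have h' : A - s z ≤ 0 := by simp at h; linarith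
      exact hz (Real.smoothTransition.zero_of_nonpos h')) hc.isClosed
  exact ⟨Real.smoothTransition.contDiff.comp (contDiff_const.sub hs), hc.of_isClosed_subset (isClosed_tsupport _) h, h⟩

lemma B_int {B : Fin n → Cn n → ℂ} (h : ∀ j, MemLp (B j) 2) : Integrable (fun z => ∑ j, ‖B j z‖ ^ 2) :=
  integrable_finsetSum _ fun j _ => (memLp_two_iff_integrable_sq_norm (h j).1).1 (h j)

lemma star2 {Ω : Set (Cn n)} {φ : Cn n → ℝ} (hφ : ContDiff ℝ 2 φ) {a B : Fin n → Cn n → ℂ}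
    (ha : ∀ j, ContDiff ℝ 1 (a j)) (hac : ∀ j, HasCompactSupport (a j)) (hG : Good Ω φ a B) {M : ℝ}
    (hM : ∀ j, ∀ z ∈ tsupport (a j), φ z ≤ M)
    {η : Cn n → ℝ} (hη : ContDiff ℝ ∞ η) (hη1 : ∀ z, η z ≤ 1) (hη0 : ∀ z, 0 ≤ η z)
    (hηc : HasCompactSupport η) (hηΩ : tsupport η ⊆ Ω) {lam : Cn n → ℝ} (hlm : Measurable lam) (hl0 : ∀ z, 0 ≤ lam z)
    {Λ : ℝ} (hlΛ : ∀ z, lam z ≤ Λ)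
    (hlev : ∀ z ∈ tsupport η, ∀ X : Cn n, lam z * ‖X‖ ^ 2 ≤ leviForm φ z X) :
    ∫ z, η z ^ 2 * lam z * ∑ j, ‖B j z‖ ^ 2 ≤ 2 * Real.exp M * (∫ z, ‖∑ j, dbar j (a j) z‖ ^ 2) +
      ∫ z, 4 * (∑ j, ‖del j (cx η) z‖ ^ 2) * ∑ j, ‖B j z‖ ^ 2 := by
  have h1 : (1 : WithTop ℕ∞) ≤ ((⊤:ℕ∞) : WithTop ℕ∞) := WithTop.coe_le_coe.2 le_top
  refine (star hφ ha hG hη hηc hηΩ hlm hl0 hlΛ (fun z hz X => ?_)).trans ?_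
  · have := hlev z hz (WithLp.toLp 2 X)
    rw [← lev_eq hφ, EuclideanSpace.norm_sq_eq] at this
    exact this
  have dc : ∀ j, Continuous (dbar j (a j)) := fun j => (contDiff_dbar (m := 1) (k := 0) j (ha j) (by simp)).continuous
  have nc : Continuous (fun z => ∑ j, ‖del j (cx η) z‖ ^ 2) := continuous_finsetSum _ fun j _ =>
    ((contDiff_del (m := ⊤) (k := 0) j (cx_contDiff hη) (by simp)).continuous.norm.pow 2)
  have hNc : HasCompactSupport (cx η) := hηc.comp_left (g := fun x : ℝ => (x : ℂ)) (by simp)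
  have ncs : HasCompactSupport (fun z => ∑ j, ‖del j (cx η) z‖ ^ 2) :=
    hNc.mono' (fun z hz => by
      by_contra h
      exact hz (Finset.sum_eq_zero fun j _ => by rw [del_eq_zero_of j h]; simp))
  obtain ⟨N, hN⟩ := ncs.exists_bound_of_continuous nc
  have i2 : Integrable (fun z => 4 * (∑ j, ‖del j (cx η) z‖ ^ 2) * ∑ j, ‖B j z‖ ^ 2) := by
    have := ((B_int hG.1).bdd_mul (f := fun z => ∑ j, ‖del j (cx η) z‖ ^ 2) (c := N) nc.aestronglyMeasurable
      (Eventually.of_forall hN)).const_mul 4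
    simpa [mul_assoc] using this
  have qcs : HasCompactSupport (fun z => ‖∑ j, dbar j (a j) z‖ ^ 2) := by
    have : HasCompactSupport (fun z => ∑ j, dbar j (a j) z) :=
      HasCompactSupport.of_support_subset_isCompact (K := ⋃ j, tsupport (a j)) (isCompact_iUnion fun j => hac j) (fun z hz => by
        by_contra h
        simp only [mem_iUnion, not_exists] at h
        exact hz (Finset.sum_eq_zero fun j _ => dbar_eq_zero_of j (h j)))
    exact this.comp_left (g := fun x : ℂ => ‖x‖ ^ 2) (by simp)
  have qc : Continuous (fun z => ‖∑ j, dbar j (a j) z‖ ^ 2) := (continuous_finsetSum _ fun j _ => dc j).norm.pow 2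
  have i1 : Integrable (fun z => 2 * η z ^ 2 * ‖∑ j, dbar j (a j) z‖ ^ 2 * Real.exp (φ z)) := by
    refine Continuous.integrable_of_hasCompactSupport ?_ ?_
    · exact ((continuous_const.mul (hη.continuous.pow 2)).mul qc).mul (Real.continuous_exp.comp hφ.continuous)
    · exact (qcs.mul_left (f := fun z => 2 * η z ^ 2)).mul_right
  rw [integral_add i1 i2]
  gcongr
  rw [← integral_const_mul]
  refine integral_mono i1 ((qc.integrable_of_hasCompactSupport qcs).const_mul _) fun z => ?_
  simp only
  by_cases h : ∃ j, z ∈ tsupport (a j)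
  · obtain ⟨j, hj⟩ := h
    have e1 : Real.exp (φ z) ≤ Real.exp M := Real.exp_le_exp.2 (hM j z hj)
    have e2 : η z ^ 2 ≤ 1 := pow_le_one₀ (hη0 z) (hη1 z)
    calc _ ≤ 2 * 1 * ‖∑ j, dbar j (a j) z‖ ^ 2 * Real.exp M := by gcongr
      _ = _ := by ring
  · push Not at h
    have : ∑ j, dbar j (a j) z = 0 := Finset.sum_eq_zero fun j _ => dbar_eq_zero_of j (h j)
    rw [this]; simp

end Loc
end

section
namespace Loc
open Filter Topology ContDiff ComplexConjugate Complex

set_option maxHeartbeats 1600000 in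
lemma apriori_t {Ω : Set (Cn n)} (hE : Exh Ω) {φ₀ : Cn n → ℝ} (hφ : ContDiff ℝ 2 φ₀) (hφ0 : ∀ z, 0 ≤ φ₀ z)
    {M : ℝ} (hM : ∀ z, φ₀ z ≤ M) {S : Set (Cn n)} (hS : MeasurableSet S) {c : ℝ} (hc : 0 < c)
    (hl0 : ∀ z ∈ Ω, ∀ X, 0 ≤ leviForm φ₀ z X) (hlc : ∀ z ∈ Ω ∩ S, ∀ X, c * ‖X‖ ^ 2 ≤ leviForm φ₀ z X)
    {a : Fin n → Cn n → ℂ} (ha : ∀ j, ContDiff ℝ 1 (a j)) (hac : ∀ j, HasCompactSupport (a j))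
    (haΩ : ∀ j, tsupport (a j) ⊆ Ω) {g : Fin n → Cn n → ℂ} (hg : ∀ j, MemLp (g j) 2)
    (hgS : ∀ j, ∀ z, z ∉ S → g j z = 0)
    (hgc : ∀ j k w, Tst Ω w → ∫ z, (g j z * dbar k w z - g k z * dbar j w z) = 0) :
    ∃ K1 : ℝ, ∀ t μ : ℝ, 0 < t → 0 < μ → ‖∫ z, ∑ j, a j z * g j z‖ ≤
      1 / 2 * μ * ((2 * Real.exp M * (∫ z, ‖∑ j, dbar j (a j) z‖ ^ 2)) / c + K1 * t⁻¹) +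
      1 / 2 * (∫ z, ∑ j, ‖g j z‖ ^ 2) / μ
      + 1 / 2 * Real.exp (-(t / 2)) * (Real.exp M * (∫ z, ∑ j, ‖a j z‖ ^ 2) + ∫ z, ∑ j, ‖g j z‖ ^ 2) := by
  obtain ⟨s, hs, hsK, hsc, hsΩ, hsl⟩ := hE (⋃ j, tsupport (a j)) (isCompact_iUnion fun j => hac j) (iUnion_subset haΩ)
  have h2 : (2:WithTop ℕ∞) ≤ ((⊤:ℕ∞) : WithTop ℕ∞) := WithTop.coe_le_coe.2 le_top
  have hs2 : ContDiff ℝ 2 s := hs.of_le h2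
  have hsc2 : IsCompact {z | s z ≤ 2} := hsc.of_isClosed_subset (isClosed_le hs.continuous continuous_const)
    (fun z (hz : s z ≤ 2) => show s z ≤ 3 by linarith)
  obtain ⟨e1, e1c, e1t⟩ := trans_facts hs hsc
  obtain ⟨e0, e0c, e0t⟩ := trans_facts hs hsc2
  set η1 : Cn n → ℝ := fun z => Real.smoothTransition (3 - s z) with hη1
  set η0 : Cn n → ℝ := fun z => Real.smoothTransition (2 - s z) with hη0
  have Nbd : ∀ {η : Cn n → ℝ}, ContDiff ℝ ∞ η → HasCompactSupport η → ∃ C : ℝ, 0 ≤ C ∧ ∀ z, ∑ j, ‖del j (cx η) z‖ ^ 2 ≤ C := by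
    intro η hη hηc
    have nc : Continuous (fun z => ∑ j, ‖del j (cx η) z‖ ^ 2) := continuous_finsetSum _ fun j _ =>
      ((contDiff_del (m := ⊤) (k := 0) j (cx_contDiff hη) (by simp)).continuous.norm.pow 2)
    have hNc : HasCompactSupport (cx η) := hηc.comp_left (g := fun x : ℝ => (x : ℂ)) (by simp)
    have ncs : HasCompactSupport (fun z => ∑ j, ‖del j (cx η) z‖ ^ 2) :=
      hNc.mono' (fun z hz => by
        by_contra h
        exact hz (Finset.sum_eq_zero fun j _ => by rw [del_eq_zero_of j h]; simp))
    obtain ⟨N, hN⟩ := ncs.exists_bound_of_continuous nc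
    exact ⟨N, (norm_nonneg _).trans (hN 0), fun z => (le_abs_self _).trans (hN z)⟩
  obtain ⟨C1, hC1, hN1⟩ := Nbd e1 e1c
  obtain ⟨C0, hC0, hN0⟩ := Nbd e0 e0c
  set Q := ∫ z, ‖∑ j, dbar j (a j) z‖ ^ 2 with hQ
  set Y := Real.exp M * (∫ z, ∑ j, ‖a j z‖ ^ 2) with hY
  set G := ∫ z, ∑ j, ‖g j z‖ ^ 2 with hGd
  refine ⟨4 * C0 / 3 * (2 * Real.exp M * Q + 4 * C1 * Y) / c, fun t μ ht hμ => ?_⟩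
  set φ : Cn n → ℝ := fun z => φ₀ z + t * pp (s z) with hφd
  have hpc : ContDiff ℝ 2 (fun z => pp (s z)) := pp_contDiff.comp hs2
  have hφ2 : ContDiff ℝ 2 φ := hφ.add (contDiff_const.mul hpc)
  have pp0 : ∀ x, 0 ≤ pp x := fun x => pow_nonneg (le_max_right _ _) 3
  have hφn : ∀ z, 0 ≤ φ z := fun z => add_nonneg (hφ0 z) (mul_nonneg ht.le (pp0 _))
  have hφK : ∀ j, ∀ z ∈ tsupport (a j), φ z ≤ M := by
    intro j z hz
    have : s z < 0 := hsK z (mem_iUnion.2 ⟨j, hz⟩)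
    simp only [hφd, pp, max_eq_right this.le]; simpa using hM z
  obtain ⟨B, hB⟩ := exists_good (Ω := Ω) hφ2.continuous hφn (fun j => (ha j).continuous) hac
  set b : Cn n → ℝ := fun z => ∑ j, ‖B j z‖ ^ 2 with hb
  have bint : Integrable b := B_int hB.1
  have b0 : ∀ z, 0 ≤ b z := fun z => Finset.sum_nonneg fun j _ => sq_nonneg _
  have aint : Integrable (fun z => ∑ j, ‖a j z‖ ^ 2) :=
    B_int (fun j => (ha j).continuous.memLp_of_hasCompactSupport (hac j))
  have bY : ∫ z, b z ≤ Y := by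
    refine hB.2.2.2.trans ?_
    rw [hY, ← integral_const_mul]
    refine integral_mono_of_nonneg (Eventually.of_forall fun z => by simp only [Pi.zero_apply]; positivity) (aint.const_mul _)
      (Eventually.of_forall fun z => ?_)
    simp only [Finset.mul_sum]
    refine Finset.sum_le_sum fun j _ => ?_
    by_cases hz : z ∈ tsupport (a j)
    · rw [mul_comm]; gcongr; exact hφK j z hz
    · rw [image_eq_zero_of_notMem_tsupport hz]; simp
  set lam : Cn n → ℝ := fun z => S.indicator (fun _ => c) z + {z | 1 ≤ s z}.indicator (fun _ => 3 * t) z with hlam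
  have hms : MeasurableSet {z | 1 ≤ s z} := (isClosed_le continuous_const hs.continuous).measurableSet
  have lm : Measurable lam := (measurable_const.indicator hS).add (measurable_const.indicator hms)
  have l1 : ∀ z, 0 ≤ S.indicator (fun _ => c) z := fun z => indicator_nonneg (fun _ _ => hc.le) z
  have l2 : ∀ z, 0 ≤ {z | 1 ≤ s z}.indicator (fun _ => 3 * t) z := fun z => indicator_nonneg (fun _ _ => by positivity) z
  have l0 : ∀ z, 0 ≤ lam z := fun z => add_nonneg (l1 z) (l2 z)
  have lL : ∀ z, lam z ≤ c + 3 * t := fun z => add_le_add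
    (indicator_le_self' (fun _ _ => hc.le) z) (indicator_le_self' (fun _ _ => by positivity) z)
  have hlev : ∀ z, s z ≤ 3 → ∀ X : Cn n, lam z * ‖X‖ ^ 2 ≤ leviForm φ z X := by
    intro z hz X
    have e : leviForm φ z X = leviForm φ₀ z X + t * leviForm (fun w => pp (s w)) z X := by
      rw [hφd, levi_add hφ (contDiff_const.mul hpc), levi_smul hpc]
    have h3 := levi_pp_ge hs2 z X
    have h4 := hsl z hz X
    have zΩ : z ∈ Ω := hsΩ hz
    rw [e, hlam, add_mul]
    refine add_le_add ?_ ?_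
    · by_cases hzS : z ∈ S
      · rw [indicator_of_mem hzS]; exact hlc z ⟨zΩ, hzS⟩ X
      · rw [indicator_of_notMem hzS]; simpa using hl0 z zΩ X
    · have h5 : 3 * (max (s z) 0) ^ 2 * ‖X‖ ^ 2 ≤ leviForm (fun w => pp (s w)) z X :=
        le_trans (by gcongr) h3
      by_cases hz1 : 1 ≤ s z
      · rw [indicator_of_mem (by exact hz1), mul_comm 3 t, mul_assoc]
        refine mul_le_mul_of_nonneg_left (le_trans ?_ h5) ht.le
        have : 1 ≤ (max (s z) 0) ^ 2 := one_le_pow₀ (le_max_of_le_left hz1)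
        gcongr; linarith
      · rw [indicator_of_notMem (by exact hz1), zero_mul]
        exact mul_nonneg ht.le (le_trans (by positivity) h5)
  have T0 : ∀ x, 0 ≤ Real.smoothTransition x := Real.smoothTransition.nonneg
  have T1 : ∀ x, Real.smoothTransition x ≤ 1 := Real.smoothTransition.le_one
  have s1 := star2 hφ2 ha hac hB hφK e1 (fun z => T1 _) (fun z => T0 _) e1c (e1t.trans hsΩ) lm l0 lL
    (fun z hz => hlev z (e1t hz))
  have s0 := star2 hφ2 ha hac hB hφK e0 (fun z => T1 _) (fun z => T0 _) e0c
    (fun z hz => hsΩ (show s z ≤ 3 from (show s z ≤ 2 from e0t hz).trans (by norm_num))) lm l0 lL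
    (fun z hz => hlev z ((show s z ≤ 2 from e0t hz).trans (by norm_num)))
  -- bound first
  have u1 : ∫ z, 4 * (∑ j, ‖del j (cx η1) z‖ ^ 2) * b z ≤ 4 * C1 * Y := by
    refine le_trans ?_ (mul_le_mul_of_nonneg_left bY (by positivity))
    rw [← integral_const_mul]
    refine integral_mono_of_nonneg (Eventually.of_forall fun z => by simp only [Pi.zero_apply]; have := b0 z; positivity)
      (bint.const_mul _) (Eventually.of_forall fun z => ?_)
    have := b0 z
    simp only
    gcongr
    exact hN1 z
  have Qb : ∀ (η : Cn n → ℝ) (f : Cn n → ℝ) (Λ : ℝ), Measurable f → Continuous η → (∀ z, 0 ≤ η z) → (∀ z, η z ≤ 1) →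
      (∀ z, 0 ≤ f z) → (∀ z, f z ≤ Λ) → Integrable (fun z => η z ^ 2 * f z * b z) := by
    intro η f Λ hf hη h0 h1 hf0 hfΛ
    refine bint.bdd_mul (c := 1 * Λ) ((hη.measurable.pow_const 2).mul hf).aestronglyMeasurable
      (Eventually.of_forall fun z => ?_)
    rw [Real.norm_of_nonneg (mul_nonneg (sq_nonneg _) (hf0 z))]
    exact mul_le_mul (pow_le_one₀ (h0 z) (h1 z)) (hfΛ z) (hf0 z) zero_le_one
  have i1 := Qb η1 lam _ lm e1.continuous (fun z => T0 _) (fun z => T1 _) l0 lL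
  have i0 := Qb η0 lam _ lm e0.continuous (fun z => T0 _) (fun z => T1 _) l0 lL
  have mi : Measurable (S.indicator (fun _ => (1:ℝ))) := measurable_const.indicator hS
  have i00 := Qb η0 (S.indicator (fun _ => (1:ℝ))) 1 mi e0.continuous (fun z => T0 _) (fun z => T1 _)
    (fun z => indicator_nonneg (fun _ _ => zero_le_one) z) (fun z => indicator_le_self' (fun _ _ => zero_le_one) z)
  have u0 : ∫ z, 4 * (∑ j, ‖del j (cx η0) z‖ ^ 2) * b z ≤ (4 * C0 / 3 * t⁻¹) * ∫ z, η1 z ^ 2 * lam z * b z := by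
    rw [← integral_const_mul]
    refine integral_mono_of_nonneg (Eventually.of_forall fun z => by simp only [Pi.zero_apply]; have := b0 z; positivity)
      (i1.const_mul _) (Eventually.of_forall fun z => ?_)
    have hbz := b0 z
    simp only
    have R : 0 ≤ 4 * C0 / 3 * t⁻¹ * (η1 z ^ 2 * lam z * b z) := by have := l0 z; positivity
    rcases lt_or_ge (s z) 1 with h | h
    · have : η0 =ᶠ[𝓝 z] fun _ => 1 := by
        filter_upwards [hs.continuous.continuousAt.eventually_lt continuousAt_const h] with y hy
        exact Real.smoothTransition.one_of_one_le (by linarith)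
      have : ∀ j, del j (cx η0) z = 0 := fun j => by
        have h' : cx η0 =ᶠ[𝓝 z] fun _ => (1:ℂ) := by
          filter_upwards [this] with y hy; simp [cx, hy]
        simp [del, h'.fderiv_eq]
      simpa [this] using R
    · rcases le_or_gt (s z) 2 with h' | h'
      · have e : η1 z = 1 := Real.smoothTransition.one_of_one_le (by linarith)
        have : 3 * t ≤ lam z := by
          have := l1 z
          simp only [hlam]; rw [indicator_of_mem (by exact h) (fun _ => 3 * t)]; linarith
        rw [e]
        calc _ ≤ 4 * C0 * b z := by gcongr; exact hN0 z
          _ = 4 * C0 / 3 * t⁻¹ * (1 ^ 2 * (3 * t) * b z) := by field_simp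
          _ ≤ _ := by gcongr
      · have : ∀ j, del j (cx η0) z = 0 := fun j => del_eq_zero_of j (fun hz => by
          have hz' : z ∈ tsupport η0 := closure_mono (fun w hw => by
            simp only [Function.mem_support, cx] at hw ⊢
            exact fun h => hw (by simp [h])) hz
          exact absurd (e0t hz') (by simpa using h'))
        simpa [this] using R
  have v0 : c * ∫ z, η0 z ^ 2 * S.indicator (fun _ => (1:ℝ)) z * b z ≤ ∫ z, η0 z ^ 2 * lam z * b z := by
    rw [← integral_const_mul]
    refine integral_mono (i00.const_mul c) i0 fun z => ?_
    have hbz := b0 z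
    have : c * S.indicator (fun _ => (1:ℝ)) z ≤ lam z := by
      have := l2 z
      simp only [hlam]
      by_cases hz : z ∈ S
      · simp only [indicator_of_mem hz]; linarith
      · simp only [indicator_of_notMem hz]; linarith
    calc c * (η0 z ^ 2 * S.indicator (fun _ => (1:ℝ)) z * b z) = η0 z ^ 2 * (c * S.indicator (fun _ => (1:ℝ)) z) * b z := by ring
      _ ≤ _ := by gcongr
  set Xt := ∫ z, η0 z ^ 2 * S.indicator (fun _ => (1:ℝ)) z * b z with hXt
  have w0 : Xt ≤ 2 * Real.exp M * Q / c + 4 * C0 / 3 * (2 * Real.exp M * Q + 4 * C1 * Y) / c * t⁻¹ := by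
    have : c * Xt ≤ 2 * Real.exp M * Q + (4 * C0 / 3 * t⁻¹) * (2 * Real.exp M * Q + 4 * C1 * Y) := by
      refine v0.trans (s0.trans ?_)
      gcongr
      refine u0.trans ?_
      gcongr
      exact s1.trans (by gcongr)
    rw [← mul_le_mul_iff_right₀ hc]
    refine this.trans (le_of_eq ?_)
    field_simp
  -- the pairing
  have gint : Integrable (fun z => ∑ j, ‖g j z‖ ^ 2) := B_int hg
  have p1 : ‖∫ z, ∑ j, a j z * g j z‖ = ‖∫ z, ∑ j, conj (g j z) * ((Real.exp (-(φ z / 2)) : ℂ) * B j z)‖ := by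
    rw [hB.2.2.1 g hg hgc, ← norm_conj (∫ z, ∑ j, a j z * g j z), ← integral_conj]
    simp
  rw [p1]
  have p2 : ‖∫ z, ∑ j, conj (g j z) * ((Real.exp (-(φ z / 2)) : ℂ) * B j z)‖ ≤
      ∫ z, (1 / 2 * μ * (η0 z ^ 2 * S.indicator (fun _ => (1:ℝ)) z * b z) + 1 / 2 / μ * (∑ j, ‖g j z‖ ^ 2)
      + 1 / 2 * Real.exp (-(t / 2)) * (b z + ∑ j, ‖g j z‖ ^ 2)) := by
    refine norm_integral_le_of_norm_le (((i00.const_mul _).add (gint.const_mul _)).add ((bint.add gint).const_mul _))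
      (Eventually.of_forall fun z => ?_)
    have hbz := b0 z
    have eg0 : 0 ≤ ∑ j, ‖g j z‖ ^ 2 := Finset.sum_nonneg fun j _ => sq_nonneg _
    have ind0 : 0 ≤ S.indicator (fun _ => (1:ℝ)) z := indicator_nonneg (fun _ _ => zero_le_one) z
    have E : ∀ x : ℝ, 0 < x → ‖∑ j, conj (g j z) * ((Real.exp (-(φ z / 2)) : ℂ) * B j z)‖ ≤
        Real.exp (-(φ z / 2)) * (1 / 2 * x * b z + 1 / 2 / x * ∑ j, ‖g j z‖ ^ 2) := by
      intro x hx
      refine (norm_sum_le _ _).trans ?_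
      rw [hb, Finset.mul_sum, Finset.mul_sum, ← Finset.sum_add_distrib, Finset.mul_sum]
      refine Finset.sum_le_sum fun j _ => ?_
      rw [norm_mul, norm_mul, norm_conj, norm_real, Real.norm_of_nonneg (Real.exp_pos _).le]
      have : ‖g j z‖ * ‖B j z‖ ≤ 1 / 2 * x * ‖B j z‖ ^ 2 + 1 / 2 / x * ‖g j z‖ ^ 2 := by
        have h := mul_nonneg (by positivity : 0 ≤ 1 / 2 / x) (sq_nonneg (x * ‖B j z‖ - ‖g j z‖))
        have : 1 / 2 / x * (x * ‖B j z‖ - ‖g j z‖) ^ 2 = 1 / 2 * x * ‖B j z‖ ^ 2 + 1 / 2 / x * ‖g j z‖ ^ 2 - ‖g j z‖ * ‖B j z‖ := by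
          field_simp; ring
        linarith
      calc _ = Real.exp (-(φ z / 2)) * (‖g j z‖ * ‖B j z‖) := by ring
        _ ≤ _ := by gcongr
    have Z : 0 ≤ Real.exp (-(t / 2)) := (Real.exp_pos _).le
    by_cases hz : z ∈ S
    · rcases le_or_gt (s z) 1 with h | h
      · have e : η0 z = 1 := Real.smoothTransition.one_of_one_le (by linarith)
        have := E μ hμ
        have h1 : Real.exp (-(φ z / 2)) ≤ 1 := Real.exp_le_one_iff.2 (by linarith [hφn z])
        rw [e, indicator_of_mem hz]
        have k1 : 0 ≤ 1 / 2 * μ * b z + 1 / 2 / μ * ∑ j, ‖g j z‖ ^ 2 := by positivity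
        have k2 : 0 ≤ 1 / 2 * Real.exp (-(t / 2)) * (b z + ∑ j, ‖g j z‖ ^ 2) := by positivity
        nlinarith [mul_le_mul_of_nonneg_right h1 k1]
      · have := E 1 one_pos
        have hp : t ≤ φ z := by
          have h1 : 1 ≤ pp (s z) := one_le_pow₀ (le_max_of_le_left h.le)
          have := hφ0 z
          simp only [hφd]; linarith [mul_le_mul_of_nonneg_left h1 ht.le]
        have h1 : Real.exp (-(φ z / 2)) ≤ Real.exp (-(t / 2)) := Real.exp_le_exp.2 (by linarith)
        have k1 : 0 ≤ 1 / 2 * 1 * b z + 1 / 2 / 1 * ∑ j, ‖g j z‖ ^ 2 := by positivity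
        have k2 : 0 ≤ 1 / 2 * μ * (η0 z ^ 2 * S.indicator (fun _ => (1:ℝ)) z * b z) := by positivity
        have k3 : 0 ≤ 1 / 2 / μ * ∑ j, ‖g j z‖ ^ 2 := by positivity
        nlinarith [mul_le_mul_of_nonneg_right h1 k1]
    · have : ∑ j, conj (g j z) * ((Real.exp (-(φ z / 2)) : ℂ) * B j z) = 0 :=
        Finset.sum_eq_zero fun j _ => by rw [hgS j z hz]; simp
      rw [this, norm_zero]
      positivity
  refine p2.trans ?_
  have j1 : Integrable (fun z => 1 / 2 * μ * (η0 z ^ 2 * S.indicator (fun _ => (1:ℝ)) z * b z) + 1 / 2 / μ * (∑ j, ‖g j z‖ ^ 2)) :=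
    (i00.const_mul _).add (gint.const_mul _)
  have j2 : Integrable (fun z => 1 / 2 * Real.exp (-(t / 2)) * (b z + ∑ j, ‖g j z‖ ^ 2)) := (bint.add gint).const_mul _
  rw [integral_add j1 j2,
    integral_add (i00.const_mul _) (gint.const_mul _), integral_const_mul, integral_const_mul, integral_const_mul]
  have : ∫ z, (b z + ∑ j, ‖g j z‖ ^ 2) = (∫ z, b z) + G := integral_add bint gint
  rw [this, ← hXt, ← hGd]
  have e : 1 / 2 * G / μ = 1 / 2 / μ * G := by ring
  rw [e]
  gcongr

lemma apriori {Ω : Set (Cn n)} (hE : Exh Ω) {φ₀ : Cn n → ℝ} (hφ : ContDiff ℝ 2 φ₀) (hφ0 : ∀ z, 0 ≤ φ₀ z)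
    {M : ℝ} (hM : ∀ z, φ₀ z ≤ M) {S : Set (Cn n)} (hS : MeasurableSet S) {c : ℝ} (hc : 0 < c)
    (hl0 : ∀ z ∈ Ω, ∀ X, 0 ≤ leviForm φ₀ z X) (hlc : ∀ z ∈ Ω ∩ S, ∀ X, c * ‖X‖ ^ 2 ≤ leviForm φ₀ z X)
    {a : Fin n → Cn n → ℂ} (ha : ∀ j, ContDiff ℝ 1 (a j)) (hac : ∀ j, HasCompactSupport (a j))
    (haΩ : ∀ j, tsupport (a j) ⊆ Ω) {g : Fin n → Cn n → ℂ} (hg : ∀ j, MemLp (g j) 2)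
    (hgS : ∀ j, ∀ z, z ∉ S → g j z = 0)
    (hgc : ∀ j k w, Tst Ω w → ∫ z, (g j z * dbar k w z - g k z * dbar j w z) = 0) :
    ‖∫ z, ∑ j, a j z * g j z‖ ^ 2 ≤
      (2 * Real.exp M * (∫ z, ‖∑ j, dbar j (a j) z‖ ^ 2)) / c * (∫ z, ∑ j, ‖g j z‖ ^ 2) := by
  obtain ⟨K1, hK⟩ := apriori_t hE hφ hφ0 hM hS hc hl0 hlc ha hac haΩ hg hgS hgc
  refine quad_aux (norm_nonneg _) (by positivity) (by positivity) fun μ hμ => ?_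
  refine ge_of_tendsto' (x := atTop (α := ℕ)) (f := fun m : ℕ => 1 / 2 * μ * ((2 * Real.exp M * (∫ z, ‖∑ j, dbar j (a j) z‖ ^ 2)) / c + K1 * ((m:ℝ)+1)⁻¹) +
      1 / 2 * (∫ z, ∑ j, ‖g j z‖ ^ 2) / μ
      + 1 / 2 * Real.exp (-(((m:ℝ)+1) / 2)) * (Real.exp M * (∫ z, ∑ j, ‖a j z‖ ^ 2) + ∫ z, ∑ j, ‖g j z‖ ^ 2)) ?_
    (fun m => hK ((m:ℝ)+1) μ (by positivity) hμ)
  have tt : Tendsto (fun m : ℕ => (m:ℝ)+1) atTop atTop := tendsto_atTop_add_const_right _ _ tendsto_natCast_atTop_atTop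
  have t1 : Tendsto (fun m : ℕ => ((m:ℝ)+1)⁻¹) atTop (𝓝 0) := tendsto_inv_atTop_zero.comp tt
  have t2 : Tendsto (fun m : ℕ => Real.exp (-(((m:ℝ)+1)/2))) atTop (𝓝 0) :=
    Real.tendsto_exp_neg_atTop_nhds_zero.comp (tt.atTop_div_const (by norm_num))
  have := (((tendsto_const_nhds (x := (2 * Real.exp M * (∫ z, ‖∑ j, dbar j (a j) z‖ ^ 2)) / c)).add (t1.const_mul K1)).const_mul (1/2*μ)).add
    (tendsto_const_nhds (x := 1 / 2 * (∫ z, ∑ j, ‖g j z‖ ^ 2) / μ)) |>.add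
    ((t2.const_mul (1/2)).mul_const (Real.exp M * (∫ z, ∑ j, ‖a j z‖ ^ 2) + ∫ z, ∑ j, ‖g j z‖ ^ 2))
  simpa using this

end Loc
end

section
namespace Loc
open Filter Topology ContDiff ComplexConjugate Complex

lemma taylor1 {g g' g'' : ℝ → ℝ} (h1 : ∀ t, HasDerivAt g (g' t) t) (h2 : ∀ t, HasDerivAt g' (g'' t) t) :
    ∃ ξ ∈ Ioo (0:ℝ) 1, g 1 = g 0 + g' 0 + 1 / 2 * g'' ξ := by
  set A := 2 * (g 1 - g 0 - g' 0) with hA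
  have hF : ∀ t, HasDerivAt (fun t => g 1 - g t - g' t * (1 - t) - A * (1 - t) ^ 2 / 2) ((1 - t) * (A - g'' t)) t := by
    intro t
    have e := (((hasDerivAt_const t (g 1)).sub (h1 t)).sub ((h2 t).mul ((hasDerivAt_const t (1:ℝ)).sub (hasDerivAt_id t)))).sub
      (((((hasDerivAt_const t (1:ℝ)).sub (hasDerivAt_id t)).pow 2).const_mul A).div_const 2)
    exact e.congr_deriv (by simp only [id, Pi.sub_apply]; ring)
  obtain ⟨ξ, hξ, h⟩ := exists_hasDerivAt_eq_zero (f := fun t => g 1 - g t - g' t * (1 - t) - A * (1 - t) ^ 2 / 2)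
    (f' := fun t => (1 - t) * (A - g'' t)) (a := 0) (b := 1) one_pos
    (fun t _ => (hF t).continuousAt.continuousWithinAt) (by simp [hA]) (fun t _ => hF t)
  refine ⟨ξ, hξ, ?_⟩
  have : A = g'' ξ := by
    rcases mul_eq_zero.1 h with h | h
    · exact absurd h (by have := hξ.2; intro h; linarith)
    · linarith
  rw [← this]; ring

lemma fderiv2_diff {u : Cn n → ℝ} (hu : ContDiff ℝ 2 u) (z : Cn n) : DifferentiableAt ℝ (fderiv ℝ u) z :=
  (hu.fderiv_right (m := 1) (by norm_num)).differentiable (by simp) z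

lemma fderiv2_cont {u : Cn n → ℝ} (hu : ContDiff ℝ 2 u) : Continuous (fderiv ℝ (fderiv ℝ u)) :=
  (hu.fderiv_right (m := 1) (by norm_num)).continuous_fderiv (by simp)

lemma D2r_eq {u : Cn n → ℝ} (hu : ContDiff ℝ 2 u) (z X Y : Cn n) :
    fderiv ℝ (fun w => fderiv ℝ u w Y) z X = fderiv ℝ (fderiv ℝ u) z X Y := by
  rw [fderiv_clm_apply (fderiv2_diff hu z) (differentiableAt_const _)]; simp

lemma D2r_symm {u : Cn n → ℝ} (hu : ContDiff ℝ 2 u) (z X Y : Cn n) :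
    fderiv ℝ (fderiv ℝ u) z X Y = fderiv ℝ (fderiv ℝ u) z Y X :=
  (hu.contDiffAt.isSymmSndFDerivAt (by simp)).eq X Y

lemma levi_H {u : Cn n → ℝ} (hu : ContDiff ℝ 2 u) (z X : Cn n) :
    leviForm u z X = (fderiv ℝ (fderiv ℝ u) z X X + fderiv ℝ (fderiv ℝ u) z (I • X) (I • X)) / 4 := by
  rw [leviForm, D2r_eq hu, D2r_eq hu]

lemma taylor2 {u : Cn n → ℝ} (hu : ContDiff ℝ 2 u) (z v : Cn n) : ∃ ξ ∈ Ioo (0:ℝ) 1,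
    u (z + v) = u z + fderiv ℝ u z v + 1 / 2 * fderiv ℝ (fderiv ℝ u) (z + ξ • v) v v := by
  have hl : ∀ t : ℝ, HasDerivAt (fun t : ℝ => z + t • v) v t := fun t => by
    simpa using ((hasDerivAt_id t).smul_const v).const_add z
  have h1 : ∀ t : ℝ, HasDerivAt (fun t : ℝ => u (z + t • v)) (fderiv ℝ u (z + t • v) v) t := fun t =>
    ((hu.differentiable (by simp) (z + t • v)).hasFDerivAt).comp_hasDerivAt t (hl t)
  have h2 : ∀ t : ℝ, HasDerivAt (fun t : ℝ => fderiv ℝ u (z + t • v) v) (fderiv ℝ (fderiv ℝ u) (z + t • v) v v) t := fun t => by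
    have := ((fderiv_apply_diff hu (z + t • v) v).hasFDerivAt).comp_hasDerivAt t (hl t)
    rw [D2r_eq hu] at this
    exact this
  obtain ⟨ξ, hξ, h⟩ := taylor1 h1 h2
  exact ⟨ξ, hξ, by simpa using h⟩

lemma gen_close {E : Type*} [NormedAddCommGroup E] [NormedSpace ℝ E] {H : E → E →L[ℝ] E →L[ℝ] ℝ} (hc : Continuous H) (z : E)
    {ε : ℝ} (hε : 0 < ε) : ∃ δ > 0, ∀ w, dist w z < δ → ∀ v, |H w v v - H z v v| ≤ ε * ‖v‖ ^ 2 := by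
  have hc0 := (tendsto_iff_norm_sub_tendsto_zero (E := E →L[ℝ] E →L[ℝ] ℝ)).1 (hc.tendsto z)
  obtain ⟨δ, hδ, h⟩ := Metric.eventually_nhds_iff.1 (hc0.eventually_lt_const hε)
  refine ⟨δ, hδ, fun w hw v => ?_⟩
  have h2 := h hw
  have h3 := (H w - H z).le_opNorm₂ v v
  rw [sub_apply, sub_apply] at h3
  refine h3.trans ?_
  rw [pow_two, ← mul_assoc]; gcongr

lemma D2_close {u : Cn n → ℝ} (hu : ContDiff ℝ 2 u) (z : Cn n) {ε : ℝ} (hε : 0 < ε) :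
    ∃ δ > 0, ∀ w, dist w z < δ → ∀ v, |fderiv ℝ (fderiv ℝ u) w v v - fderiv ℝ (fderiv ℝ u) z v v| ≤ ε * ‖v‖ ^ 2 :=
  gen_close (fderiv2_cont hu) z hε

lemma taylor_upper {u : Cn n → ℝ} (hu : ContDiff ℝ 2 u) (z : Cn n) {ε : ℝ} (hε : 0 < ε) : ∃ δ > 0, ∀ v, ‖v‖ < δ →
    u (z + v) ≤ u z + fderiv ℝ u z v + 1 / 2 * fderiv ℝ (fderiv ℝ u) z v v + ε * ‖v‖ ^ 2 := by
  obtain ⟨δ, hδ, h⟩ := D2_close hu z hε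
  refine ⟨δ, hδ, fun v hv => ?_⟩
  obtain ⟨ξ, hξ, e⟩ := taylor2 hu z v
  have h1 : dist (z + ξ • v) z < δ := by
    rw [dist_eq_norm, add_sub_cancel_left, norm_smul, Real.norm_of_nonneg hξ.1.le]
    nlinarith [norm_nonneg v, hξ.2]
  have h2 := (abs_le.1 (h _ h1 v)).2
  have : 0 ≤ ε * ‖v‖ ^ 2 := by positivity
  rw [e]; linarith

lemma levi_nonneg_of_submean {u : Cn n → ℝ} (hu : ContDiff ℝ 2 u) (z X : Cn n) {r₀ : ℝ} (hr₀ : 0 < r₀)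
    (h : ∀ r, 0 < r → r < r₀ → u z ≤ (1 / (2 * Real.pi)) * ∫ θ in (0:ℝ)..(2 * Real.pi),
      u (z + ((r : ℂ) * Complex.exp (θ * I)) • X)) : 0 ≤ leviForm u z X := by
  have key : ∀ ε > 0, 0 ≤ leviForm u z X + ε * ‖X‖ ^ 2 := by
    intro ε hε
    obtain ⟨δ, hδ, hT⟩ := taylor_upper hu z hε
    obtain ⟨r, hr, hr1⟩ : ∃ r, 0 < r ∧ r < min r₀ (δ / (‖X‖ + 1)) := exists_between (by positivity)
    have hrX : r * ‖X‖ < δ := by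
      have := hr1.trans_le (min_le_right _ _)
      rw [lt_div_iff₀ (by positivity)] at this
      nlinarith
    have hs := h r hr (hr1.trans_le (min_le_left _ _))
    set H := fderiv ℝ (fderiv ℝ u) z
    set L := fderiv ℝ u z
    have ev : ∀ θ : ℝ, ((r : ℂ) * Complex.exp (θ * I)) • X = r • (Real.cos θ • X + Real.sin θ • (I • X)) := by
      intro θ
      rw [Complex.exp_mul_I, ← ofReal_cos, ← ofReal_sin, mul_smul, add_smul, mul_smul]
      simp only [Complex.coe_smul]
    have hb : ∀ θ : ℝ, u (z + ((r : ℂ) * Complex.exp (θ * I)) • X) ≤ u z + r * (Real.cos θ * L X + Real.sin θ * L (I • X))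
        + 1 / 2 * r ^ 2 * (Real.cos θ ^ 2 * H X X + Real.sin θ ^ 2 * H (I • X) (I • X)
          + Real.sin θ * Real.cos θ * (H X (I • X) + H (I • X) X)) + ε * r ^ 2 * ‖X‖ ^ 2 := by
      intro θ
      have nv : ‖((r : ℂ) * Complex.exp (θ * I)) • X‖ = r * ‖X‖ := by
        rw [norm_smul, norm_mul, norm_exp_ofReal_mul_I, norm_real, Real.norm_of_nonneg hr.le, mul_one]
      have := hT _ (by rw [nv]; exact hrX)
      rw [nv] at this
      refine this.trans (le_of_eq ?_)
      rw [ev]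
      simp only [map_smul, map_add, ContinuousLinearMap.add_apply, ContinuousLinearMap.smul_apply, smul_eq_mul]
      ring
    have hm : ∫ θ in (0:ℝ)..(2 * Real.pi), u (z + ((r : ℂ) * Complex.exp (θ * I)) • X) ≤
        ∫ θ in (0:ℝ)..(2 * Real.pi), (u z + r * (Real.cos θ * L X + Real.sin θ * L (I • X))
        + 1 / 2 * r ^ 2 * (Real.cos θ ^ 2 * H X X + Real.sin θ ^ 2 * H (I • X) (I • X)
          + Real.sin θ * Real.cos θ * (H X (I • X) + H (I • X) X)) + ε * r ^ 2 * ‖X‖ ^ 2) := by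
      refine intervalIntegral.integral_mono_on Real.two_pi_pos.le ?_ ?_ (fun θ _ => hb θ)
      · have := hu.continuous
        exact Continuous.intervalIntegrable (by fun_prop) _ _
      · exact Continuous.intervalIntegrable (by fun_prop) _ _
    have hi : ∫ θ in (0:ℝ)..(2 * Real.pi), (u z + r * (Real.cos θ * L X + Real.sin θ * L (I • X))
        + 1 / 2 * r ^ 2 * (Real.cos θ ^ 2 * H X X + Real.sin θ ^ 2 * H (I • X) (I • X)
          + Real.sin θ * Real.cos θ * (H X (I • X) + H (I • X) X)) + ε * r ^ 2 * ‖X‖ ^ 2) =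
        2 * Real.pi * (u z + r ^ 2 * (leviForm u z X + ε * ‖X‖ ^ 2)) := by
      have ci : ∀ {f : ℝ → ℝ}, Continuous f → IntervalIntegrable f volume 0 (2 * Real.pi) := fun hf => hf.intervalIntegrable _ _
      rw [intervalIntegral.integral_add (ci (by fun_prop)) (ci (by fun_prop)),
        intervalIntegral.integral_add (ci (by fun_prop)) (ci (by fun_prop)),
        intervalIntegral.integral_add (ci (by fun_prop)) (ci (by fun_prop)),
        intervalIntegral.integral_const_mul, intervalIntegral.integral_const_mul,
        intervalIntegral.integral_add (ci (by fun_prop)) (ci (by fun_prop)),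
        intervalIntegral.integral_add (ci (by fun_prop)) (ci (by fun_prop)),
        intervalIntegral.integral_add (ci (by fun_prop)) (ci (by fun_prop))]
      simp only [intervalIntegral.integral_mul_const, integral_cos, integral_sin, integral_cos_sq, integral_sin_sq,
        integral_sin_mul_cos₁, intervalIntegral.integral_const]
      simp only [Real.sin_two_pi, Real.cos_two_pi, Real.sin_zero, Real.cos_zero, smul_eq_mul]
      rw [levi_H hu]; ring
    rw [hi] at hm
    have : u z ≤ (1 / (2 * Real.pi)) * (2 * Real.pi * (u z + r ^ 2 * (leviForm u z X + ε * ‖X‖ ^ 2))) :=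
      hs.trans (by gcongr)
    have e : (1 / (2 * Real.pi)) * (2 * Real.pi * (u z + r ^ 2 * (leviForm u z X + ε * ‖X‖ ^ 2))) =
      u z + r ^ 2 * (leviForm u z X + ε * ‖X‖ ^ 2) := by field_simp
    rw [e] at this
    have : 0 ≤ r ^ 2 * (leviForm u z X + ε * ‖X‖ ^ 2) := by linarith
    exact (mul_nonneg_iff_of_pos_left (by positivity)).1 this
  have ht : Tendsto (fun ε : ℝ => leviForm u z X + ε * ‖X‖ ^ 2) (𝓝[>] 0) (𝓝 (leviForm u z X + 0 * ‖X‖ ^ 2)) :=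
    Tendsto.mono_left (Continuous.tendsto (by fun_prop) 0) nhdsWithin_le_nhds
  rw [zero_mul, add_zero] at ht
  exact ge_of_tendsto ht (by filter_upwards [self_mem_nhdsWithin] with ε hε using key ε hε)

lemma levi_normsq (p z X : Cn n) : leviForm (fun w => ‖w - p‖ ^ 2) z X = ‖X‖ ^ 2 := by
  have h1 : ∀ w Y, fderiv ℝ (fun w : Cn n => ‖w - p‖ ^ 2) w Y = 2 * Inner.inner ℝ (w - p) Y := by
    intro w Y
    have := ((hasFDerivAt_id w).sub_const p).norm_sq.fderiv
    simp only [id] at this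
    rw [this]; simp [inner_sub_left]
  have h2 : ∀ Y, fderiv ℝ (fun w : Cn n => (2:ℝ) * Inner.inner ℝ (w - p) Y) z Y = 2 * ‖Y‖ ^ 2 := by
    intro Y
    have hd : DifferentiableAt ℝ (fun w : Cn n => w - p) z := differentiableAt_id.sub_const p
    rw [fderiv_const_mul (hd.inner ℝ (differentiableAt_const _)), ContinuousLinearMap.smul_apply,
      fderiv_inner_apply ℝ hd (differentiableAt_const _)]
    simp [fderiv_sub_const]
  simp only [leviForm, h1, h2, norm_smul, norm_I]; ring

end Loc
end

section
namespace Loc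
open Filter Topology ContDiff ComplexConjugate Complex

/-- real mollification -/
def mr (ε : ℝ) (m : Cn n → ℝ) (z : Cn n) : ℝ := ∫ y, ker ε y * m (z - y)

lemma mr_smooth {m : Cn n → ℝ} (hm : Continuous m) {ε : ℝ} (hε : 0 < ε) : ContDiff ℝ ∞ (mr ε m) := by
  have e : mr ε m = fun z => (mol ε (cx m) z).re := by
    ext z
    have : mol ε (cx m) z = ((mr ε m z : ℝ) : ℂ) := by
      rw [mr, ← integral_complex_ofReal]; simp [mol, cx]
    rw [this, ofReal_re]
  rw [e]
  exact reCLM.contDiff.comp (mol_smooth (continuous_ofReal.comp hm).locallyIntegrable hε)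

lemma mr_int {m : Cn n → ℝ} (hm : Continuous m) {ε : ℝ} (hε : 0 < ε) (z : Cn n) :
    Integrable (fun y => ker ε y * m (z - y)) :=
  Continuous.integrable_of_hasCompactSupport ((ker_smooth ε).continuous.mul (hm.comp (continuous_const.sub continuous_id)))
    (ker_hcs hε).mul_right

lemma mr_near {m : Cn n → ℝ} (hm : Continuous m) {ε : ℝ} (hε : 0 < ε) {κ : ℝ} {z : Cn n}
    (h : ∀ y, ‖y‖ < ε → |m (z - y) - m z| ≤ κ) : |mr ε m z - m z| ≤ κ := by
  have e : mr ε m z - m z = ∫ y, ker ε y * (m (z - y) - m z) := by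
    simp_rw [mul_sub]
    rw [integral_sub (mr_int hm hε z) ((ker_int hε).mul_const _), integral_mul_const, ker_integral hε, one_mul]; rfl
  rw [e, ← Real.norm_eq_abs]
  refine (norm_integral_le_of_norm_le ((ker_int hε).mul_const κ) (Eventually.of_forall fun y => ?_)).trans ?_
  · rw [norm_mul, Real.norm_of_nonneg (ker_nonneg hε y)]
    rcases lt_or_ge ‖y‖ ε with hy | hy
    · exact mul_le_mul_of_nonneg_left (h y hy) (ker_nonneg hε y)
    · rw [ker_zero hε hy]; simp
  · rw [integral_mul_const, ker_integral hε, one_mul]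

lemma mr_submean {m : Cn n → ℝ} (hm : Continuous m) {ε : ℝ} (hε : 0 < ε) {z X : Cn n} {r : ℝ}
    (h : ∀ y, ‖y‖ < ε → m (z - y) ≤ (1 / (2 * Real.pi)) * ∫ θ in (0:ℝ)..(2 * Real.pi),
      m (z - y + ((r : ℂ) * Complex.exp (θ * I)) • X)) :
    mr ε m z ≤ (1 / (2 * Real.pi)) * ∫ θ in (0:ℝ)..(2 * Real.pi), mr ε m (z + ((r : ℂ) * Complex.exp (θ * I)) • X) := by
  have hpi := Real.two_pi_pos
  obtain ⟨C, hC⟩ := (isCompact_closedBall z (|r| * ‖X‖ + ε)).exists_bound_of_continuousOn hm.continuousOn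
  have hF : Integrable (Function.uncurry fun (θ : ℝ) (y : Cn n) => ker ε y * m (z + ((r : ℂ) * Complex.exp (θ * I)) • X - y))
      ((volume.restrict (Ioc 0 (2 * Real.pi))).prod volume) := by
    have hd : Integrable (fun p : ℝ × Cn n => (C : ℝ) * ker ε p.2) ((volume.restrict (Ioc 0 (2 * Real.pi))).prod volume) :=
      Integrable.mul_prod (f := fun _ : ℝ => C) (integrable_const _) (ker_int hε)
    refine hd.mono' ?_ (Eventually.of_forall fun ⟨θ, y⟩ => ?_)
    · have := (ker_smooth (n := n) ε).continuous
      exact Continuous.aestronglyMeasurable (by unfold Function.uncurry; fun_prop)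
    · simp only [Function.uncurry]
      rw [norm_mul, Real.norm_of_nonneg (ker_nonneg hε y), mul_comm]
      rcases lt_or_ge ‖y‖ ε with hy | hy
      · refine mul_le_mul_of_nonneg_right (hC _ ?_) (ker_nonneg hε y)
        rw [mem_closedBall, dist_eq_norm]
        rw [show z + ((r : ℂ) * Complex.exp (θ * I)) • X - y - z = ((r : ℂ) * Complex.exp (θ * I)) • X - y by abel]
        refine (norm_sub_le _ _).trans (add_le_add (le_of_eq ?_) hy.le)
        rw [norm_smul, norm_mul, norm_exp_ofReal_mul_I, norm_real, mul_one]; rfl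
      · rw [ker_zero hε hy]; simp
  have sw : ∫ θ in (0:ℝ)..(2 * Real.pi), mr ε m (z + ((r : ℂ) * Complex.exp (θ * I)) • X) =
      ∫ y, ker ε y * ∫ θ in (0:ℝ)..(2 * Real.pi), m (z - y + ((r : ℂ) * Complex.exp (θ * I)) • X) := by
    rw [intervalIntegral.integral_of_le hpi.le]
    simp only [mr]
    rw [integral_integral_swap hF]
    refine integral_congr_ae (Eventually.of_forall fun y => ?_)
    simp only
    rw [intervalIntegral.integral_of_le hpi.le, integral_const_mul]
    simp_rw [sub_add_eq_add_sub]
  rw [sw, ← integral_const_mul]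
  have hi := hF.integral_prod_right
  refine integral_mono_ae (mr_int hm hε z) ?_ (Eventually.of_forall fun y => ?_)
  · refine (hi.const_mul (1 / (2 * Real.pi))).congr (Eventually.of_forall fun y => ?_)
    simp only [Function.uncurry]
    rw [integral_const_mul, intervalIntegral.integral_of_le hpi.le]
    simp_rw [sub_add_eq_add_sub]
  · simp only
    rw [mul_left_comm]
    rcases lt_or_ge ‖y‖ ε with hy | hy
    · exact mul_le_mul_of_nonneg_left (h y hy) (ker_nonneg hε y)
    · rw [ker_zero hε hy]; simp

lemma log_lip {η x y : ℝ} (hη : 0 < η) (hx : η ≤ x) (hy : η ≤ y) : |Real.log x - Real.log y| ≤ |x - y| / η := by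
  wlog h : y ≤ x generalizing x y
  · rw [abs_sub_comm, abs_sub_comm x]; exact this hy hx (le_of_not_ge h)
  have hy0 : 0 < y := hη.trans_le hy
  have hx0 : 0 < x := hη.trans_le hx
  rw [abs_of_nonneg (sub_nonneg.2 (Real.log_le_log hy0 h)), abs_of_nonneg (sub_nonneg.2 h), ← Real.log_div hx0.ne' hy0.ne']
  refine (Real.log_le_sub_one_of_pos (div_pos hx0 hy0)).trans ?_
  rw [div_sub_one hy0.ne']
  exact div_le_div_of_nonneg_left (sub_nonneg.2 h) hη hy

lemma pseudo_exh {Ω : Set (Cn n)} (hΩ : IsPseudoconvex Ω) (hne : Ωᶜ.Nonempty) : Exh Ω := by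
  intro K hK hKΩ
  obtain ⟨hop, -, hps⟩ := hΩ
  set d : Cn n → ℝ := fun z => infDist z Ωᶜ with hd
  have dc : Continuous d := continuous_infDist_pt _
  have d0 : ∀ z, 0 ≤ d z := fun z => infDist_nonneg
  have dpos : ∀ z ∈ Ω, 0 < d z := fun z hz => (hop.isClosed_compl.notMem_iff_infDist_pos hne).1 (by simpa using hz)
  have dmem : ∀ z, 0 < d z → z ∈ Ω := fun z hz => by
    by_contra h
    have : d z = 0 := infDist_zero_of_mem (by simpa using h)
    linarith
  have dl : ∀ x y, |d x - d y| ≤ ‖x - y‖ := fun x y => by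
    have := (lipschitz_infDist_pt Ωᶜ).dist_le_mul x y
    simpa [Real.dist_eq, dist_eq_norm] using this
  have hcK : ContinuousOn (fun z => - Real.log (d z) + ‖z‖ ^ 2) K :=
    ((dc.continuousOn.log (fun z hz => (dpos z (hKΩ hz)).ne')).neg).add (by fun_prop)
  obtain ⟨C, hC⟩ := hK.exists_bound_of_continuousOn hcK
  set A := C + 1 with hA
  obtain ⟨η, hη, hη1, hηA⟩ : ∃ η : ℝ, 0 < η ∧ η ≤ 1 ∧ A + 4 < - Real.log (2 * η) := by
    refine ⟨min 1 (Real.exp (-(A + 5)) / 2), by positivity, min_le_left _ _, ?_⟩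
    have : Real.log (2 * min 1 (Real.exp (-(A + 5)) / 2)) ≤ Real.log (Real.exp (-(A+5))) := by
      refine Real.log_le_log (by positivity) ?_
      have := min_le_right 1 (Real.exp (-(A + 5)) / 2)
      linarith
    rw [Real.log_exp] at this; linarith
  set m : Cn n → ℝ := fun z => - Real.log (max (d z) η) with hm
  have hM : ∀ z, η ≤ max (d z) η := fun z => le_max_right _ _
  have mc : Continuous m := ((dc.max continuous_const).log (fun z => (hη.trans_le (hM z)).ne')).neg
  set ε := η / 2 with hε
  have hε0 : 0 < ε := by positivity
  have near : ∀ z, |mr ε m z - m z| ≤ 1 / 2 := fun z => mr_near mc hε0 fun y hy => by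
    simp only [hm]
    rw [neg_sub_neg]
    refine (log_lip hη (hM _) (hM _)).trans ?_
    rw [div_le_iff₀ hη]
    have h1 : |max (d z) η - max (d (z - y)) η| ≤ |d z - d (z-y)| := by
      have := abs_max_sub_max_le_abs (d z) (d (z-y)) η; exact this
    have h2 := dl z (z - y)
    rw [sub_sub_cancel] at h2
    linarith
  have ms := mr_smooth mc hε0
  have h2 : (2:WithTop ℕ∞) ≤ ((⊤:ℕ∞) : WithTop ℕ∞) := WithTop.coe_le_coe.2 le_top
  have nsm : ContDiff ℝ ∞ (fun z : Cn n => ‖z - 0‖ ^ 2) := (contDiff_id.sub contDiff_const).norm_sq ℝ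
  have big : ∀ z, mr ε m z + ‖z - 0‖ ^ 2 - A ≤ 3 → 2 * η < d z := by
    intro z hz
    by_contra hcon
    push Not at hcon
    have h1 := abs_le.1 (near z)
    have h3 : - Real.log (2 * η) ≤ m z := by
      simp only [hm]
      exact neg_le_neg (Real.log_le_log (hη.trans_le (hM z)) (max_le hcon (by linarith)))
    have := sq_nonneg ‖z - 0‖
    linarith [h1.1]
  refine ⟨fun z => mr ε m z + ‖z - 0‖ ^ 2 - A, (ms.add nsm).sub contDiff_const, ?_, ?_, ?_, ?_⟩
  · intro z hz
    have h1 := abs_le.1 (near z)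
    have h3 := (le_abs_self _).trans (hC z hz)
    have h4 : m z ≤ - Real.log (d z) := neg_le_neg (Real.log_le_log (dpos z (hKΩ hz)) (le_max_left _ _))
    simp only [sub_zero]
    linarith [h1.2]
  · refine Metric.isCompact_of_isClosed_isBounded
      (isClosed_le ((ms.add nsm).sub contDiff_const).continuous continuous_const) ?_
    refine (Metric.isBounded_closedBall (x := (0 : Cn n)) (r := A + 4 + d 0 + 1 + 1)).subset fun z hz => ?_
    rw [mem_closedBall, dist_zero_right]
    simp only [mem_ofPred_eq, sub_zero] at hz
    have h1 := abs_le.1 (near z)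
    have h3 : Real.log (max (d z) η) ≤ max (d z) η := Real.log_le_self (hη.le.trans (hM z))
    have h4 : d z ≤ d 0 + ‖z‖ := by have := (abs_le.1 (dl z 0)).2; rw [sub_zero] at this; linarith
    have h5 : max (d z) η ≤ d 0 + ‖z‖ + 1 := max_le (by linarith) (by linarith [d0 0, norm_nonneg z])
    have h6 : m z = - Real.log (max (d z) η) := rfl
    by_contra hcon
    push Not at hcon
    have hA4 : 0 ≤ A + 4 + d 0 + 1 ∨ A + 4 + d 0 + 1 < 0 := le_or_gt _ _
    rcases hA4 with h | h
    · nlinarith [h1.1, d0 0, norm_nonneg z]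
    · nlinarith [h1.1, d0 0, norm_nonneg z, sq_nonneg (‖z‖ - 1)]
  · intro z hz
    have := big z hz
    exact dmem z (by linarith)
  · intro z hz X
    have hb := big z hz
    rw [levi_sub_const, levi_add (ms.of_le h2) (nsm.of_le h2), levi_normsq]
    refine le_add_of_nonneg_left ?_
    refine levi_nonneg_of_submean (ms.of_le h2) z X (r₀ := η / 2 / (‖X‖ + 1)) (by positivity) fun r hr hr1 => ?_
    refine mr_submean mc hε0 fun y hy => ?_
    have hrX : r * ‖X‖ < η / 2 := by
      rw [lt_div_iff₀ (by positivity)] at hr1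
      nlinarith
    have hin : ∀ l : ℂ, ‖l‖ ≤ r → η < d (z - y + l • X) := by
      intro l hl
      have h1 := (abs_le.1 (dl (z - y + l • X) z)).1
      have e : z - y + l • X - z = l • X - y := by abel
      have h3 := norm_sub_le (l • X) y
      rw [norm_smul] at h3
      have h4 : ‖l‖ * ‖X‖ ≤ r * ‖X‖ := by gcongr
      rw [e] at h1
      linarith
    have hz0 : η < d (z - y) := by simpa using hin 0 (by simpa using hr.le)
    have mm : ∀ w, η < d w → m w = - Real.log (infDist w Ωᶜ) := fun w hw => by
      simp only [hm]; rw [max_eq_left hw.le]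
    have := hps (z - y) (dmem _ (hη.trans hz0)) X r hr (fun l hl => dmem _ (hη.trans (hin l hl)))
    rw [mm _ hz0]
    refine this.trans (le_of_eq ?_)
    congr 1
    refine intervalIntegral.integral_congr fun θ _ => ?_
    rw [mm _ (hin _ ?_)]
    rw [norm_mul, norm_exp_ofReal_mul_I, norm_real, Real.norm_of_nonneg hr.le, mul_one]

end Loc
end

section
namespace Loc
open Filter Topology ContDiff ComplexConjugate Complex

lemma contDiff_cut {W : Set (Cn n)} (hW : IsOpen W) {ρ : Cn n → ℝ} (hρ : ContDiffOn ℝ 2 ρ W) {Θ : Cn n → ℝ}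
    (hΘ : ContDiff ℝ ∞ Θ) (hs : tsupport Θ ⊆ W) : ContDiff ℝ 2 (fun w => Θ w * ρ w) := by
  rw [contDiff_iff_contDiffAt]
  intro x
  by_cases hx : x ∈ W
  · exact (hΘ.of_le (WithTop.coe_le_coe.2 le_top)).contDiffAt.mul (hρ.contDiffAt (hW.mem_nhds hx))
  · have h0 : Θ =ᶠ[𝓝 x] 0 := notMem_tsupport_iff_eventuallyEq.1 fun h => hx (hs h)
    refine (contDiffAt_const (c := (0:ℝ))).congr_of_eventuallyEq ?_
    filter_upwards [h0] with y hy
    rw [hy]; simp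

lemma D2_quad {ρ : Cn n → ℝ} (hρ : ContDiff ℝ 2 ρ) {p : Cn n} (hp : ρ p = 0) (K : ℝ) (X : Cn n) :
    fderiv ℝ (fun w => fderiv ℝ (fun w => ρ w + K * ρ w ^ 2) w X) p X =
      fderiv ℝ (fun w => fderiv ℝ ρ w X) p X + 2 * K * (fderiv ℝ ρ p X) ^ 2 := by
  have hd : ∀ w, HasFDerivAt ρ (fderiv ℝ ρ w) w := fun w => (hρ.differentiable (by simp) w).hasFDerivAt
  have e : (fun w => fderiv ℝ (fun w => ρ w + K * ρ w ^ 2) w X) =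
      fun w => fderiv ℝ ρ w X + (2 * K * ρ w) * fderiv ℝ ρ w X := by
    ext w
    rw [((hd w).fun_add (((hd w).pow 2).const_mul K)).fderiv]
    simp; ring
  rw [e]
  have h1 := (fderiv_apply_diff hρ p X).hasFDerivAt
  have h2 := h1.fun_add ((((hd p).const_mul (2 * K))).fun_mul h1)
  rw [h2.fderiv]
  simp [hp]; ring

lemma cover_aux {S : Set (Cn n)} (hS : IsCompact S) {f g : Cn n → ℝ} (hf : Continuous f) (hg : Continuous g)
    (g0 : ∀ x, 0 ≤ g x) (h : ∀ x ∈ S, g x = 0 → 0 < f x) : ∃ K : ℕ, ∀ x ∈ S, 0 < f x + K * g x := by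
  refine hS.elim_directed_cover (fun K : ℕ => {x | 0 < f x + K * g x})
    (fun K => isOpen_lt continuous_const (by fun_prop)) ?_ ?_
  · intro x hx
    rw [mem_iUnion]
    rcases (g0 x).eq_or_lt with h0 | h0
    · exact ⟨0, show 0 < f x + _ by simpa using h x hx h0.symm⟩
    · obtain ⟨K, hK⟩ := exists_nat_gt (-f x / g x)
      refine ⟨K, show 0 < f x + K * g x from ?_⟩
      rw [div_lt_iff₀ h0] at hK; linarith
  · refine Monotone.directed_le fun a b hab x hx => ?_
    have hx : 0 < f x + a * g x := hx
    show 0 < f x + b * g x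
    have : (a:ℝ) ≤ b := by exact_mod_cast hab
    nlinarith [g0 x]

lemma norm_rho {Ω : Set (Cn n)} (hop : IsOpen Ω) {p : Cn n} (hp : IsStrictPscPtC2 Ω p) :
    ∃ u : Cn n → ℝ, ContDiff ℝ 2 u ∧ u p = 0 ∧ ∃ r > 0, (∀ w ∈ ball p r, (w ∈ Ω ↔ u w < 0)) ∧
      (∀ q ∈ frontier Ω ∩ ball p r, u q = 0) ∧ ∃ c > 0, ∀ X, c * ‖X‖ ^ 2 ≤ leviForm u p X := by
  obtain ⟨hpf, W, hW, hpW, ρ, hρ, hΩ, -, hL⟩ := hp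
  obtain ⟨Θ, hΘ, -, hs, -, h1⟩ := exists_cutoff (isCompact_singleton (x := p)) hW (by simpa using hpW)
  rw [nhdsSet_singleton] at h1
  set ρ1 : Cn n → ℝ := fun w => Θ w * ρ w with hρ1
  have c1 : ContDiff ℝ 2 ρ1 := contDiff_cut hW hρ hΘ hs
  have ev : ρ1 =ᶠ[𝓝 p] ρ := by filter_upwards [h1] with w hw; simp [hρ1, hw]
  have evm : ∀ᶠ w in 𝓝 p, (w ∈ Ω ↔ ρ1 w < 0) := by
    filter_upwards [ev, hW.mem_nhds hpW] with w hw hwW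
    rw [hw]
    have := Set.ext_iff.1 hΩ w
    simp only [mem_inter_iff, hwW, and_true] at this
    rw [this]
    exact ⟨fun h => h.2, fun h => ⟨hwW, h⟩⟩
  have frz : ∀ (u : Cn n → ℝ) r, Continuous u → (∀ w ∈ ball p r, (w ∈ Ω ↔ u w < 0)) → ∀ q ∈ frontier Ω ∩ ball p r, u q = 0 := by
    rintro u r hu h q ⟨hq, hqr⟩
    rw [hop.frontier_eq] at hq
    apply le_antisymm
    · by_contra hc
      push Not at hc
      obtain ⟨w, ⟨hw1, hw2⟩, hw3⟩ := mem_closure_iff.1 hq.1 (ball p r ∩ {w | 0 < u w})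
        (isOpen_ball.inter (isOpen_lt continuous_const hu)) ⟨hqr, hc⟩
      have := (h w hw1).1 hw3
      have hw2 : 0 < u w := hw2
      linarith
    · by_contra hc
      push Not at hc
      exact hq.2 ((h q hqr).2 hc)
  obtain ⟨r1, hr1, hb1⟩ := Metric.eventually_nhds_iff_ball.1 evm
  have hp0 : ρ1 p = 0 := frz ρ1 r1 c1.continuous hb1 p ⟨hpf, mem_ball_self hr1⟩
  set D := fderiv ℝ ρ1 p with hD
  have fD : fderiv ℝ ρ p = D := ev.fderiv_eq.symm
  have Lc : Continuous (fun X => leviForm ρ1 p X) := by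
    simp_rw [levi_H c1]; fun_prop
  have IS : Continuous (fun X : Cn n => D (I • X)) := D.continuous.comp (continuous_const_smul I)
  obtain ⟨K, hK⟩ := cover_aux (isCompact_sphere (0 : Cn n) 1) Lc (g := fun X => (D X ^ 2 + D (I • X) ^ 2) / 2)
    (by fun_prop) (fun X => by positivity) (fun X hX h => by
      have hX0 : X ≠ 0 := by rintro rfl; simp at hX
      rw [levi_congr ev]
      refine hL p ⟨hpf, hpW⟩ X hX0 ?_
      have a1 : D X = 0 := by nlinarith [sq_nonneg (D X), sq_nonneg (D (I • X))]
      have a2 : D (I • X) = 0 := by nlinarith [sq_nonneg (D X), sq_nonneg (D (I • X))]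
      simp [_root_.cderiv, fD, a1, a2])
  set u : Cn n → ℝ := fun w => ρ1 w + K * ρ1 w ^ 2 with hu
  have cu : ContDiff ℝ 2 u := c1.add (contDiff_const.mul (c1.pow 2))
  have lu : ∀ X, leviForm u p X = leviForm ρ1 p X + K * ((D X ^ 2 + D (I • X) ^ 2) / 2) := by
    intro X
    unfold leviForm
    rw [D2_quad c1 hp0, D2_quad c1 hp0]; ring
  obtain ⟨c, hc, hcS⟩ := (isCompact_sphere (0 : Cn n) 1).exists_forall_le' (f := fun X => leviForm u p X) (a := 0)
    (by simp_rw [levi_H cu]; fun_prop) (fun X hX => by rw [lu]; exact hK X hX)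
  have sm : ∀ᶠ w in 𝓝 p, K * |ρ1 w| < 1 := by
    have : Continuous fun w => K * |ρ1 w| := by have := c1.continuous; fun_prop
    refine this.continuousAt.eventually_lt_const ?_
    simp [hp0]
  obtain ⟨r2, hr2, hb2⟩ := Metric.eventually_nhds_iff_ball.1 (evm.and sm)
  have iff2 : ∀ w ∈ ball p r2, (w ∈ Ω ↔ u w < 0) := by
    intro w hw
    obtain ⟨h1, h2⟩ := hb2 w hw
    rw [h1]
    have e : u w = ρ1 w * (1 + K * ρ1 w) := by simp only [hu]; ring
    have h3 := neg_abs_le (ρ1 w)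
    have hK0 : (0:ℝ) ≤ K := by positivity
    have h4 : 0 < 1 + K * ρ1 w := by nlinarith
    rw [e]
    constructor
    · intro h; exact mul_neg_of_neg_of_pos h h4
    · intro h; by_contra h5; push Not at h5; linarith [mul_nonneg h5 h4.le]
  refine ⟨u, cu, by simp [hu, hp0], r2, hr2, iff2, frz u r2 cu.continuous iff2, c, hc, fun X => ?_⟩
  by_cases hX : X = 0
  · subst hX; simp [levi_H cu]
  have nX : 0 < ‖X‖ := norm_pos_iff.2 hX
  have := hcS ((‖X‖⁻¹ : ℝ) • X) (by simp [norm_smul, nX.ne'])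
  rw [levi_H cu, smul_comm] at this
  simp only [map_smul, smul_apply, smul_eq_mul] at this
  rw [levi_H cu]
  set A := fderiv ℝ (fderiv ℝ u) p X X
  set B := fderiv ℝ (fderiv ℝ u) p (I • X) (I • X)
  have e : (‖X‖⁻¹ * (‖X‖⁻¹ * A) + ‖X‖⁻¹ * (‖X‖⁻¹ * B)) / 4 = ((A + B) / 4) / ‖X‖ ^ 2 := by field_simp
  rw [e, le_div_iff₀ (by positivity)] at this
  exact this

end Loc
end

section
namespace Loc
open Filter Topology ContDiff ComplexConjugate Complex

lemma lin_diff (l : Cn n →ₗ[ℂ] ℂ) : Differentiable ℂ (fun v => l v) :=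
  (LinearMap.toContinuousLinearMap l).differentiable

def lC (D : Cn n →L[ℝ] ℝ) : Cn n →ₗ[ℂ] ℂ where
  toFun v := (D v : ℂ) - I * (D (I • v) : ℂ)
  map_add' x y := by simp only [smul_add, map_add, ofReal_add]; ring
  map_smul' a v := by
    have e : a • v = a.re • v + a.im • (I • v) := by
      conv_lhs => rw [← re_add_im a]
      rw [add_smul, mul_smul]; rfl
    have e2 : I • a • v = a.re • (I • v) - a.im • v := by
      rw [e, smul_add, smul_comm I, smul_comm I, smul_smul I I, I_mul_I, neg_one_smul, smul_neg, sub_eq_add_neg]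
    rw [e2, e]
    simp only [map_add, map_sub, map_smul, smul_eq_mul, ofReal_add, ofReal_sub, ofReal_mul, RingHom.id_apply]
    conv_rhs => rw [← re_add_im a]
    linear_combination ((a.im : ℂ)) * (D (I • v) : ℂ) * I_sq

lemma lC_apply (D : Cn n →L[ℝ] ℝ) (v : Cn n) : lC D v = (D v : ℂ) - I * (D (I • v) : ℂ) := rfl

lemma lC_add (D E : Cn n →L[ℝ] ℝ) (v : Cn n) : lC (D + E) v = lC D v + lC E v := by
  simp only [lC_apply, add_apply, ofReal_add]; ring

lemma lC_smul (a : ℝ) (D : Cn n →L[ℝ] ℝ) (v : Cn n) : lC (a • D) v = a * lC D v := by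
  simp only [lC_apply, smul_apply, smul_eq_mul, ofReal_mul]; ring

/-- the complex quadratic form attached to a symmetric real bilinear form -/
def QQ (H : Cn n →L[ℝ] Cn n →L[ℝ] ℝ) (v : Cn n) : ℂ := (lC (H v) v - I * lC (H (I • v)) v) / 2

lemma QQ_re (H : Cn n →L[ℝ] Cn n →L[ℝ] ℝ) (v : Cn n) : (QQ H v).re = (H v v - H (I • v) (I • v)) / 2 := by
  simp [QQ, lC_apply]

lemma QQ_diff (H : Cn n →L[ℝ] Cn n →L[ℝ] ℝ) : Differentiable ℂ (QQ H) := by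
  have e : ∀ v : Cn n, QQ H v = ∑ j, v j * ((lC (H (ee j)) v - I * lC (H (I • ee j)) v) / 2) := by
    intro v
    have e2 : I • v = ∑ j, ((v j).re • (I • ee j) - (v j).im • (ee j : Cn n)) := by
      conv_lhs => rw [vec_expand v]
      rw [Finset.smul_sum]
      refine Finset.sum_congr rfl fun j _ => ?_
      rw [smul_add, smul_comm I, smul_comm I, smul_smul I I, I_mul_I, neg_one_smul, smul_neg, sub_eq_add_neg]
    have L1 : ∀ Y : Cn n, lC (H Y) v = (H Y v : ℂ) - I * (H Y (I • v) : ℂ) := fun Y => rfl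
    have ex : ∀ w : Cn n, (H v w : ℂ) = ∑ j, (((v j).re : ℂ) * H (ee j) w + ((v j).im : ℂ) * H (I • ee j) w) := by
      intro w
      conv_lhs => rw [vec_expand v]
      simp only [map_sum, map_add, map_smul, sum_apply, add_apply, smul_apply, smul_eq_mul]
      push_cast; rfl
    have ex2 : ∀ w : Cn n, (H (I • v) w : ℂ) = ∑ j, (((v j).re : ℂ) * H (I • ee j) w - ((v j).im : ℂ) * H (ee j) w) := by
      intro w
      conv_lhs => rw [e2]
      simp only [map_sum, map_sub, map_smul, sum_apply, sub_apply, smul_apply, smul_eq_mul]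
      push_cast; rfl
    unfold QQ
    simp only [L1]
    rw [ex, ex, ex2, ex2]
    simp only [Finset.mul_sum, ← Finset.sum_sub_distrib, Finset.sum_div]
    refine Finset.sum_congr rfl fun j _ => ?_
    conv_rhs => rw [← re_add_im (v j)]
    ring_nf
    simp only [I_sq, show I ^ 3 = - I by rw [pow_succ, I_sq]; ring]
    ring
  rw [show QQ H = _ from funext e]
  refine Differentiable.fun_sum fun j _ => Differentiable.fun_mul ?_ ?_
  · exact (EuclideanSpace.proj (𝕜 := ℂ) j : Cn n →L[ℂ] ℂ).differentiable
  · simp_rw [div_eq_mul_inv]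
    exact ((lin_diff _).fun_sub ((lin_diff _).const_mul I)).mul_const _

lemma lC_norm (D : Cn n →L[ℝ] ℝ) (v : Cn n) : ‖lC D v‖ ≤ 2 * ‖D‖ * ‖v‖ := by
  have h1 := D.le_opNorm v
  have h2 := D.le_opNorm (I • v)
  rw [norm_smul, norm_I, one_mul] at h2
  refine (norm_sub_le _ _).trans ?_
  rw [norm_mul, norm_I, one_mul, norm_real, norm_real]
  linarith

lemma QQ_norm (H : Cn n →L[ℝ] Cn n →L[ℝ] ℝ) (v : Cn n) : ‖QQ H v‖ ≤ 2 * ‖H‖ * ‖v‖ ^ 2 := by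
  have a1 := lC_norm (H v) v
  have a2 := lC_norm (H (I • v)) v
  have h1 := H.le_opNorm v
  have h2 := H.le_opNorm (I • v)
  rw [norm_smul, norm_I, one_mul] at h2
  have h3 := norm_sub_le (lC (H v) v) (I * lC (H (I • v)) v)
  rw [norm_mul, norm_I, one_mul] at h3
  rw [QQ, norm_div, Complex.norm_ofNat, div_le_iff₀ (by norm_num)]
  nlinarith [norm_nonneg v, norm_nonneg (H v), norm_nonneg (H (I • v))]

lemma peak {u : Cn n → ℝ} (hu : ContDiff ℝ 2 u) {p : Cn n} {c : ℝ} (hc : 0 < c)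
    (hL : ∀ X, c * ‖X‖ ^ 2 ≤ leviForm u p X) : ∃ r > 0, ∃ L > 0, ∀ q ∈ ball p r, u q = 0 →
      ∃ P : Cn n → ℂ, Differentiable ℂ P ∧ (∀ w ∈ ball p r, (P w).re ≤ u w - c / 2 * ‖w - q‖ ^ 2) ∧
        ∀ w ∈ ball p r, ‖P w‖ ≤ L * ‖w - q‖ := by
  obtain ⟨δ, hδ, hcl⟩ := D2_close hu p hc
  have hD : Continuous (fderiv ℝ u) := hu.continuous_fderiv (by simp)
  obtain ⟨C, hC⟩ := (isCompact_closedBall p 1).exists_bound_of_continuousOn hD.continuousOn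
  set H := fderiv ℝ (fderiv ℝ u) p with hH
  have C0 : 0 ≤ C := (norm_nonneg _).trans (hC p (mem_closedBall_self zero_le_one))
  refine ⟨min δ 1, by positivity, 2 * C + 2 * ‖H‖ + 1, by positivity, fun q hq hq0 => ?_⟩
  have hqδ : q ∈ ball p δ := ball_subset_ball (min_le_left _ _) hq
  have hq1 : q ∈ ball p 1 := ball_subset_ball (min_le_right _ _) hq
  refine ⟨fun w => lC (fderiv ℝ u q) (w - q) + QQ H (w - q) / 2, ?_, fun w hw => ?_, fun w hw => ?_⟩
  · simp_rw [div_eq_mul_inv]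
    exact ((lin_diff _).comp (differentiable_id.sub_const q)).add
      (((QQ_diff H).comp (differentiable_id.sub_const q)).mul_const _)
  · have hwδ : w ∈ ball p δ := ball_subset_ball (min_le_left _ _) hw
    obtain ⟨ξ, hξ, e⟩ := taylor2 hu q (w - q)
    rw [add_sub_cancel, hq0, zero_add] at e
    set v := w - q with hv
    have hin : q + ξ • v ∈ ball p δ :=
      (convex_ball p δ).add_smul_sub_mem hqδ hwδ ⟨hξ.1.le, hξ.2.le⟩
    have h1 := (abs_le.1 (hcl _ hin v)).1
    have h2 := hL v
    rw [levi_H hu] at h2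
    have e3 : (lC (fderiv ℝ u q) v + QQ H v / 2).re = fderiv ℝ u q v + (H v v - H (I • v) (I • v)) / 4 := by
      have : (QQ H v / 2).re = (QQ H v).re / 2 := by simp
      rw [add_re, this, QQ_re, lC_apply]; simp; ring
    rw [e3, e]
    linarith
  · have hw1 : w ∈ ball p 1 := ball_subset_ball (min_le_right _ _) hw
    set v := w - q with hv
    have hv2 : ‖v‖ ≤ 2 := by
      have := dist_triangle_right w q p
      rw [dist_eq_norm w q] at this
      rw [mem_ball] at hw1 hq1
      linarith
    have a1 := lC_norm (fderiv ℝ u q) v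
    have a2 := QQ_norm H v
    have a3 := hC q (ball_subset_closedBall hq1)
    refine (norm_add_le _ _).trans ?_
    rw [norm_div, Complex.norm_ofNat]
    have a4 : 2 * ‖fderiv ℝ u q‖ * ‖v‖ ≤ 2 * C * ‖v‖ := by gcongr
    have a5 : 2 * ‖H‖ * ‖v‖ ^ 2 ≤ 2 * ‖H‖ * (2 * ‖v‖) := by rw [pow_two]; gcongr
    nlinarith [norm_nonneg v]

end Loc
end

section
namespace Loc
open Filter Topology ContDiff ComplexConjugate Complex

lemma levi_near {u : Cn n → ℝ} (hu : ContDiff ℝ 2 u) {p : Cn n} {c : ℝ} (hc : 0 < c)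
    (hL : ∀ X, c * ‖X‖ ^ 2 ≤ leviForm u p X) : ∃ r > 0, ∀ w ∈ ball p r, ∀ X, c / 2 * ‖X‖ ^ 2 ≤ leviForm u w X := by
  obtain ⟨δ, hδ, hcl⟩ := D2_close hu p hc
  refine ⟨δ, hδ, fun w hw X => ?_⟩
  have h1 := (abs_le.1 (hcl w hw X)).1
  have h2 := (abs_le.1 (hcl w hw (I • X))).1
  have h3 := hL X
  rw [norm_smul, norm_I, one_mul] at h2
  rw [levi_H hu] at h3 ⊢
  linarith

lemma levi_zero (z X : Cn n) : leviForm (fun _ => 0) z X = 0 := by simp [leviForm]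

lemma weight {Ω : Set (Cn n)} (hop : IsOpen Ω) {u : Cn n → ℝ} (hu : ContDiff ℝ 2 u) {p : Cn n} {c r₀ : ℝ} (hc : 0 < c)
    (hup : u p = 0) (hr₀ : 0 < r₀) (hneg : ∀ w ∈ ball p r₀, w ∈ Ω → u w < 0)
    (hL : ∀ X, c * ‖X‖ ^ 2 ≤ leviForm u p X) : ∃ (φ : Cn n → ℝ) (M c' r : ℝ), ContDiff ℝ 2 φ ∧ (∀ z, 0 ≤ φ z) ∧
      (∀ z, φ z ≤ M) ∧ 0 < c' ∧ 0 < r ∧ (∀ z ∈ Ω, ∀ X, 0 ≤ leviForm φ z X) ∧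
      ∀ z ∈ Ω ∩ ball p r, ∀ X, c' * ‖X‖ ^ 2 ≤ leviForm φ z X := by
  obtain ⟨δ, hδ, hn⟩ := levi_near hu hc hL
  set r2 := min δ r₀ with hr2
  have hr20 : 0 < r2 := by positivity
  set r1 := r2 / 2 with hr1
  have hr10 : 0 < r1 := by positivity
  set κ := c / 4 with hκ
  have hκ0 : 0 < κ := by positivity
  set c0 := κ * r1 ^ 2 with hc0
  have hc00 : 0 < c0 := by positivity
  have nsm : ContDiff ℝ 2 (fun z : Cn n => ‖z - p‖ ^ 2) := (contDiff_id.sub contDiff_const).norm_sq ℝ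
  set s : Cn n → ℝ := fun w => u w + (-κ) * ‖w - p‖ ^ 2 - (-c0) with hs
  have ss : ContDiff ℝ 2 s := (hu.add (contDiff_const.mul nsm)).sub contDiff_const
  have sl : ∀ w X, leviForm s w X = leviForm u w X + (-κ) * ‖X‖ ^ 2 := by
    intro w X
    rw [hs, levi_sub_const, levi_add hu (contDiff_const.mul nsm), levi_smul nsm, levi_normsq]
  have slb : ∀ w ∈ ball p r2, ∀ X, κ * ‖X‖ ^ 2 ≤ leviForm s w X := by
    intro w hw X
    have := hn w (ball_subset_ball (min_le_left _ _) hw) X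
    rw [sl, hκ]; linarith
  obtain ⟨ζ, hζ, hζc, hζs, hζ1, hζe⟩ := exists_cutoff (isCompact_closedBall p r1) (isOpen_ball (x := p) (ε := r2))
    (closedBall_subset_ball (by linarith))
  set φ : Cn n → ℝ := fun w => ζ w * pp (s w) with hφ
  have cφ : ContDiff ℝ 2 φ := (hζ.of_le (WithTop.coe_le_coe.2 le_top)).mul (pp_contDiff.comp ss)
  have pp0 : ∀ x, 0 ≤ pp x := fun x => by unfold pp; positivity
  have φc : HasCompactSupport φ := hζc.mul_right
  obtain ⟨M, hM⟩ := cφ.continuous.bounded_above_of_compact_support φc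
  have inner : ∀ z ∈ closedBall p r1, ∀ X, 3 * (max (s z) 0) ^ 2 * (κ * ‖X‖ ^ 2) ≤ leviForm φ z X := by
    intro z hz X
    have e : φ =ᶠ[𝓝 z] fun w => pp (s w) := by
      filter_upwards [hζe.filter_mono (nhds_le_nhdsSet hz)] with w hw
      simp [hφ, hw]
    rw [levi_congr e]
    refine le_trans ?_ (levi_pp_ge ss z X)
    gcongr
    exact slb z (closedBall_subset_ball (by linarith) hz) X
  have nb : ∀ᶠ w in 𝓝 p, -(c0 / 4) < u w ∧ κ * ‖w - p‖ ^ 2 < c0 / 4 := by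
    refine (hu.continuous.continuousAt.eventually_const_lt ?_).and
      ((continuous_const.mul nsm.continuous).continuousAt.eventually_lt_const ?_)
    · rw [hup]; linarith
    · simp; linarith
  obtain ⟨r3, hr3, hb3⟩ := Metric.eventually_nhds_iff_ball.1 nb
  refine ⟨φ, M, 3 * (c0 / 2) ^ 2 * κ, min r3 r1, cφ, fun z => mul_nonneg (hζ1 z).1 (pp0 _),
    fun z => (le_abs_self _).trans (hM z), by positivity, by positivity, ?_, ?_⟩
  · intro z hz X
    by_cases h1 : z ∈ closedBall p r1
    · exact le_trans (by positivity) (inner z h1 X)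
    · have : φ =ᶠ[𝓝 z] fun _ => 0 := by
        by_cases h2 : z ∈ ball p r2
        · filter_upwards [hop.mem_nhds hz, isOpen_ball.mem_nhds h2, isClosed_closedBall.isOpen_compl.mem_nhds h1] with w a1 a2 a3
          have b1 := hneg w (ball_subset_ball (min_le_right _ _) a2) a1
          have b2 : r1 < ‖w - p‖ := by
            simpa [dist_eq_norm] using a3
          have b3 : r1 ^ 2 ≤ ‖w - p‖ ^ 2 := by gcongr
          have b4 : s w ≤ 0 := by
            simp only [hs, hc0]; nlinarith
          simp [hφ, pp, max_eq_right b4]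
        · filter_upwards [notMem_tsupport_iff_eventuallyEq.1 fun h => h2 (hζs h)] with w hw
          simp [hφ, hw]
      rw [levi_congr this, levi_zero]
  · rintro z ⟨-, hz⟩ X
    have h1 : z ∈ closedBall p r1 := ball_subset_closedBall (ball_subset_ball (min_le_right _ _) hz)
    obtain ⟨a1, a2⟩ := hb3 z (ball_subset_ball (min_le_left _ _) hz)
    refine le_trans ?_ (inner z h1 X)
    have : c0 / 2 ≤ max (s z) 0 := by
      refine le_trans ?_ (le_max_left _ _)
      simp only [hs]; linarith
    rw [mul_assoc]
    gcongr

lemma geom {Ω : Set (Cn n)} (hop : IsOpen Ω) {p : Cn n} (hp : IsStrictPscPtC2 Ω p) {R : ℝ} (hR : 0 < R) :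
    ∃ (φ : Cn n → ℝ) (M c' r L c : ℝ), 0 < r ∧ r ≤ R ∧ 0 < L ∧ 0 < c ∧ ContDiff ℝ 2 φ ∧ (∀ z, 0 ≤ φ z) ∧
      (∀ z, φ z ≤ M) ∧ 0 < c' ∧ (∀ z ∈ Ω, ∀ X, 0 ≤ leviForm φ z X) ∧
      (∀ z ∈ Ω ∩ ball p r, ∀ X, c' * ‖X‖ ^ 2 ≤ leviForm φ z X) ∧
      ∀ q ∈ frontier Ω ∩ ball p r, ∃ P : Cn n → ℂ, Differentiable ℂ P ∧
        (∀ w ∈ Ω ∩ ball p r, (P w).re ≤ - (c * ‖w - q‖ ^ 2)) ∧ ∀ w ∈ ball p r, ‖P w‖ ≤ L * ‖w - q‖ := by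
  obtain ⟨u, hu, hup, r0, hr0, hiff, hfr, c, hc, hL⟩ := norm_rho hop hp
  obtain ⟨φ, M, c', r1, h1, h2, h3, h4, h5, h6, h7⟩ := weight hop hu hc hup hr0 (fun w hw => (hiff w hw).1) hL
  obtain ⟨r2, hr2, L, hL0, hP⟩ := peak hu hc hL
  have s1 : min (min r0 r1) (min r2 R) ≤ r0 := (min_le_left _ _).trans (min_le_left _ _)
  have s2 : min (min r0 r1) (min r2 R) ≤ r1 := (min_le_left _ _).trans (min_le_right _ _)
  have s3 : min (min r0 r1) (min r2 R) ≤ r2 := (min_le_right _ _).trans (min_le_left _ _)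
  have s4 : min (min r0 r1) (min r2 R) ≤ R := (min_le_right _ _).trans (min_le_right _ _)
  refine ⟨φ, M, c', min (min r0 r1) (min r2 R), L, c / 2, by positivity, s4, hL0, by positivity, h1, h2, h3, h4, h6,
    fun z hz => h7 z ⟨hz.1, ball_subset_ball s2 hz.2⟩, fun q hq => ?_⟩
  obtain ⟨P, p1, p2, p3⟩ := hP q (ball_subset_ball s3 hq.2) (hfr q ⟨hq.1, ball_subset_ball s1 hq.2⟩)
  refine ⟨P, p1, fun w hw => ?_, fun w hw => p3 w (ball_subset_ball s3 hw)⟩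
  have := p2 w (ball_subset_ball s3 hw.2)
  have := (hiff w (ball_subset_ball s1 hw.2)).1 hw.1
  linarith

end Loc
end

section
namespace Loc
open Filter Topology ContDiff ComplexConjugate Complex

lemma hilb2 {E : Type*} [NormedAddCommGroup E] [InnerProductSpace ℂ E] [CompleteSpace E] (S : Submodule ℂ E) (x : E)
    {B : ℝ} (hB : 0 ≤ B) (hb : ∀ s ∈ S, ‖inner ℂ s x‖ ≤ B * ‖s‖) :
    ∃ A : E, (∀ s ∈ S, inner ℂ s A = 0) ∧ ‖A‖ ≤ ‖x‖ ∧ ‖x - A‖ ≤ B := by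
  let T := S.topologicalClosure
  have : CompleteSpace T := S.isClosed_topologicalClosure.completeSpace_coe
  set P := T.starProjection x with hP
  have hPT : P ∈ T := T.starProjection_apply_mem x
  have horth : x - P ∈ Tᗮ := T.sub_starProjection_mem_orthogonal x
  have hoin : ∀ s ∈ T, inner ℂ s (x - P) = 0 := (Submodule.mem_orthogonal _ _).1 horth
  have hcl : ∀ s ∈ T, ‖inner ℂ s x‖ ≤ B * ‖s‖ := by
    intro s hs
    have hclosed : IsClosed {s : E | ‖inner ℂ s x‖ ≤ B * ‖s‖} :=
      isClosed_le ((continuous_id.inner continuous_const).norm) (continuous_const.mul continuous_norm)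
    exact closure_minimal (fun y hy => hb y hy) hclosed hs
  have h0 : inner ℂ P x = inner ℂ P P := by
    have := hoin P hPT
    rw [inner_sub_right, sub_eq_zero] at this; exact this
  have h1 := hcl P hPT
  rw [h0, inner_self_eq_norm_sq_to_K, norm_pow, RCLike.norm_ofReal, abs_norm] at h1
  refine ⟨x - P, fun s hs => hoin s (S.le_topologicalClosure hs), ?_, ?_⟩
  · have h2 : ‖x‖ ^ 2 = ‖x - P‖ ^ 2 + ‖P‖ ^ 2 := by
      have := norm_add_sq_eq_norm_sq_add_norm_sq_of_inner_eq_zero P (x - P) (hoin P hPT)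
      rw [add_sub_cancel] at this
      rw [pow_two, this]; ring
    nlinarith [norm_nonneg x, norm_nonneg (x - P), sq_nonneg ‖P‖]
  · rw [sub_sub_cancel]
    by_contra hc
    push Not at hc
    nlinarith [norm_nonneg P]

lemma Tst.add {Ω : Set (Cn n)} {f g : Cn n → ℂ} (hf : Tst Ω f) (hg : Tst Ω g) : Tst Ω (fun z => f z + g z) :=
  ⟨hf.1.add hg.1, hf.2.1.add hg.2.1, (tsupport_add f g).trans (union_subset hf.2.2 hg.2.2)⟩

lemma Tst.smul {Ω : Set (Cn n)} {f : Cn n → ℂ} (hf : Tst Ω f) (c : ℂ) : Tst Ω (fun z => c * f z) :=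
  ⟨contDiff_const.mul hf.1, hf.2.1.mul_left, (tsupport_mul_subset_right (f := fun _ => c)).trans hf.2.2⟩

lemma Tst.zero {Ω : Set (Cn n)} : Tst Ω (fun _ => (0:ℂ)) :=
  ⟨contDiff_const, HasCompactSupport.zero, by simp [tsupport]⟩

lemma Tst.diff {Ω : Set (Cn n)} {f : Cn n → ℂ} (hf : Tst Ω f) (z : Cn n) : DifferentiableAt ℝ f z :=
  hf.1.differentiable (by simp) z

lemma dbar_add' {f g : Cn n → ℂ} {z : Cn n} (j : Fin n) (hf : DifferentiableAt ℝ f z) (hg : DifferentiableAt ℝ g z) :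
    dbar j (fun w => f w + g w) z = dbar j f z + dbar j g z := by
  simp only [dbar]; rw [fderiv_fun_add hf hg]; simp; ring

lemma dbar_const_mul {f : Cn n → ℂ} {z : Cn n} (j : Fin n) (hf : DifferentiableAt ℝ f z) (c : ℂ) :
    dbar j (fun w => c * f w) z = c * dbar j f z := by
  rw [dbar_mul j (differentiableAt_const c) hf]
  simp [dbar]

/-- the space of divergences -/
def divS (Ω : Set (Cn n)) : Submodule ℂ (Lp ℂ 2 (volume : Measure (Cn n))) where
  carrier := {x | ∃ a : Fin n → Cn n → ℂ, (∀ j, Tst Ω (a j)) ∧ x =ᵐ[volume] fun z => conj (∑ j, dbar j (a j) z)}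
  zero_mem' := ⟨fun _ _ => 0, fun _ => Tst.zero, by
    filter_upwards [Lp.coeFn_zero ℂ 2 (volume : Measure (Cn n))] with z hz
    rw [hz]; simp [dbar]⟩
  add_mem' := by
    rintro x y ⟨a, ha, hx⟩ ⟨b, hb, hy⟩
    refine ⟨fun j z => a j z + b j z, fun j => (ha j).add (hb j), ?_⟩
    filter_upwards [hx, hy, Lp.coeFn_add x y] with z h1 h2 h3
    rw [h3, Pi.add_apply, h1, h2, ← map_add, ← Finset.sum_add_distrib]
    congr 1
    exact Finset.sum_congr rfl fun j _ => (dbar_add' j ((ha j).diff z) ((hb j).diff z)).symm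
  smul_mem' := by
    rintro c x ⟨a, ha, hx⟩
    refine ⟨fun j z => conj c * a j z, fun j => (ha j).smul _, ?_⟩
    filter_upwards [hx, Lp.coeFn_smul c x] with z h1 h3
    rw [h3, Pi.smul_apply, h1, smul_eq_mul]
    simp_rw [dbar_const_mul _ ((ha _).diff z)]
    rw [← Finset.mul_sum, map_mul, conj_conj]

lemma Lp_norm_sq (x : Lp ℂ 2 (volume : Measure (Cn n))) : ‖x‖ₑ ^ 2 = ∫⁻ z, ‖x z‖ₑ ^ 2 := by
  rw [Lp.enorm_def, sq_eLpNorm]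

lemma Lp_norm_sq' (x : Lp ℂ 2 (volume : Measure (Cn n))) : ‖x‖ ^ 2 = ∫ z, ‖x z‖ ^ 2 := by
  have h := L2.inner_def (𝕜 := ℂ) x x
  rw [inner_self_eq_norm_sq_to_K] at h
  have : ∀ z, inner ℂ (x z) (x z) = ((‖x z‖ ^ 2 : ℝ) : ℂ) := by
    intro z; rw [inner_self_eq_norm_sq_to_K]; norm_cast
  simp_rw [this] at h
  rw [integral_complex_ofReal] at h
  have h' : ((‖x‖ ^ 2 : ℝ) : ℂ) = ((∫ z, ‖x z‖ ^ 2 : ℝ) : ℂ) := by rw [← h]; norm_cast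
  exact ofReal_injective h'

lemma tst_memLp {Ω : Set (Cn n)} {f : Cn n → ℂ} (hf : Tst Ω f) (j : Fin n) : MemLp (dbar j f) 2 :=
  (contDiff_dbar (m := ⊤) (k := 0) j hf.1 le_top).continuous.memLp_of_hasCompactSupport (hcs_dbar j hf.2.1)

lemma project {Ω : Set (Cn n)} (hΩ : IsOpen Ω) (hne : Ωᶜ.Nonempty) {v : Cn n → ℂ} (hv : MemLp v 2) {B : ℝ} (hB : 0 ≤ B)
    (hbd : ∀ a : Fin n → Cn n → ℂ, (∀ j, Tst Ω (a j)) →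
      ‖∫ z, v z * ∑ j, dbar j (a j) z‖ ^ 2 ≤ B ^ 2 * ∫ z, ‖∑ j, dbar j (a j) z‖ ^ 2) :
    ∃ G : Cn n → ℂ, DifferentiableOn ℂ G Ω ∧ ∫⁻ z in Ω, ‖G z‖ₑ ^ 2 ≤ ∫⁻ z, ‖v z‖ₑ ^ 2 ∧
      ∫⁻ z in Ω, ‖G z - v z‖ₑ ^ 2 ≤ ENNReal.ofReal (B ^ 2) := by
  set x := hv.toLp with hx
  have xv : x =ᵐ[volume] v := hv.coeFn_toLp
  have inn : ∀ s : Lp ℂ 2 (volume : Measure (Cn n)), ∀ y : Lp ℂ 2 (volume : Measure (Cn n)), ∀ a : Fin n → Cn n → ℂ,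
      (s =ᵐ[volume] fun z => conj (∑ j, dbar j (a j) z)) → inner ℂ s y = ∫ z, y z * ∑ j, dbar j (a j) z := by
    intro s y a hs
    rw [L2.inner_def]
    refine integral_congr_ae ?_
    filter_upwards [hs] with z hz
    rw [RCLike.inner_apply, hz, conj_conj]
  obtain ⟨A, hA1, hA2, hA3⟩ := hilb2 (divS Ω) x hB (by
    rintro s ⟨a, ha, hs⟩
    rw [inn s x a hs]
    have e1 : ∫ z, x z * ∑ j, dbar j (a j) z = ∫ z, v z * ∑ j, dbar j (a j) z :=
      integral_congr_ae (by filter_upwards [xv] with z hz; rw [hz])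
    have e2 : ‖s‖ ^ 2 = ∫ z, ‖∑ j, dbar j (a j) z‖ ^ 2 := by
      rw [Lp_norm_sq']
      refine integral_congr_ae ?_
      filter_upwards [hs] with z hz
      rw [hz, norm_conj]
    have := hbd a ha
    rw [← e1, ← e2, ← mul_pow] at this
    exact (pow_le_pow_iff_left₀ (norm_nonneg _) (by positivity) two_ne_zero).1 this)
  obtain ⟨G, hG, hGA⟩ := weyl hΩ hne (Lp.memLp A) (by
    intro j w h1 h2 h3
    have ht : Tst Ω w := ⟨h1, h2, h3⟩
    have hm : MemLp (fun z => conj (dbar j w z)) 2 := (tst_memLp ht j).star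
    have hT : ∀ k, Tst Ω ((fun k => if k = j then w else fun _ => 0) k) := fun k => by
      by_cases h : k = j
      · simpa [h] using ht
      · simpa [h] using Tst.zero
    have es : ∀ z, ∑ k, dbar k ((fun k => if k = j then w else fun _ => 0) k) z = dbar j w z := by
      intro z
      rw [Finset.sum_eq_single j]
      · simp
      · intro k _ hk; simp [hk, dbar]
      · simp
    have hs : (hm.toLp : Cn n → ℂ) =ᵐ[volume] fun z => conj (∑ k, dbar k ((fun k => if k = j then w else fun _ => 0) k) z) := by
      simp_rw [es]; exact hm.coeFn_toLp
    have := hA1 hm.toLp ⟨_, hT, hs⟩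
    rw [inn _ _ _ hs] at this
    simpa only [es] using this)
  refine ⟨G, hG, ?_, ?_⟩
  · calc ∫⁻ z in Ω, ‖G z‖ₑ ^ 2 = ∫⁻ z in Ω, ‖A z‖ₑ ^ 2 := by
          refine setLIntegral_congr_fun_ae hΩ.measurableSet ?_
          filter_upwards [hGA] with z hz hzΩ
          rw [hz hzΩ]
      _ ≤ ∫⁻ z, ‖A z‖ₑ ^ 2 := setLIntegral_le_lintegral _ _
      _ = ‖A‖ₑ ^ 2 := (Lp_norm_sq A).symm
      _ ≤ ‖x‖ₑ ^ 2 := by gcongr; exact enorm_le_iff_norm_le.2 hA2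
      _ = ∫⁻ z, ‖x z‖ₑ ^ 2 := Lp_norm_sq x
      _ = ∫⁻ z, ‖v z‖ₑ ^ 2 := lintegral_congr_ae (by filter_upwards [xv] with z hz; rw [hz])
  · calc ∫⁻ z in Ω, ‖G z - v z‖ₑ ^ 2 = ∫⁻ z in Ω, ‖(x - A) z‖ₑ ^ 2 := by
          refine setLIntegral_congr_fun_ae hΩ.measurableSet ?_
          filter_upwards [hGA, Lp.coeFn_sub x A, xv] with z hz h1 h2 hzΩ
          rw [hz hzΩ, h1, Pi.sub_apply, h2, enorm_sub_rev]
      _ ≤ ∫⁻ z, ‖(x - A) z‖ₑ ^ 2 := setLIntegral_le_lintegral _ _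
      _ = ‖x - A‖ₑ ^ 2 := (Lp_norm_sq _).symm
      _ ≤ ENNReal.ofReal B ^ 2 := by
          gcongr
          rw [← ofReal_norm]
          exact ENNReal.ofReal_le_ofReal hA3
      _ = ENNReal.ofReal (B ^ 2) := (ENNReal.ofReal_pow hB 2).symm

end Loc
end

section
namespace Loc
open Filter Topology ContDiff ComplexConjugate Complex

lemma tst_dbar {Ω : Set (Cn n)} {w : Cn n → ℂ} (hw : Tst Ω w) (k : Fin n) : Tst Ω (dbar k w) :=
  ⟨contDiff_dbar (m := ⊤) (k := ⊤) k hw.1 le_top, hcs_dbar k hw.2.1, (tsupport_dbar k w).trans hw.2.2⟩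

lemma tst_mem {Ω : Set (Cn n)} {f : Cn n → ℂ} (hf : Tst Ω f) : MemLp f 2 :=
  hf.1.continuous.memLp_of_hasCompactSupport hf.2.1

lemma int_mul {f g : Cn n → ℂ} (hf : MemLp f 2) (hg : MemLp g 2) : Integrable (fun z => f z * g z) :=
  hf.integrable_mul (q := 2) hg

lemma weak_id {Ω : Set (Cn n)} (hΩ : IsOpen Ω) {v : Cn n → ℂ} (hv : ∀ z ∈ Ω, ContDiffAt ℝ ∞ v z) {w : Cn n → ℂ}
    (hw : Tst Ω w) (j : Fin n) {g : Cn n → ℂ} (hg : ∀ z ∈ Ω, dbar j v z = g z) :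
    ∫ z, v z * dbar j w z = - ∫ z, g z * w z := by
  obtain ⟨Θ, h1, h2, h3, -, h5⟩ := exists_cutoff hw.2.1 hΩ hw.2.2
  have sm : ContDiff ℝ ∞ (fun z => (Θ z : ℂ) * v z) := by
    rw [contDiff_iff_contDiffAt]
    intro z
    by_cases hz : z ∈ Ω
    · exact (ofRealCLM.contDiff.comp h1).contDiffAt.mul (hv z hz)
    · refine (contDiffAt_const (c := (0:ℂ))).congr_of_eventuallyEq ?_
      filter_upwards [notMem_tsupport_iff_eventuallyEq.1 fun h => hz (h3 h)] with y hy
      simp [hy]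
  have ev : ∀ z ∈ tsupport w, (fun z => (Θ z : ℂ) * v z) =ᶠ[𝓝 z] v := fun z hz => by
    filter_upwards [nhds_le_nhdsSet hz h5] with y hy
    simp [hy]
  have key := ibp_dbar (f := fun z => (Θ z : ℂ) * v z) (g := w) (sm.of_le (by simp)) (hw.1.of_le (by simp)) hw.2.1 j
  have e1 : ∀ z, (Θ z : ℂ) * v z * dbar j w z = v z * dbar j w z := by
    intro z
    by_cases hz : z ∈ tsupport w
    · rw [(ev z hz).eq_of_nhds]
    · simp [dbar_eq_zero_of j hz]
  have e2 : ∀ z, dbar j (fun z => (Θ z : ℂ) * v z) z * w z = g z * w z := by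
    intro z
    by_cases hz : z ∈ tsupport w
    · rw [dbar_congr (ev z hz), hg z (hw.2.2 hz)]
    · simp [image_eq_zero_of_notMem_tsupport hz]
  simp only [e1, e2] at key
  exact key

lemma solve {Ω : Set (Cn n)} (hΩ : IsOpen Ω) (hne : Ωᶜ.Nonempty) (hE : Exh Ω) {φ : Cn n → ℝ} {M c r : ℝ} {p : Cn n}
    (hφ : ContDiff ℝ 2 φ) (hφ0 : ∀ z, 0 ≤ φ z) (hM : ∀ z, φ z ≤ M) (hc : 0 < c)
    (hl0 : ∀ z ∈ Ω, ∀ X, 0 ≤ leviForm φ z X) (hlc : ∀ z ∈ Ω ∩ ball p r, ∀ X, c * ‖X‖ ^ 2 ≤ leviForm φ z X)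
    {χ : Cn n → ℝ} (hχ : ContDiff ℝ ∞ χ) (hχc : HasCompactSupport χ) (hχs : tsupport χ ⊆ ball p r)
    {h : Cn n → ℂ} (hh : DifferentiableOn ℂ h (Ω ∩ ball p r)) (hm : MemLp ((Ω ∩ ball p r).indicator h) 2) :
    ∃ G : Cn n → ℂ, DifferentiableOn ℂ G Ω ∧
      ∫⁻ z in Ω, ‖G z‖ₑ ^ 2 ≤ ∫⁻ z, ‖(χ z : ℂ) * (Ω ∩ ball p r).indicator h z‖ₑ ^ 2 ∧
      ∫⁻ z in Ω, ‖G z - (χ z : ℂ) * (Ω ∩ ball p r).indicator h z‖ₑ ^ 2 ≤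
        ENNReal.ofReal (2 * Real.exp M / c * ∫ z, ∑ j, ‖dbar j (cx χ) z * (Ω ∩ ball p r).indicator h z‖ ^ 2) := by
  set D := Ω ∩ ball p r with hD
  have oD : IsOpen D := hΩ.inter isOpen_ball
  have cχ : ContDiff ℝ ∞ (cx χ) := ofRealCLM.contDiff.comp hχ
  have csχ : HasCompactSupport (cx χ) := hχc.comp_left (g := fun x : ℝ => (x : ℂ)) (by simp)
  have supχ : ∀ z, z ∉ ball p r → cx χ =ᶠ[𝓝 z] 0 := fun z hz => by
    filter_upwards [notMem_tsupport_iff_eventuallyEq.1 fun h => hz (hχs h)] with y hy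
    simp [cx, hy]
  set v : Cn n → ℂ := fun z => cx χ z * D.indicator h z with hv
  set g : Fin n → Cn n → ℂ := fun j z => dbar j (cx χ) z * D.indicator h z with hg
  have dc : ∀ j, Continuous (dbar j (cx χ)) := fun j => (contDiff_dbar (m := ⊤) (k := 0) j cχ le_top).continuous
  have mv : MemLp v 2 := memLp_cs_mul cχ.continuous csχ hm
  have mg : ∀ j, MemLp (g j) 2 := fun j => memLp_cs_mul (dc j) (hcs_dbar j csχ) hm
  have evD : ∀ z ∈ D, v =ᶠ[𝓝 z] fun z => cx χ z * h z := fun z hz => by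
    filter_upwards [oD.mem_nhds hz] with y hy
    simp only [hv]; rw [indicator_of_mem hy]
  have evO : ∀ z, z ∉ ball p r → v =ᶠ[𝓝 z] fun _ => 0 := fun z hz => by
    filter_upwards [supχ z hz] with y hy
    simp [hv, hy]
  have sv : ∀ z ∈ Ω, ContDiffAt ℝ ∞ v z := by
    intro z hz
    by_cases hb : z ∈ ball p r
    · exact (cχ.contDiffAt.mul (holo_smooth oD hh ⟨hz, hb⟩)).congr_of_eventuallyEq (evD z ⟨hz, hb⟩)
    · exact contDiffAt_const.congr_of_eventuallyEq (evO z hb)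
  have dv : ∀ j, ∀ z ∈ Ω, dbar j v z = g j z := by
    intro j z hz
    by_cases hb : z ∈ ball p r
    · have hzD : z ∈ D := ⟨hz, hb⟩
      rw [dbar_congr (evD z hzD), dbar_mul j (cχ.differentiable (by simp) z)
        ((holo_smooth oD hh hzD).differentiableAt (by simp)), dbar_of_holo (hh.differentiableAt (oD.mem_nhds hzD))]
      simp only [hg]; rw [indicator_of_mem hzD]; ring
    · rw [dbar_congr (evO z hb)]
      have : z ∉ D := fun h => hb h.2
      simp [hg, this, dbar]
  have wid : ∀ j w, Tst Ω w → ∫ z, v z * dbar j w z = - ∫ z, g j z * w z := fun j w hw => weak_id hΩ sv hw j (dv j)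
  have hgc : ∀ j k w, Tst Ω w → ∫ z, (g j z * dbar k w z - g k z * dbar j w z) = 0 := by
    intro j k w hw
    rw [integral_sub (int_mul (mg j) (tst_memLp hw k)) (int_mul (mg k) (tst_memLp hw j))]
    have h1 := wid j _ (tst_dbar hw k)
    have h2 := wid k _ (tst_dbar hw j)
    simp_rw [dbar_comm (hw.1.of_le (WithTop.coe_le_coe.2 le_top)) j k] at h1
    linear_combination h1 - h2
  set N := ∫ z, ∑ j, ‖g j z‖ ^ 2 with hN
  have N0 : 0 ≤ N := integral_nonneg fun z => Finset.sum_nonneg fun j _ => by positivity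
  set B := Real.sqrt (2 * Real.exp M / c * N) with hB
  have B2 : B ^ 2 = 2 * Real.exp M / c * N := Real.sq_sqrt (by positivity)
  obtain ⟨G, g1, g2, g3⟩ := project hΩ hne mv (B := B) (Real.sqrt_nonneg _) (by
    intro a ha
    have ap := apriori hE hφ hφ0 hM (measurableSet_ball (x := p) (ε := r)) hc hl0 hlc
      (fun j => (ha j).1.of_le (by simp)) (fun j => (ha j).2.1) (fun j => (ha j).2.2) mg
      (fun j z hz => by
        have : z ∉ D := fun h => hz h.2
        simp [hg, this]) hgc
    have e : ∫ z, v z * ∑ j, dbar j (a j) z = - ∫ z, ∑ j, a j z * g j z := by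
      simp_rw [Finset.mul_sum]
      rw [integral_finsetSum _ (fun j _ => int_mul mv (tst_memLp (ha j) j)),
        integral_finsetSum _ (fun j _ => int_mul (tst_mem (ha j)) (mg j)), ← Finset.sum_neg_distrib]
      refine Finset.sum_congr rfl fun j _ => ?_
      rw [wid j _ (ha j)]
      simp_rw [mul_comm]
    rw [e, norm_neg, B2]
    refine ap.trans (le_of_eq ?_)
    ring)
  refine ⟨G, g1, g2, ?_⟩
  rw [B2] at g3
  exact g3

end Loc
end

section
namespace Loc
open Filter Topology ContDiff ComplexConjugate Complex

lemma ball_sub {Ω : Set (Cn n)} (hΩ : IsOpen Ω) {z : Cn n} (hz : z ∈ Ω) : ball z (bdist Ω z) ⊆ Ω := by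
  rcases le_or_gt (bdist Ω z) 0 with h0 | h0
  · simp [ball_eq_empty.2 h0]
  have hc : IsPreconnected (ball z (bdist Ω z)) := (convex_ball z _).isPreconnected
  refine (isPreconnected_iff_subset_of_disjoint.1 hc Ω (closure Ω)ᶜ hΩ isClosed_closure.isOpen_compl ?_ ?_).elim id ?_
  · intro w hw
    by_contra hn
    rw [mem_union, not_or, mem_compl_iff, not_not] at hn
    have hf : w ∈ frontier Ω := by rw [hΩ.frontier_eq]; exact ⟨hn.2, hn.1⟩
    have := infDist_le_dist_of_mem (x := z) hf
    rw [mem_ball, dist_comm] at hw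
    exact absurd hw (not_lt.2 this)
  · ext w
    simp only [mem_inter_iff, mem_compl_iff, mem_empty_iff_false, iff_false, not_and, not_not]
    exact fun _ h => subset_closure h
  · intro h
    exact absurd (subset_closure hz) (h (mem_ball_self h0))

lemma J0_bdd {D : Set (Cn n)} {z : Cn n} {s : ℝ} (hs : 0 < s) (hb : ball z s ⊆ D) :
    BddAbove {v : ℝ | ∃ f : Cn n → ℂ, DifferentiableOn ℂ f D ∧ L2normSq D f ≤ 1 ∧ v = ‖f z‖ ^ 2} := by
  refine ⟨((s / 2) ^ (2 * n))⁻¹ * Ck n, ?_⟩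
  rintro v ⟨f, hf, h1, rfl⟩
  have h2 := point_bound hs (hf.mono hb)
  have h3 : ∫⁻ w in ball z s, ‖f w‖ₑ ^ 2 ≤ 1 := (lintegral_mono_set hb).trans h1
  have h4 : ‖f z‖ₑ ^ 2 ≤ ENNReal.ofReal (((s / 2) ^ (2 * n))⁻¹ * Ck n) := by
    refine h2.trans ?_
    calc _ ≤ ENNReal.ofReal (((s / 2) ^ (2 * n))⁻¹ * Ck n) * 1 := by gcongr
      _ = _ := mul_one _
  rw [← ofReal_norm, ← ENNReal.ofReal_pow (norm_nonneg _)] at h4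
  have := Ck_pos (n := n)
  exact (ENNReal.ofReal_le_ofReal_iff (by positivity)).1 h4

lemma loc_one {Ω : Set (Cn n)} (hΩ : IsOpen Ω) (hne : Ωᶜ.Nonempty) (hE : Exh Ω) {φ : Cn n → ℝ} {M c' r c A k δ : ℝ}
    {p q z : Cn n}
    (hφ : ContDiff ℝ 2 φ) (hφ0 : ∀ z, 0 ≤ φ z) (hM : ∀ z, φ z ≤ M) (hc' : 0 < c')
    (hl0 : ∀ z ∈ Ω, ∀ X, 0 ≤ leviForm φ z X) (hlc : ∀ z ∈ Ω ∩ ball p r, ∀ X, c' * ‖X‖ ^ 2 ≤ leviForm φ z X)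
    {χ : Cn n → ℝ} (hχ : ContDiff ℝ ∞ χ) (hχc : HasCompactSupport χ) (hχs : tsupport χ ⊆ ball p r)
    (hχ01 : ∀ x, χ x ∈ Icc (0:ℝ) 1) (hχ1 : ∀ᶠ x in 𝓝ˢ (closedBall p (r / 2)), χ x = 1)
    (hA : ∀ z, ∑ j, ‖dbar j (cx χ) z‖ ^ 2 ≤ A) (hc : 0 < c) (hr : 0 < r)
    {P : Cn n → ℂ} (hP : Differentiable ℂ P) (hPr : ∀ w ∈ Ω ∩ ball p r, (P w).re ≤ -(c * ‖w - q‖ ^ 2))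
    (hq : dist q p < r / 4) (hk : 0 ≤ k) {f : Cn n → ℂ} (hf : DifferentiableOn ℂ f (Ω ∩ ball p r))
    (hf1 : ∫⁻ w in Ω ∩ ball p r, ‖f w‖ₑ ^ 2 ≤ 1) (hδ : 0 < δ) (hz : ball z δ ⊆ Ω) (hzp : ball z δ ⊆ ball p (r / 2)) :
    ∃ G : Cn n → ℂ, DifferentiableOn ℂ G Ω ∧ ∫⁻ w in Ω, ‖G w‖ₑ ^ 2 ≤ 1 ∧
      ‖G z - f z * cexp (k * P z)‖ ^ 2 ≤ ((δ / 2) ^ (2 * n))⁻¹ * Ck n *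
        (2 * Real.exp M / c' * (A * Real.exp (-2 * k * (c * (r / 4) ^ 2)))) := by
  set D := Ω ∩ ball p r with hD
  have oD : IsOpen D := hΩ.inter isOpen_ball
  set h : Cn n → ℂ := fun w => f w * cexp (k * P w) with hh
  have dh : DifferentiableOn ℂ h D := hf.mul ((hP.const_mul (k : ℂ)).cexp.differentiableOn)
  have nE : ∀ w, ‖h w‖ = ‖f w‖ * Real.exp (k * (P w).re) := fun w => by
    simp [hh, Complex.norm_exp]
  have hle : ∀ w ∈ D, ‖h w‖ ≤ ‖f w‖ := fun w hw => by
    rw [nE]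
    refine mul_le_of_le_one_right (norm_nonneg _) (Real.exp_le_one_iff.2 (mul_nonpos_of_nonneg_of_nonpos hk ?_))
    have := hPr w hw
    nlinarith [mul_nonneg hc.le (sq_nonneg ‖w - q‖)]
  have mf : MemLp (D.indicator f) 2 := by
    rw [memLp_indicator_iff_restrict oD.measurableSet]
    refine ⟨hf.continuousOn.aestronglyMeasurable oD.measurableSet, ?_⟩
    have : eLpNorm f 2 (volume.restrict D) ^ 2 < ⊤ := by
      rw [sq_eLpNorm]; exact hf1.trans_lt ENNReal.one_lt_top
    exact (ENNReal.pow_lt_top_iff (n := 2)).1 this |>.resolve_right (by norm_num)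
  have mh : MemLp (D.indicator h) 2 := by
    refine mf.mono ((aestronglyMeasurable_indicator_iff oD.measurableSet).2
      (dh.continuousOn.aestronglyMeasurable oD.measurableSet)) (ae_of_all _ fun w => ?_)
    by_cases hw : w ∈ D
    · simpa only [indicator_of_mem hw] using hle w hw
    · simp [hw]
  obtain ⟨G, g1, g2, g3⟩ := solve hΩ hne hE hφ hφ0 hM hc' hl0 hlc hχ hχc hχs dh mh
  rw [← hD] at g2 g3
  refine ⟨G, g1, g2.trans ?_, ?_⟩
  · refine le_trans ?_ hf1
    rw [← lintegral_indicator oD.measurableSet]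
    refine lintegral_mono fun w => ?_
    by_cases hw : w ∈ D
    · simp only [indicator_of_mem hw]
      gcongr
      rw [enorm_le_iff_norm_le, norm_mul, norm_real, Real.norm_of_nonneg (hχ01 w).1]
      exact (mul_le_of_le_one_left (norm_nonneg _) (hχ01 w).2).trans (hle w hw)
    · simp [hw]
  have A0 : 0 ≤ A := le_trans (Finset.sum_nonneg fun j _ => by positivity) (hA 0)
  set E := Real.exp (-2 * k * (c * (r / 4) ^ 2)) with hEE
  have hI : ∫ w, ∑ j, ‖dbar j (cx χ) w * D.indicator h w‖ ^ 2 ≤ A * E := by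
    have i1 : Integrable fun w => ‖D.indicator f w‖ ^ 2 := (memLp_two_iff_integrable_sq_norm mf.1).1 mf
    have i2 : ∫ w, ‖D.indicator f w‖ ^ 2 ≤ 1 := by
      rw [integral_eq_lintegral_of_nonneg_ae (ae_of_all _ fun w => by positivity) i1.1]
      refine ENNReal.toReal_le_of_le_ofReal zero_le_one ?_
      rw [ENNReal.ofReal_one]
      refine le_trans (le_of_eq ?_) hf1
      rw [← lintegral_indicator oD.measurableSet]
      refine lintegral_congr fun w => ?_
      by_cases hw : w ∈ D
      · simp only [indicator_of_mem hw]
        rw [ENNReal.ofReal_pow (norm_nonneg _), ofReal_norm]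
      · simp [hw]
    calc _ ≤ ∫ w, A * E * ‖D.indicator f w‖ ^ 2 := by
          refine integral_mono_of_nonneg (ae_of_all _ fun w => Finset.sum_nonneg fun j _ => by positivity)
            (i1.const_mul _) (ae_of_all _ fun w => ?_)
          by_cases hw : w ∈ D
          · simp only [indicator_of_mem hw, norm_mul, mul_pow, ← Finset.sum_mul]
            by_cases hb : w ∈ closedBall p (r / 2)
            · have e : cx χ =ᶠ[𝓝 w] fun _ => 1 := by
                filter_upwards [nhds_le_nhdsSet hb hχ1] with y hy
                simp [cx, hy]
              have : ∀ j, dbar j (cx χ) w = 0 := fun j => by rw [dbar_congr e]; simp [dbar]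
              simp only [this]
              simp
              positivity
            · rw [mem_closedBall, not_le] at hb
              have h1 : r / 4 ≤ ‖w - q‖ := by
                rw [← dist_eq_norm]
                linarith [dist_triangle w q p]
              have h2 : (P w).re ≤ -(c * (r / 4) ^ 2) := (hPr w hw).trans (by gcongr)
              have h3 : ‖h w‖ ^ 2 ≤ E * ‖f w‖ ^ 2 := by
                rw [nE, mul_pow, mul_comm, ← Real.exp_nat_mul]
                gcongr
                rw [hEE]
                apply Real.exp_le_exp.2
                push_cast
                nlinarith [mul_le_mul_of_nonneg_left h2 hk]
              calc _ ≤ A * (E * ‖f w‖ ^ 2) := by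
                    gcongr
                    exact hA w
                _ = _ := by ring
          · simp [hw]
      _ = A * E * ∫ w, ‖D.indicator f w‖ ^ 2 := integral_const_mul _ _
      _ ≤ A * E * 1 := by
          have : 0 ≤ E := (Real.exp_pos _).le
          gcongr
      _ = _ := mul_one _
  have zz : ball z δ ⊆ D := fun w hw => ⟨hz hw, ball_subset_ball (by linarith) (hzp hw)⟩
  have pb := point_bound hδ (f := fun w => G w - h w) ((g1.mono hz).sub (dh.mono zz))
  have CkP := Ck_pos (n := n)
  have hK : 0 ≤ ((δ / 2) ^ (2 * n))⁻¹ * Ck n := by positivity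
  have hB : 0 ≤ 2 * Real.exp M / c' := by positivity
  have le2 : ∫⁻ w in ball z δ, ‖G w - h w‖ₑ ^ 2 ≤ ENNReal.ofReal (2 * Real.exp M / c' * (A * E)) := by
    refine le_trans ?_ (g3.trans (ENNReal.ofReal_le_ofReal (by gcongr)))
    refine le_trans (le_of_eq ?_) (lintegral_mono_set hz)
    refine setLIntegral_congr_fun measurableSet_ball fun w hw => ?_
    have : χ w = 1 := (hχ1.self_of_nhdsSet) w (ball_subset_closedBall (hzp hw))
    simp only [indicator_of_mem (zz hw), this, ofReal_one, one_mul]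
  have fin : ‖G z - h z‖ₑ ^ 2 ≤ ENNReal.ofReal (((δ / 2) ^ (2 * n))⁻¹ * Ck n * (2 * Real.exp M / c' * (A * E))) := by
    rw [ENNReal.ofReal_mul hK]
    exact pb.trans (by gcongr)
  rw [← ofReal_norm, ← ENNReal.ofReal_pow (norm_nonneg _)] at fin
  have : 0 ≤ E := (Real.exp_pos _).le
  exact (ENNReal.ofReal_le_ofReal_iff (by positivity)).1 fin

end Loc
end

section
namespace Loc
open Filter Topology ContDiff ComplexConjugate Complex

lemma arith {s j a b y m : ℝ} (hs : 0 ≤ s) (hm : 0 < m) (hj : m ≤ j) (hb : 0 ≤ b) (h : √j * a - b ≤ s)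
    (hy : 1 - a + b / √m ≤ y) (hy0 : 0 ≤ y) : 1 - 2 * y ≤ s ^ 2 / j := by
  have hj0 : 0 < j := hm.trans_le hj
  have q0 : 0 < √j := Real.sqrt_pos.2 hj0
  have q1 : 0 < √m := Real.sqrt_pos.2 hm
  have q2 : √m ≤ √j := Real.sqrt_le_sqrt hj
  have h1 : b ≤ √j * (b / √m) := by
    rw [mul_div_assoc', le_div_iff₀ q1, mul_comm]
    gcongr
  have h2 : √j * (1 - y) ≤ s := by nlinarith
  rw [le_div_iff₀ hj0]
  have h3 := Real.sq_sqrt hj0.le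
  rcases le_or_gt y 1 with h4 | h4
  · have : (√j * (1 - y)) ^ 2 ≤ s ^ 2 := by
      have : 0 ≤ 1 - y := by linarith
      gcongr
    rw [mul_pow, h3] at this
    nlinarith [mul_nonneg hj0.le (sq_nonneg y)]
  · nlinarith [sq_nonneg s]

lemma constb {N : ℕ} {δ c1 K B A : ℝ} (hδ : 0 < δ) (hc : 0 < c1) :
    ((δ / 2) ^ (2 * N))⁻¹ * K * (B * (A * Real.exp (-2 * ((N + 1) / c1 * (-Real.log δ)) * c1))) =
      4 ^ N * K * B * A * δ ^ 2 := by
  have : -2 * (((N:ℝ) + 1) / c1 * (-Real.log δ)) * c1 = ((2 * N + 2 : ℕ) : ℝ) * Real.log δ := by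
    push_cast
    field_simp
  rw [this, Real.exp_nat_mul, Real.exp_log hδ, div_pow, pow_add, pow_mul 2 2 N]
  norm_num
  have : δ ^ (2 * N) ≠ 0 := by positivity
  field_simp

set_option maxHeartbeats 1000000 in
lemma main_aux {Ω : Set (Cn n)} (hpsc : IsPseudoconvex Ω) {p : Cn n} (hp : IsStrictPscPtC2 Ω p)
    {V : Set (Cn n)} (hV : V ∈ nhds p) (hVbdd : Bornology.IsBounded V) :
    ∃ (U : Set (Cn n)) (C : ℝ), U ⊆ V ∧ U ∈ nhds p ∧ 0 < C ∧
      ∀ z ∈ Ω ∩ U,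
        J0 Ω z / J0 (Ω ∩ V) z ≤ 1 ∧ 1 + C * bdist Ω z * Real.log (bdist Ω z) ≤ J0 Ω z / J0 (Ω ∩ V) z := by
  have oΩ := hpsc.1
  have pf := hp.1
  have pn : p ∉ Ω := by
    have := pf; rw [oΩ.frontier_eq] at this; exact this.2
  have hne : Ωᶜ.Nonempty := ⟨p, pn⟩
  have hE := pseudo_exh hpsc hne
  obtain ⟨R, hR, hRV⟩ := Metric.mem_nhds_iff.1 hV
  obtain ⟨φ, M, c', r, L, c, hr, hrR, hL, hc, hφ, hφ0, hM, hc', hl0, hlc, hpk⟩ := geom oΩ hp hR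
  obtain ⟨χ, x1, x2, x3, x4, x5⟩ := exists_cutoff (isCompact_closedBall p (r / 2)) (isOpen_ball (x := p) (ε := r))
    (closedBall_subset_ball (by linarith))
  have cχ : ContDiff ℝ ∞ (cx χ) := ofRealCLM.contDiff.comp x1
  have csχ : HasCompactSupport (cx χ) := x2.comp_left (g := fun x : ℝ => (x : ℂ)) (by simp)
  obtain ⟨A, hA⟩ : ∃ A : ℝ, ∀ z, ∑ j, ‖dbar j (cx χ) z‖ ^ 2 ≤ A := by
    have : ∀ j : Fin n, ∃ A : ℝ, ∀ z, ‖dbar j (cx χ) z‖ ≤ A := fun j =>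
      (contDiff_dbar (m := ⊤) (k := 0) j cχ le_top).continuous.bounded_above_of_compact_support (hcs_dbar j csχ)
    choose A hA using this
    exact ⟨∑ j, A j ^ 2, fun z => Finset.sum_le_sum fun j _ => by
      have := hA j z
      gcongr⟩
  have A0 : 0 ≤ A := le_trans (Finset.sum_nonneg fun j _ => by positivity) (hA 0)
  set c1 := c * (r / 4) ^ 2 with hc1
  have c1p : 0 < c1 := by positivity
  set T := (volume V).toReal with hT
  set m := (T + 1)⁻¹ with hm
  have T0 : 0 ≤ T := ENNReal.toReal_nonneg
  have mp : 0 < m := by positivity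
  have CkP := Ck_pos (n := n)
  set C0 := √(4 ^ n * Ck n * (2 * Real.exp M / c') * A) with hC0
  have C0s : C0 ^ 2 = 4 ^ n * Ck n * (2 * Real.exp M / c') * A := Real.sq_sqrt (by positivity)
  have C00 : 0 ≤ C0 := Real.sqrt_nonneg _
  set C1 := (n + 1) / c1 * L + C0 / √m with hC1
  have C1p : 0 < C1 := by positivity
  set r' := min (r / 8) (Real.exp (-1)) with hr'
  have r'p : 0 < r' := by positivity
  have r'1 : r' ≤ r / 8 := min_le_left _ _
  have r'2 : r' ≤ Real.exp (-1) := min_le_right _ _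
  have bV : ball p r ⊆ V := (ball_subset_ball hrR).trans hRV
  refine ⟨ball p r', 2 * C1, (ball_subset_ball (by linarith)).trans bV, ball_mem_nhds p r'p, by positivity, ?_⟩
  rintro z ⟨hzΩ, hzU⟩
  rw [mem_ball] at hzU
  set δ := bdist Ω z with hδd
  have fne : (frontier Ω).Nonempty := ⟨p, pf⟩
  have δp : 0 < δ := by
    refine (isClosed_frontier.notMem_iff_infDist_pos fne).1 fun h => ?_
    rw [oΩ.frontier_eq] at h
    exact h.2 hzΩ
  have δr : δ < r' := (infDist_le_dist_of_mem pf).trans_lt hzU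
  obtain ⟨q, hqf, hqd⟩ := isClosed_frontier.exists_infDist_eq_dist fne z
  have hqd' : δ = dist z q := hqd
  have qp : dist q p < r / 4 := by
    have := dist_triangle q z p
    rw [dist_comm q z] at this
    linarith
  obtain ⟨P, hP, hPr, hPL⟩ := hpk q ⟨hqf, by rw [mem_ball]; linarith⟩
  have bz : ball z δ ⊆ Ω := ball_sub oΩ hzΩ
  have bz2 : ball z δ ⊆ ball p (r / 2) := ball_subset_ball' (by linarith)
  have bz3 : ball z δ ⊆ Ω ∩ V := fun w hw => ⟨bz hw, bV (ball_subset_ball (by linarith) (bz2 hw))⟩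
  have bd1 := J0_bdd δp bz
  have bd2 := J0_bdd δp bz3
  have zV : z ∈ Ω ∩ V := bz3 (mem_ball_self δp)
  -- lower bound
  have Jm : m ≤ J0 (Ω ∩ V) z := by
    refine le_csSup bd2 ⟨fun _ => ((√m : ℝ) : ℂ), differentiableOn_const _, ?_, ?_⟩
    · have hv : volume (Ω ∩ V) ≤ ENNReal.ofReal T := by
        rw [hT, ENNReal.ofReal_toReal hVbdd.measure_lt_top.ne]
        exact measure_mono inter_subset_right
      rw [L2normSq, lintegral_const, Measure.restrict_apply_univ]
      have : (‖((√m : ℝ) : ℂ)‖₊ : ℝ≥0∞) ^ 2 = ENNReal.ofReal m := by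
        rw [← enorm_eq_nnnorm, ← ofReal_norm, ← ENNReal.ofReal_pow (norm_nonneg _), norm_real,
          Real.norm_of_nonneg (Real.sqrt_nonneg _), Real.sq_sqrt mp.le]
      rw [this]
      calc _ ≤ ENNReal.ofReal m * ENNReal.ofReal T := by gcongr
        _ = ENNReal.ofReal (m * T) := (ENNReal.ofReal_mul mp.le).symm
        _ ≤ ENNReal.ofReal 1 := by
          apply ENNReal.ofReal_le_ofReal
          rw [hm, inv_mul_le_iff₀ (by positivity)]
          linarith
        _ = 1 := ENNReal.ofReal_one
    · rw [norm_real, Real.norm_of_nonneg (Real.sqrt_nonneg _), Real.sq_sqrt mp.le]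
  have Jp : 0 < J0 (Ω ∩ V) z := mp.trans_le Jm
  constructor
  · rw [div_le_one Jp]
    refine csSup_le_csSup bd2 ⟨0, fun _ => 0, differentiableOn_const _, by simp [L2normSq], by simp⟩ ?_
    rintro v ⟨f, f1, f2, f3⟩
    exact ⟨f, f1.mono inter_subset_left, (lintegral_mono_set inter_subset_left).trans f2, f3⟩
  set ℓ := -Real.log δ with hℓ
  have ℓ1 : 1 ≤ ℓ := by
    have := Real.log_lt_log δp (δr.trans_le r'2)
    rw [Real.log_exp] at this
    linarith
  set k := ((n:ℝ) + 1) / c1 * ℓ with hk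
  have k0 : 0 ≤ k := by positivity
  have JΩ0 : 0 ≤ J0 Ω z := le_csSup bd1 ⟨fun _ => 0, differentiableOn_const _, by simp [L2normSq], by simp⟩
  set s := √(J0 Ω z) with hs
  have s0 : 0 ≤ s := Real.sqrt_nonneg _
  have each : ∀ f : Cn n → ℂ, DifferentiableOn ℂ f (Ω ∩ V) → L2normSq (Ω ∩ V) f ≤ 1 →
      ‖f z‖ * (1 - k * L * δ) - C0 * δ ≤ s := by
    intro f f1 f2
    have sub : Ω ∩ ball p r ⊆ Ω ∩ V := inter_subset_inter_right _ bV
    obtain ⟨G, g1, g2, g3⟩ := loc_one oΩ hne hE hφ hφ0 hM hc' hl0 hlc x1 x2 x3 x4 x5 hA hc hr hP hPr qp k0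
      (f1.mono sub) ((lintegral_mono_set sub).trans f2) δp bz bz2
    rw [← hc1, hk, constb δp c1p, ← hk, ← C0s, ← mul_pow] at g3
    have g4 : ‖G z - f z * cexp (k * P z)‖ ≤ C0 * δ := abs_le_of_sq_le_sq' g3 (by positivity) |>.2
    have g5 : ‖G z‖ ≤ s := Real.le_sqrt_of_sq_le (le_csSup bd1 ⟨G, g1, g2, rfl⟩)
    have g6 : ‖f z * cexp (k * P z)‖ ≤ s + C0 * δ := by
      have := norm_sub_norm_le (f z * cexp (k * P z)) (G z)
      rw [norm_sub_rev] at this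
      linarith
    have g7 : 1 - k * L * δ ≤ ‖cexp (k * P z)‖ := by
      rw [Complex.norm_exp]
      have h1 := hPL z (ball_subset_ball (by linarith) (bz2 (mem_ball_self δp)))
      rw [← dist_eq_norm, ← hqd'] at h1
      have h2 : -(L * δ) ≤ (P z).re := by
        have := (abs_le.1 (abs_re_le_norm (P z))).1
        linarith
      have h3 : ((k:ℂ) * P z).re = k * (P z).re := by simp
      rw [h3]
      have := Real.add_one_le_exp (k * (P z).re)
      have := mul_le_mul_of_nonneg_left h2 k0
      linarith
    rw [norm_mul] at g6
    have := mul_le_mul_of_nonneg_left g7 (norm_nonneg (f z))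
    linarith
  have sup : √(J0 (Ω ∩ V) z) * (1 - k * L * δ) - C0 * δ ≤ s := by
    have b0 : 0 ≤ C0 * δ := by positivity
    rcases le_or_gt (1 - k * L * δ) 0 with ha | ha
    · linarith [mul_nonpos_of_nonneg_of_nonpos (Real.sqrt_nonneg (J0 (Ω ∩ V) z)) ha]
    · have : J0 (Ω ∩ V) z ≤ ((s + C0 * δ) / (1 - k * L * δ)) ^ 2 := by
        refine csSup_le ⟨0, fun _ => 0, differentiableOn_const _, by simp [L2normSq], by simp⟩ ?_
        rintro v ⟨f, f1, f2, rfl⟩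
        have := each f f1 f2
        gcongr
        rw [le_div_iff₀ ha]
        linarith
      have h2 := (Real.sqrt_le_left (by positivity)).2 this
      rw [le_div_iff₀ ha] at h2
      linarith
  have fin := arith (y := C1 * δ * ℓ) s0 mp Jm (by positivity) sup (by
    have e1 : 1 - (1 - k * L * δ) + C0 * δ / √m = (n + 1) / c1 * L * δ * ℓ + C0 / √m * δ := by rw [hk]; ring
    rw [e1, hC1]
    have : C0 / √m * δ * 1 ≤ C0 / √m * δ * ℓ := by gcongr
    linarith) (by positivity)
  rw [hs, Real.sq_sqrt JΩ0] at fin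
  refine le_trans (le_of_eq ?_) fin
  rw [hℓ]
  ring

end Loc
end

/-- Localization of `J⁰` near a `C²`-smooth strictly pseudoconvex boundary
point of a pseudoconvex domain. -/
theorem localization_J0 (n : ℕ) (Ω : Set (Cn n)) (hpsc : IsPseudoconvex Ω) (hconn : IsConnected Ω)
    (p : Cn n) (hp : IsStrictPscPtC2 Ω p)
    (V : Set (Cn n)) (hV : V ∈ nhds p) (hVbdd : Bornology.IsBounded V) :
    ∃ (U : Set (Cn n)) (C : ℝ), U ⊆ V ∧ U ∈ nhds p ∧ 0 < C ∧
      ∀ z ∈ Ω ∩ U,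
        J0 Ω z / J0 (Ω ∩ V) z ≤ 1 ∧ 1 + C * bdist Ω z * Real.log (bdist Ω z) ≤ J0 Ω z / J0 (Ω ∩ V) z := by
  exact Loc.main_aux hpsc hp hV hVbdd

end
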